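/- Let d and n be integers with 3 ≤ d ≤ n, n odd and d even. Let R be a non-negatively graded Gorenstein ring with R_0 a local Cohen-Macaulay ring, with maximal homogeneous ideal 𝔪 and dim R = d. Let φ be an n×n alternating matrix of linear forms from R and I = Pf_{n−1}(φ). Assume I has height three and satisfies: n − i ≤ ht I_i(φ) for all i with n − d ≤ i ≤ n − 1. Then: (a) the annihilator of H^0_𝔪(Sym_{d−1}(I)) equals Pf_{n−d+1}(φ); and (b) if R is a standard graded polynomial ring over a field, then Pf_{n−d+1}(φ) = 𝔪^{(n−d+1)/2}. -/

import Mathlib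

/-!
Statement 16 (Lemma `Apr10` of the paper).

`3 ≤ d ≤ n`, `n` odd, `d` even; `R` a non-negatively graded Gorenstein ring with
`R₀ = 𝒜 0` a local Cohen–Macaulay ring, maximal homogeneous ideal `𝔪`, `dim R = d`;
`φ` an `n × n` alternating matrix of linear forms and `I = Pf_{n-1}(φ)`; `I` has
height three and `n − i ≤ ht I_i(φ)` for `n − d ≤ i ≤ n − 1`.  Then
(a) `ann_R H⁰_𝔪(Sym_{d-1}(I)) = Pf_{n-d+1}(φ)`, and
(b) if `R` is a standard graded polynomial ring over a field, then
    `Pf_{n-d+1}(φ) = 𝔪^{(n-d+1)/2}`.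

"Gorenstein" is rendered as Cohen–Macaulay (depth `𝔪` equal to `d`) of type one;
the Pfaffian is defined recursively by expansion along the first row; `Sym_{d-1}` is
the symmetric power (a quotient of the tensor power).
-/

open CategoryTheory
open scoped TensorProduct

noncomputable section
namespace Paper

variable {R : Type} [CommRing R]

abbrev extModule (R : Type) [CommRing R] (A B : Type) [AddCommGroup A] [Module R A]
    [AddCommGroup B] [Module R B] (n : ℕ) : Type :=
  ((Ext R (ModuleCat R) n).obj (Opposite.op (ModuleCat.of R A))).obj (ModuleCat.of R B)

def maxHomIdeal (𝒜 : ℤ → AddSubgroup R) [GradedRing 𝒜] : Ideal R :=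
  Ideal.span ({ r : R | ∃ h : r ∈ 𝒜 0, ¬ IsUnit (⟨r, h⟩ : 𝒜 0) } ∪
    ⋃ (i : ℤ) (_ : i ≠ 0), (𝒜 i : Set R))

def depthGE (I : Ideal R) (N : Type) [AddCommGroup N] [Module R N] (k : ℕ) : Prop :=
  Subsingleton N ∨ ∃ rs : List R, rs.length = k ∧ (∀ r ∈ rs, r ∈ I) ∧
    RingTheory.Sequence.IsRegular N rs

def torsionSubmodule (I : Ideal R) (M : Type) [AddCommGroup M] [Module R M] :
    Submodule R M where
  carrier := { x | ∃ t : ℕ, ∀ r ∈ I ^ t, r • x = 0 }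
  zero_mem' := ⟨0, fun r _ => smul_zero r⟩
  add_mem' := by
    rintro a b ⟨t, ht⟩ ⟨m, hm⟩
    refine ⟨t + m, fun r hr => ?_⟩
    have h1 : r ∈ I ^ t := Ideal.pow_le_pow_right (Nat.le_add_right t m) hr
    have h2 : r ∈ I ^ m := Ideal.pow_le_pow_right (Nat.le_add_left m t) hr
    rw [smul_add, ht r h1, hm r h2, add_zero]
  smul_mem' := by
    rintro c x ⟨t, ht⟩
    exact ⟨t, fun r hr => by rw [smul_comm, ht r hr, smul_zero]⟩

/-- The Pfaffian of an `n × n` (alternating) matrix, by expansion along the first row. -/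
def pf : (n : ℕ) → Matrix (Fin n) (Fin n) R → R
  | 0, _ => 1
  | 1, _ => 0
  | (n + 2), A =>
    ∑ j : Fin (n + 1),
      (-1 : R) ^ (j : ℕ) * A 0 j.succ *
        pf n (A.submatrix (fun i => Fin.succ (j.succAbove i))
          (fun i => Fin.succ (j.succAbove i)))

/-- `Pf_r(A)`: the ideal generated by the Pfaffians of the principal `r × r`
submatrices of `A`. -/
def pfaffianIdeal (n r : ℕ) (A : Matrix (Fin n) (Fin n) R) : Ideal R :=
  Ideal.span { x | ∃ (S : Finset (Fin n)) (h : S.card = r),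
    x = pf r (A.submatrix (S.orderEmbOfFin h) (S.orderEmbOfFin h)) }

/-- `I_r(A)`: the ideal generated by the `r × r` minors of `A`. -/
def minorsIdeal (n r : ℕ) (A : Matrix (Fin n) (Fin n) R) : Ideal R :=
  Ideal.span { x | ∃ f g : Fin r → Fin n, x = (A.submatrix f g).det }

/-- The height of an ideal. -/
def idealHeight (I : Ideal R) : ℕ∞ :=
  ⨅ (𝔭 : PrimeSpectrum R) (_ : I ≤ 𝔭.asIdeal), Order.height 𝔭

def IsAlternating {n : ℕ} (A : Matrix (Fin n) (Fin n) R) : Prop :=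
  (∀ i, A i i = 0) ∧ ∀ i j, A j i = - A i j

/-- `Sym^m Q`, the `m`-th symmetric power of the module `Q`. -/
abbrev SymPow (Q : Type) [AddCommGroup Q] [Module R Q] (m : ℕ) : Type :=
  (⨂[R]^m Q) ⧸ (Submodule.span R { x : ⨂[R]^m Q |
    ∃ (v : Fin m → Q) (σ : Equiv.Perm (Fin m)),
      x = (PiTensorProduct.tprod R v) - (PiTensorProduct.tprod R (v ∘ σ)) })

end Paper

namespace Paper

/-! ### Chains of liftings along a weakly regular sequence -/

section Chains

variable {R : Type} [CommRing R]

/-- The ideal generated by the first `s` terms of a sequence. -/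
def initIdeal (a : ℕ → R) : ℕ → Ideal R
  | 0 => ⊥
  | s + 1 => initIdeal a s ⊔ Ideal.span {a s}

lemma initIdeal_le_succ (a : ℕ → R) (s : ℕ) : initIdeal a s ≤ initIdeal a (s + 1) := le_sup_left

lemma initIdeal_mono (a : ℕ → R) {s t : ℕ} (h : s ≤ t) : initIdeal a s ≤ initIdeal a t :=
  monotone_nat_of_le_succ (initIdeal_le_succ a) h

lemma mem_initIdeal (a : ℕ → R) {s t : ℕ} (h : s < t) : a s ∈ initIdeal a t :=
  initIdeal_mono a h (Ideal.mem_sup_right (Ideal.mem_span_singleton_self _))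

lemma initIdeal_le (a : ℕ → R) {s : ℕ} {J : Ideal R} (h : ∀ i < s, a i ∈ J) :
    initIdeal a s ≤ J := by
  induction s with
  | zero => exact bot_le
  | succ s ih =>
    refine sup_le (ih fun i hi => h i (by omega)) ?_
    rw [Ideal.span_singleton_le_iff_mem]
    exact h s (by omega)

/-- `𝔟_s M`, where `𝔟_s` is generated by the first `s` terms of `a`. -/
def initSub (a : ℕ → R) (M : Type) [AddCommGroup M] [Module R M] (s : ℕ) : Submodule R M :=
  initIdeal a s • ⊤

section

variable {M N : Type} [AddCommGroup M] [Module R M] [AddCommGroup N] [Module R N]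

lemma initSub_zero (a : ℕ → R) : initSub a M 0 = ⊥ := by
  simp [initSub, initIdeal]

lemma mem_initSub_succ {a : ℕ → R} {s : ℕ} {y : M} :
    y ∈ initSub a M (s + 1) ↔ ∃ v, y - a s • v ∈ initSub a M s := by
  have : initSub a M (s + 1) = initSub a M s ⊔ Submodule.map (a s • LinearMap.id) ⊤ := by
    simp only [initSub, initIdeal, Submodule.sup_smul]
    congr 1
    ext x
    simp [Submodule.ideal_span_singleton_smul,
      Submodule.mem_smul_pointwise_iff_exists]
  rw [this, Submodule.mem_sup]
  constructor
  · rintro ⟨u, hu, v, ⟨w, -, rfl⟩, rfl⟩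
    exact ⟨w, by simpa using hu⟩
  · rintro ⟨v, hv⟩
    exact ⟨_, hv, a s • v, ⟨v, trivial, by simp⟩, by simp⟩

lemma initSub_mono (a : ℕ → R) {s t : ℕ} (h : s ≤ t) : initSub a M s ≤ initSub a M t :=
  Submodule.smul_mono_left (initIdeal_mono a h)

lemma smul_mem_initSub (a : ℕ → R) {s t : ℕ} (h : s < t) (y : M) : a s • y ∈ initSub a M t :=
  Submodule.smul_mem_smul (mem_initIdeal a h) trivial

lemma map_mem_initSub {a : ℕ → R} {s : ℕ} (f : M →ₗ[R] N) {y : M} (h : y ∈ initSub a M s) :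
    f y ∈ initSub a N s := by
  refine Submodule.smul_induction_on h (fun r hr n _ => ?_) fun x y hx hy => ?_
  · rw [map_smul]; exact Submodule.smul_mem_smul hr trivial
  · rw [map_add]; exact add_mem hx hy

end

/-- The first `r` terms of `a` form a weakly regular sequence on `M`. -/
def WReg (a : ℕ → R) (M : Type) [AddCommGroup M] [Module R M] (r : ℕ) : Prop :=
  ∀ s < r, ∀ y : M, a s • y ∈ initSub a M s → y ∈ initSub a M s

variable {E : ℕ → Type} [∀ i, AddCommGroup (E i)] [∀ i, Module R (E i)]
  (d : ∀ i, E (i + 1) →ₗ[R] E i) (a : ℕ → R)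

/-- Exactness of a complex at position `i + 1`. -/
def ExactAt (i : ℕ) : Prop := ∀ y, d i y = 0 → y ∈ LinearMap.range (d (i + 1))

/-- Exactness at position `i + 1` modulo the first `s` terms of `a`. -/
def ExactMod (s i : ℕ) : Prop :=
  ∀ y, d i y ∈ initSub a (E i) s → y ∈ LinearMap.range (d (i + 1)) ⊔ initSub a (E (i + 1)) s

/-- A sequence of liftings along a complex. -/
def Chain (k : ℕ) (w : ∀ i, E i) : Prop :=
  ∀ i < k, a i • w i - d i (w (i + 1)) ∈ initSub a (E i) i

variable {d a}

lemma exactMod_of_exactAt (hdd : ∀ i x, d i (d (i + 1) x) = 0) {r : ℕ}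
    (hreg : ∀ i, WReg a (E i) r) (s : ℕ) (hs : s ≤ r) (i : ℕ) (hsi : s ≤ i)
    (hex : ∀ j, j ≤ i → i ≤ j + s → ExactAt d j) : ExactMod d a s i := by
  induction s generalizing i with
  | zero =>
    intro y hy
    rw [initSub_zero, Submodule.mem_bot] at hy
    exact Submodule.mem_sup_left (hex i le_rfl le_rfl y hy)
  | succ s ih =>
    obtain ⟨i, rfl⟩ : ∃ i', i = i' + 1 := ⟨i - 1, by omega⟩
    intro y hy
    obtain ⟨w, hw⟩ := mem_initSub_succ.1 hy
    have h1 : a s • d i w ∈ initSub a (E i) s := by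
      have := neg_mem (map_mem_initSub (d i) hw)
      simpa [hdd] using this
    have h2 := ih (by omega) i (by omega) (fun j hj hj' => hex j (by omega) (by omega)) w
      (hreg i s (by omega) _ h1)
    obtain ⟨_, ⟨w', rfl⟩, v', hv', rfl⟩ := Submodule.mem_sup.1 h2
    have h3 : d (i + 1) (y - a s • w') ∈ initSub a (E (i + 1)) s := by
      have := add_mem hw (Submodule.smul_mem _ (a s) hv')
      convert this using 1
      simp only [map_sub, map_smul, smul_add]
      abel
    have h4 := ih (by omega) (i + 1) (by omega) (fun j hj hj' => hex j hj (by omega)) _ h3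
    have h5 : a s • w' ∈ LinearMap.range (d (i + 1 + 1)) ⊔ initSub a (E (i + 1 + 1)) (s + 1) :=
      Submodule.mem_sup_right (smul_mem_initSub a (Nat.lt_succ_self s) _)
    have h6 := (sup_le_sup_left (initSub_mono (M := E (i + 1 + 1)) a (Nat.le_succ s))
      (LinearMap.range (d (i + 1 + 1)))) h4
    simpa using add_mem h6 h5

lemma exists_chain (r : ℕ) (hU : ∀ i, i + 1 < r → ExactMod d a i i)
    (m : E 0) (hm : ∀ i < r, a i • m ∈ LinearMap.range (d 0)) :
    ∃ w : ∀ i, E i, w 0 = m ∧ Chain d a r w := by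
  have key : ∀ k, k < r → ∃ w : ∀ i, E i, w 0 = m ∧ Chain d a k w ∧
      ∀ j < r, a j • w k ∈ LinearMap.range (d k) ⊔ initSub a (E k) k := by
    intro k
    induction k with
    | zero =>
      intro _
      refine ⟨Function.update (fun _ => 0) 0 m, by simp, fun i hi => by omega, fun j hj => ?_⟩
      simpa using Submodule.mem_sup_left (hm j hj)
    | succ k ih =>
      intro hk
      obtain ⟨w, hw0, hw, hinv⟩ := ih (by omega)
      obtain ⟨_, ⟨u, rfl⟩, v, hv, huv⟩ := Submodule.mem_sup.1 (hinv k (by omega))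
      refine ⟨Function.update w (k + 1) u, by simpa using hw0, fun i hi => ?_, fun j hj => ?_⟩
      · rcases Nat.lt_succ_iff_lt_or_eq.1 hi with h | rfl
        · rw [Function.update_of_ne (by omega), Function.update_of_ne (by omega)]
          exact hw i h
        · rw [Function.update_of_ne (by omega), Function.update_self, ← huv]
          simpa using hv
      · rw [Function.update_self]
        obtain ⟨_, ⟨u', rfl⟩, v', hv', huv'⟩ := Submodule.mem_sup.1 (hinv j hj)
        have h3 : d k (a j • u - a k • u') ∈ initSub a (E k) k := by
          have := sub_mem (Submodule.smul_mem _ (a k) hv') (Submodule.smul_mem _ (a j) hv)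
          convert this using 1
          have e1 : d k u = a k • w k - v := by rw [← huv]; abel
          have e2 : d k u' = a j • w k - v' := by rw [← huv']; abel
          simp only [map_sub, map_smul, e1, e2, smul_sub]
          rw [smul_comm (a j) (a k)]
          abel
        have h4 := hU k (by omega) _ h3
        have h5 : a k • u' ∈ LinearMap.range (d (k + 1)) ⊔ initSub a (E (k + 1)) (k + 1) :=
          Submodule.mem_sup_right (smul_mem_initSub a (Nat.lt_succ_self k) _)
        have h6 := (sup_le_sup_left (initSub_mono (M := E (k + 1)) a (Nat.le_succ k))
          (LinearMap.range (d (k + 1)))) h4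
        simpa using add_mem h6 h5
  rcases Nat.eq_zero_or_pos r with rfl | hr
  · exact ⟨Function.update (fun _ => 0) 0 m, by simp, fun i hi => by omega⟩
  obtain ⟨k, rfl⟩ : ∃ k, r = k + 1 := ⟨r - 1, by omega⟩
  obtain ⟨w, hw0, hw, hinv⟩ := key k (by omega)
  obtain ⟨_, ⟨u, rfl⟩, v, hv, huv⟩ := Submodule.mem_sup.1 (hinv k (by omega))
  refine ⟨Function.update w (k + 1) u, by simpa using hw0, fun i hi => ?_⟩
  rcases Nat.lt_succ_iff_lt_or_eq.1 hi with h | rfl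
  · rw [Function.update_of_ne (by omega), Function.update_of_ne (by omega)]
    exact hw i h
  · rw [Function.update_of_ne (by omega), Function.update_self, ← huv]
    simpa using hv

lemma Chain.smul {k : ℕ} {w : ∀ i, E i} (h : Chain d a k w) (r : R) :
    Chain d a k (fun i => r • w i) := by
  intro i hi
  have := Submodule.smul_mem _ r (h i hi)
  rwa [smul_sub, smul_comm, ← map_smul] at this

lemma Chain.mem_range_of_last (hdd : ∀ i x, d i (d (i + 1) x) = 0) {k : ℕ} {w : ∀ i, E i}
    (h : Chain d a k w) (hreg : ∀ i, WReg a (E i) k)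
    (hk : w k ∈ LinearMap.range (d k) ⊔ initSub a (E k) k) :
    w 0 ∈ LinearMap.range (d 0) := by
  induction k with
  | zero => simpa [initSub_zero] using hk
  | succ k ih =>
    refine ih (fun i hi => h i (by omega)) (fun i s hs => hreg i s (by omega)) ?_
    obtain ⟨_, ⟨u, rfl⟩, v, hv, huv⟩ := Submodule.mem_sup.1 hk
    obtain ⟨t, ht⟩ := mem_initSub_succ.1 hv
    have h1 : a k • (w k - d k t) ∈ initSub a (E k) k := by
      have := add_mem (h k (by omega)) (map_mem_initSub (d k) ht)
      convert this using 1
      have e1 : d k v = d k (w (k + 1)) := by rw [← huv, map_add, hdd, zero_add]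
      simp only [map_sub, map_smul, e1, smul_sub]
      abel
    have h2 := hreg k k (by omega) _ h1
    exact Submodule.mem_sup.2 ⟨_, ⟨t, rfl⟩, _, h2, by abel⟩

lemma exists_chain_of_last (hdd : ∀ i x, d i (d (i + 1) x) = 0) {k : ℕ}
    (hreg : ∀ i, WReg a (E i) (k + 1)) (y : E (k + 1))
    (hy : d k y ∈ initSub a (E k) (k + 1)) :
    ∃ w : ∀ i, E i, w (k + 1) = y ∧ Chain d a (k + 1) w := by
  induction k with
  | zero =>
    obtain ⟨t, ht⟩ := mem_initSub_succ.1 hy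
    refine ⟨Function.update (Function.update (fun _ => 0) 0 t) 1 y, by simp, fun i hi => ?_⟩
    obtain rfl : i = 0 := by omega
    rw [Function.update_of_ne (by omega), Function.update_self, Function.update_self]
    simpa using neg_mem ht
  | succ k ih =>
    obtain ⟨t, ht⟩ := mem_initSub_succ.1 hy
    have h1 : a (k + 1) • d k t ∈ initSub a (E k) (k + 1) := by
      have := neg_mem (map_mem_initSub (d k) ht)
      simpa [hdd] using this
    have h2 := hreg k (k + 1) (by omega) _ h1
    obtain ⟨w, hw, hc⟩ := ih (fun i s hs => hreg i s (by omega)) t h2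
    refine ⟨Function.update w (k + 1 + 1) y, by simp, fun i hi => ?_⟩
    rcases Nat.lt_succ_iff_lt_or_eq.1 hi with h | rfl
    · rw [Function.update_of_ne (by omega), Function.update_of_ne (by omega)]
      exact hc i h
    · rw [Function.update_of_ne (by omega), Function.update_self, hw]
      simpa using neg_mem ht

lemma Chain.last_mem {k : ℕ} {w : ∀ i, E i}
    (h : Chain d a k w) (hU : ∀ i < k, ExactMod d a i i)
    (hm : w 0 ∈ LinearMap.range (d 0)) :
    w k ∈ LinearMap.range (d k) ⊔ initSub a (E k) k := by
  induction k with
  | zero => exact Submodule.mem_sup_left hm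
  | succ k ih =>
    obtain ⟨_, ⟨u, rfl⟩, v, hv, huv⟩ := Submodule.mem_sup.1
      (ih (fun i hi => h i (by omega)) (fun i hi => hU i (by omega)))
    have h1 : d k (w (k + 1) - a k • u) ∈ initSub a (E k) k := by
      have := sub_mem (Submodule.smul_mem _ (a k) hv) (h k (by omega))
      convert this using 1
      have e1 : d k u = w k - v := by rw [← huv]; abel
      simp only [map_sub, map_smul, e1, smul_sub]
      abel
    have h2 := hU k (by omega) _ h1
    have h6 := (sup_le_sup_left (initSub_mono (M := E (k + 1)) a (Nat.le_succ k))
          (LinearMap.range (d (k + 1)))) h2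
    have h5 : a k • u ∈ LinearMap.range (d (k + 1)) ⊔ initSub a (E (k + 1)) (k + 1) :=
      Submodule.mem_sup_right (smul_mem_initSub a (Nat.lt_succ_self k) _)
    simpa using add_mem h6 h5

lemma mem_of_pow_smul_mem {M : Type} [AddCommGroup M] [Module R M] (D : Submodule R M) (a : ℕ → R)
    (r : ℕ) (hD : ∀ m, (∀ i < r, a i • m ∈ D) → m ∈ D) (m : M)
    (hm : ∀ i < r, ∃ N : ℕ, a i ^ N • m ∈ D) : m ∈ D := by
  have key : ∀ (N : ℕ) (e : ℕ → ℕ), ∑ i ∈ Finset.range r, e i = N →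
      ∀ m, (∀ i < r, a i ^ e i • m ∈ D) → m ∈ D := by
    intro N
    induction N with
    | zero =>
      intro e he m hm
      refine hD m fun i hi => ?_
      have : e i = 0 := (Finset.sum_eq_zero_iff.1 he) i (Finset.mem_range.2 hi)
      have h := hm i hi
      rw [this, pow_zero, one_smul] at h
      exact D.smul_mem _ h
    | succ N ih =>
      intro e he m hm
      refine hD m fun i hi => ?_
      rcases Nat.eq_zero_or_pos (e i) with h0 | h0
      · have h := hm i hi
        rw [h0, pow_zero, one_smul] at h
        exact D.smul_mem _ h
      · refine ih (Function.update e i (e i - 1)) ?_ _ fun j hj => ?_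
        · rw [Finset.sum_update_of_mem (Finset.mem_range.2 hi)]
          rw [Finset.sum_eq_add_sum_sdiff_singleton_of_mem (Finset.mem_range.2 hi)] at he
          omega
        · by_cases hji : j = i
          · subst hji
            rw [Function.update_self, smul_smul, ← pow_succ, Nat.sub_add_cancel h0]
            exact hm j hj
          · rw [Function.update_of_ne hji, smul_comm]
            exact D.smul_mem _ (hm j hj)
  choose! e he using hm
  exact key _ e rfl m he

/-- The acyclicity lemma. -/
lemma exactAt_of_pow_smul_mem (hdd : ∀ i x, d i (d (i + 1) x) = 0) (p : ℕ)
    (hreg : ∀ i, WReg a (E i) (p + 1))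
    (hex : ∀ i < p, ExactAt d i) (hp : ExactMod d a (p + 1) p)
    (m : E 0) (hm : ∀ i < p + 1, ∃ N : ℕ, a i ^ N • m ∈ LinearMap.range (d 0)) :
    m ∈ LinearMap.range (d 0) := by
  refine mem_of_pow_smul_mem _ a (p + 1) (fun m hm => ?_) m hm
  obtain ⟨w, rfl, hw⟩ := exists_chain (d := d) (a := a) (p + 1)
    (fun i hi => exactMod_of_exactAt hdd hreg i (by omega) i le_rfl
      (fun j hj _ => hex j (by omega))) m hm
  refine hw.mem_range_of_last hdd hreg (hp _ ?_)
  have h1 := hw p (by omega)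
  have h2 : a p • w p ∈ initSub a (E p) (p + 1) := smul_mem_initSub a (by omega) _
  have h3 := sub_mem h2 (initSub_mono a (Nat.le_succ p) h1)
  simpa using h3

end Chains

/-! ### Clifford-type operators on functions on finite subsets -/

section Fock

set_option linter.unusedSectionVars false

variable {ι : Type} [Fintype ι] [LinearOrder ι]

/-- The sign of moving `j` past the smaller elements of `B`. -/
def sgn (S : Type) [CommRing S] (j : ι) (B : Finset ι) : S := (-1) ^ (B.filter (· < j)).card

/-- Toggle membership of `j` in `B`. -/
def flip (j : ι) (B : Finset ι) : Finset ι := if j ∈ B then B.erase j else insert j B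

lemma mem_flip_self {j : ι} {B : Finset ι} : j ∈ flip j B ↔ j ∉ B := by
  unfold flip; split_ifs <;> simp [*]

lemma mem_flip_of_ne {j k : ι} {B : Finset ι} (h : k ≠ j) : k ∈ flip j B ↔ k ∈ B := by
  unfold flip; split_ifs <;> simp [h]

lemma flip_flip (j : ι) (B : Finset ι) : flip j (flip j B) = B := by
  ext k
  by_cases h : k = j
  · subst h; simp [mem_flip_self]
  · simp [mem_flip_of_ne h]

lemma flip_comm (j k : ι) (B : Finset ι) : flip j (flip k B) = flip k (flip j B) := by
  by_cases hjk : j = k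
  · rw [hjk]
  ext b
  by_cases hj : b = j
  · subst hj
    simp [mem_flip_self, mem_flip_of_ne hjk]
  · by_cases hk : b = k
    · subst hk
      simp [mem_flip_self, mem_flip_of_ne hj]
    · simp [mem_flip_of_ne hj, mem_flip_of_ne hk]

lemma flip_of_mem {j : ι} {B : Finset ι} (h : j ∈ B) : flip j B = B.erase j := if_pos h

lemma flip_of_notMem {j : ι} {B : Finset ι} (h : j ∉ B) : flip j B = insert j B := if_neg h

lemma card_flip_of_mem {j : ι} {B : Finset ι} (h : j ∈ B) : (flip j B).card + 1 = B.card := by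
  rw [flip_of_mem h, Finset.card_erase_add_one h]

lemma card_flip_of_notMem {j : ι} {B : Finset ι} (h : j ∉ B) :
    (flip j B).card = B.card + 1 := by
  rw [flip_of_notMem h, Finset.card_insert_of_notMem h]

lemma card_flip_le (j : ι) (B : Finset ι) : (flip j B).card ≤ B.card + 1 := by
  by_cases h : j ∈ B
  · have := card_flip_of_mem h; omega
  · exact (card_flip_of_notMem h).le

variable {S : Type} [CommRing S]

lemma sgn_mul_self (j : ι) (B : Finset ι) : sgn S j B * sgn S j B = 1 := by
  unfold sgn; rw [← mul_pow]; simp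

lemma sgn_flip_self (j : ι) (B : Finset ι) : sgn S j (flip j B) = sgn S j B := by
  unfold sgn
  congr 2
  ext k
  simp only [Finset.mem_filter, and_congr_left_iff]
  intro h
  exact mem_flip_of_ne h.ne

lemma sgn_flip_of_lt {j k : ι} (h : j < k) (B : Finset ι) :
    sgn S j (flip k B) = sgn S j B := by
  unfold sgn
  congr 2
  ext b
  simp only [Finset.mem_filter, and_congr_left_iff]
  intro hb
  exact mem_flip_of_ne (hb.trans h).ne

lemma sgn_flip_of_gt {j k : ι} (h : k < j) (B : Finset ι) :
    sgn S j (flip k B) = - sgn S j B := by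
  have key : ∀ B : Finset ι, k ∉ B → sgn S j (insert k B) = - sgn S j B := by
    intro B hB
    unfold sgn
    rw [Finset.filter_insert, if_pos h, Finset.card_insert_of_notMem (by simp [hB]), pow_succ]
    ring
  by_cases hk : k ∈ B
  · rw [flip_of_mem hk]
    have := key (B.erase k) (by simp)
    rw [Finset.insert_erase hk] at this
    rw [this, neg_neg]
  · rw [flip_of_notMem hk, key B hk]

/-- The operator `∑ b, (c b true) e_b + (c b false) ε_b`, where `e_b` and `ε_b` are exterior
multiplication and contraction. -/
def gd (c : ι → Bool → S) : (Finset ι → S) →ₗ[S] (Finset ι → S) where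
  toFun x B := ∑ b, sgn S b B * c b (decide (b ∈ B)) * x (flip b B)
  map_add' x y := by
    funext B; simp [mul_add, Finset.sum_add_distrib]
  map_smul' r x := by
    funext B; simp only [Pi.smul_apply, smul_eq_mul, RingHom.id_apply, Finset.mul_sum]
    exact Finset.sum_congr rfl fun b _ => by ring

lemma gd_apply (c : ι → Bool → S) (x : Finset ι → S) (B : Finset ι) :
    gd c x B = ∑ b, sgn S b B * c b (decide (b ∈ B)) * x (flip b B) := rfl

lemma gd_add (c c' : ι → Bool → S) (x : Finset ι → S) :
    gd (c + c') x = gd c x + gd c' x := by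
  funext B
  simp [gd_apply, mul_add, add_mul, Finset.sum_add_distrib]

lemma sum_sum_eq_diag {M : Type} [AddCommGroup M] (h : ι → ι → M)
    (hh : ∀ b b', b ≠ b' → h b b' + h b' b = 0) : ∑ b, ∑ b', h b b' = ∑ b, h b b := by
  have h1 : ∀ s : Finset ι, ∑ b ∈ s, ∑ b' ∈ s, h b b' = ∑ b ∈ s, h b b := by
    intro s
    induction s using Finset.induction_on with
    | empty => simp
    | insert a s ha ih =>
      rw [Finset.sum_insert ha, Finset.sum_insert ha, Finset.sum_insert ha]
      have : ∑ b ∈ s, ∑ b' ∈ insert a s, h b b' = ∑ b ∈ s, h b a + ∑ b ∈ s, h b b := by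
        rw [← ih, ← Finset.sum_add_distrib]
        exact Finset.sum_congr rfl fun b _ => by rw [Finset.sum_insert ha]
      rw [this]
      have h2 : ∑ b' ∈ s, h a b' + ∑ b ∈ s, h b a = 0 := by
        rw [← Finset.sum_add_distrib]
        exact Finset.sum_eq_zero fun b hb => hh _ _ (by rintro rfl; exact ha hb)
      rw [← add_assoc, add_assoc (h a a), h2, add_zero]
  exact h1 Finset.univ

lemma gd_gd (c : ι → Bool → S) (x : Finset ι → S) :
    gd c (gd c x) = (∑ b, c b true * c b false) • x := by
  funext B
  simp only [gd_apply, Finset.mul_sum]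
  rw [sum_sum_eq_diag]
  · simp only [Pi.smul_apply, smul_eq_mul, Finset.sum_mul]
    refine Finset.sum_congr rfl fun b _ => ?_
    rw [flip_flip, sgn_flip_self]
    have h1 := sgn_mul_self (S := S) b B
    by_cases hb : b ∈ B
    · have : b ∉ flip b B := by simp [mem_flip_self, hb]
      simp only [hb, this, decide_true, decide_false]
      linear_combination c b true * c b false * x B * h1
    · have : b ∈ flip b B := by simp [mem_flip_self, hb]
      simp only [hb, this, decide_true, decide_false]
      linear_combination c b true * c b false * x B * h1
  · intro b b' hbb'
    rw [flip_comm b' b]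
    have e1 : decide (b' ∈ flip b B) = decide (b' ∈ B) := by
      simp only [mem_flip_of_ne hbb'.symm]
    have e2 : decide (b ∈ flip b' B) = decide (b ∈ B) := by
      simp only [mem_flip_of_ne hbb']
    rw [e1, e2]
    rcases lt_or_gt_of_ne hbb' with h | h
    · rw [sgn_flip_of_lt h, sgn_flip_of_gt h]; ring
    · rw [sgn_flip_of_lt h, sgn_flip_of_gt h]; ring

/-- Elimination of one coefficient of the operator `gd c`. -/
lemma gd_eliminate (c : ι → Bool → S) (hc : ∑ b, c b true * c b false = 0) (j : ι) (s : Bool)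
    (Z : Finset ι) (𝔞 : Ideal S) (hZ : ∀ z ∈ Z, c z s ∈ 𝔞)
    (hnzd : ∀ u, c j s * u ∈ 𝔞 → u ∈ 𝔞) (hjZ : j ∉ Z) (L L' : Finset ι → Prop)
    (hL : ∀ B, L B → decide (j ∈ B) ≠ s → L' (flip j B)) (hL' : ∀ B b, L' B → L (flip b B))
    (x : Finset ι → S)
    (hx : ∀ B, L' B → (∀ z ∈ Z, decide (z ∈ B) = s) → gd c x B ∈ 𝔞)
    (hx0 : ∀ B, L B → (∀ z ∈ Z, decide (z ∈ B) = s) → decide (j ∈ B) = s →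
      ∃ v, x B - c j s * v ∈ 𝔞) :
    ∃ y, ∀ B, L B → (∀ z ∈ Z, decide (z ∈ B) = s) → (x - gd c y) B ∈ 𝔞 := by
  classical
  have hflip : ∀ B : Finset ι, decide (j ∈ B) ≠ s → decide (j ∈ flip j B) = s := by
    intro B h
    cases s <;> simp_all [mem_flip_self]
  have hflip' : ∀ B : Finset ι, decide (j ∈ B) = s → decide (j ∈ flip j B) ≠ s := by
    intro B h
    cases s <;> simp_all [mem_flip_self]
  choose! v hv using hx0
  let y : Finset ι → S := fun B => if decide (j ∈ B) = s then 0 else sgn S j B * v (flip j B)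
  have hy : ∀ B, decide (j ∈ B) = s → gd c y B = c j s * v B := by
    intro B hB
    rw [gd_apply, Finset.sum_eq_single j]
    · have : y (flip j B) = sgn S j B * v B := by
        simp only [y, if_neg (hflip' B hB), flip_flip, sgn_flip_self]
      rw [this, hB]
      linear_combination c j s * v B * sgn_mul_self (S := S) j B
    · intro b _ hb
      have : y (flip b B) = 0 := by
        simp only [y]
        rw [if_pos]
        simpa only [mem_flip_of_ne hb.symm] using hB
      rw [this, mul_zero]
    · simp
  refine ⟨y, ?_⟩
  have case1 : ∀ B, L B → (∀ z ∈ Z, decide (z ∈ B) = s) → decide (j ∈ B) = s →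
      (x - gd c y) B ∈ 𝔞 := by
    intro B h1 h2 h3
    rw [Pi.sub_apply, hy B h3]
    exact hv B h1 h2 h3
  intro B h1 h2
  by_cases h3 : decide (j ∈ B) = s
  · exact case1 B h1 h2 h3
  have hZ' : ∀ z ∈ Z, decide (z ∈ flip j B) = s := by
    intro z hz
    have : z ≠ j := by rintro rfl; exact hjZ hz
    simpa only [mem_flip_of_ne this] using h2 z hz
  have h4 := hx _ (hL B h1 h3) hZ'
  have h5 : gd c (x - gd c y) (flip j B) ∈ 𝔞 := by
    rw [map_sub, gd_gd, hc, zero_smul, sub_zero]; exact h4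
  rw [gd_apply, ← Finset.add_sum_erase _ _ (Finset.mem_univ j)] at h5
  have h6 : ∑ b ∈ Finset.univ.erase j, sgn S b (flip j B) * c b (decide (b ∈ flip j B)) *
      (x - gd c y) (flip b (flip j B)) ∈ 𝔞 := by
    refine Ideal.sum_mem _ fun b hb => ?_
    have hbj : b ≠ j := (Finset.mem_erase.1 hb).1
    by_cases hbZ : b ∈ Z
    · rw [hZ' b hbZ]
      exact Ideal.mul_mem_right _ _ (Ideal.mul_mem_left _ _ (hZ b hbZ))
    · refine Ideal.mul_mem_left _ _ (case1 _ (hL' _ _ (hL B h1 h3)) (fun z hz => ?_) ?_)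
      · have : z ≠ b := by rintro rfl; exact hbZ hz
        simpa only [mem_flip_of_ne this] using hZ' z hz
      · simpa only [mem_flip_of_ne hbj.symm] using hflip B h3
  have h7 := (Ideal.add_mem_iff_left _ h6).1 h5
  rw [flip_flip, hflip B h3, mul_assoc] at h7
  have h8 := Ideal.mul_mem_left _ (sgn S j (flip j B)) h7
  rw [← mul_assoc, sgn_mul_self, one_mul] at h8
  exact hnzd _ h8

/-- Coefficients of the operator attached to the `j`-th row of `φ`. -/
def rowCoeff (φ : Matrix ι ι S) (j : ι) : ι → Bool → S
  | b, true => if b = j then 1 else 0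
  | b, false => φ j b

/-- `x` is annihilated by all the row operators of `φ`. -/
def IsVac (φ : Matrix ι ι S) (x : Finset ι → S) : Prop := ∀ j, gd (rowCoeff φ j) x = 0

lemma row_row_self {φ : Matrix ι ι S} (h0 : ∀ i, φ i i = 0) (j : ι) (x : Finset ι → S) :
    gd (rowCoeff φ j) (gd (rowCoeff φ j) x) = 0 := by
  rw [gd_gd]
  simp [rowCoeff, h0]

lemma row_row_anticomm {φ : Matrix ι ι S} (h0 : ∀ i, φ i i = 0) (h1 : ∀ i j, φ j i = - φ i j)
    (i j : ι) (x : Finset ι → S) :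
    gd (rowCoeff φ i) (gd (rowCoeff φ j) x) = - gd (rowCoeff φ j) (gd (rowCoeff φ i) x) := by
  have h := gd_gd (rowCoeff φ i + rowCoeff φ j) x
  have hz : (∑ b, (rowCoeff φ i + rowCoeff φ j) b true *
      (rowCoeff φ i + rowCoeff φ j) b false) = 0 := by
    simp [rowCoeff, add_mul, Finset.sum_add_distrib, h0, h1 i j]
  rw [hz, zero_smul, gd_add, gd_add] at h
  simp only [map_add, row_row_self h0, zero_add, add_zero] at h
  rw [add_comm] at h
  exact eq_neg_of_add_eq_zero_right h

/-- The product of row operators applied to the vacuum. -/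
def vacList (φ : Matrix ι ι S) : List ι → (Finset ι → S)
  | [] => fun B => if B = ∅ then 1 else 0
  | j :: L => gd (rowCoeff φ j) (vacList φ L)

lemma row_vacList {φ : Matrix ι ι S} (h0 : ∀ i, φ i i = 0) (h1 : ∀ i j, φ j i = - φ i j)
    (j : ι) (L : List ι) (h : j ∈ L) : gd (rowCoeff φ j) (vacList φ L) = 0 := by
  induction L with
  | nil => simp at h
  | cons a L ih =>
    rw [vacList]
    by_cases ha : j = a
    · subst ha; exact row_row_self h0 _ _
    · rw [row_row_anticomm h0 h1, ih (by simpa [ha] using h)]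
      simp

lemma row_apply (φ : Matrix ι ι S) (j : ι) (x : Finset ι → S) (B : Finset ι) :
    gd (rowCoeff φ j) x B = (if j ∈ B then sgn S j B * x (flip j B) else 0) +
      ∑ b, if b ∈ B then 0 else sgn S b B * φ j b * x (flip b B) := by
  rw [gd_apply]
  have : ∀ b, sgn S b B * rowCoeff φ j b (decide (b ∈ B)) * x (flip b B) =
      (if b = j then (if j ∈ B then sgn S j B * x (flip j B) else 0) else 0) +
      (if b ∈ B then 0 else sgn S b B * φ j b * x (flip b B)) := by
    intro b
    by_cases hb : b ∈ B
    · by_cases hbj : b = j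
      · subst hbj; simp [hb, rowCoeff]
      · simp [hb, rowCoeff, hbj]
    · by_cases hbj : b = j
      · subst hbj; simp [hb, rowCoeff]
      · simp [hb, rowCoeff, hbj]
  rw [Finset.sum_congr rfl fun b _ => this b, Finset.sum_add_distrib]
  simp

lemma vacList_top (φ : Matrix ι ι S) (L : List ι) (hL : L.Pairwise (· < ·)) (B : Finset ι)
    (hB : L.length ≤ B.card) : vacList φ L B = if B = L.toFinset then 1 else 0 := by
  induction L generalizing B with
  | nil =>
    simp only [vacList, List.toFinset_nil]
    congr
  | cons a L ih =>
    have hL' := (List.pairwise_cons.1 hL)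
    have haL : a ∉ L := fun h => lt_irrefl _ (hL'.1 a h)
    have hnd : L.Nodup := hL'.2.imp (fun h => h.ne)
    have hcard : L.toFinset.card = L.length := List.toFinset_card_of_nodup hnd
    rw [List.length_cons] at hB
    rw [vacList, row_apply, Finset.sum_eq_zero, add_zero]
    · by_cases ha : a ∈ B
      · have hc := card_flip_of_mem ha
        rw [if_pos ha, ih hL'.2 _ (by omega)]
        have hiff : flip a B = L.toFinset ↔ B = (a :: L).toFinset := by
          rw [flip_of_mem ha, List.toFinset_cons]
          constructor
          · intro h; rw [← h, Finset.insert_erase ha]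
          · intro h; rw [h, Finset.erase_insert (by simpa using haL)]
        by_cases h : B = (a :: L).toFinset
        · rw [if_pos (hiff.2 h), if_pos h, mul_one]
          unfold sgn
          rw [Finset.filter_false_of_mem]
          · simp
          · intro b hb
            rw [h] at hb
            simp only [List.toFinset_cons, Finset.mem_insert, List.mem_toFinset] at hb
            rcases hb with rfl | hb
            · exact lt_irrefl _
            · exact (hL'.1 b hb).not_gt
        · rw [if_neg h, if_neg (fun h' => h (hiff.1 h')), mul_zero]
      · rw [if_neg ha, if_neg]
        rintro rfl
        simp at ha
    · intro b _
      by_cases hb : b ∈ B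
      · rw [if_pos hb]
      · have hc := card_flip_of_notMem hb
        rw [if_neg hb, ih hL'.2 _ (by omega), if_neg, mul_zero]
        intro h
        rw [h, hcard] at hc
        omega

/-- The canonical vector annihilated by all row operators; its coordinates are, up to sign,
Pfaffians of principal submatrices. -/
def vac (φ : Matrix ι ι S) : Finset ι → S := vacList φ (Finset.univ.sort (· ≤ ·))

lemma vac_isVac {φ : Matrix ι ι S} (h0 : ∀ i, φ i i = 0) (h1 : ∀ i j, φ j i = - φ i j) :
    IsVac φ (vac φ) := fun j => row_vacList h0 h1 j _ (by simp)

lemma vac_univ (φ : Matrix ι ι S) : vac φ Finset.univ = 1 := by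
  rw [vac, vacList_top]
  · simp
  · exact (Finset.sortedLT_sort (Finset.univ : Finset ι)).pairwise
  · simp

lemma IsVac.rec_formula {φ : Matrix ι ι S} {x : Finset ι → S} (hx : IsVac φ x) {j : ι}
    {A : Finset ι} (hj : j ∉ A) :
    x A = - (sgn S j A * ∑ b, if b ∈ insert j A then 0 else
      sgn S b (insert j A) * φ j b * x (insert b (insert j A))) := by
  have h := congrFun (hx j) (insert j A)
  rw [row_apply, if_pos (Finset.mem_insert_self _ _)] at h
  have e1 : flip j (insert j A) = A := by
    rw [← flip_of_notMem hj, flip_flip]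
  have e2 : sgn S j (insert j A) = sgn S j A := by
    rw [← flip_of_notMem hj, sgn_flip_self]
  rw [e1, e2, Pi.zero_apply] at h
  have e3 : ∀ b, (if b ∈ insert j A then (0 : S) else
      sgn S b (insert j A) * φ j b * x (flip b (insert j A))) = if b ∈ insert j A then 0 else
      sgn S b (insert j A) * φ j b * x (insert b (insert j A)) := by
    intro b
    split_ifs with hb
    · rfl
    · rw [flip_of_notMem hb]
  rw [Finset.sum_congr rfl fun b _ => e3 b] at h
  have h2 := congrArg (sgn S j A * ·) h
  simp only [mul_add, mul_zero, ← mul_assoc, sgn_mul_self, one_mul] at h2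
  exact eq_neg_of_add_eq_zero_left h2

/-- Downward induction for coordinates of a vacuum vector. -/
lemma IsVac.induction {φ : Matrix ι ι S} {x : Finset ι → S} (hx : IsVac φ x)
    (P : ℕ → S → Prop) (h0 : ∀ k, P k 0) (hadd : ∀ k a b, P k a → P k b → P k (a + b))
    (hneg : ∀ k a, P k a → P k (-a)) (hmul : ∀ k i j a, P k a → P (k + 2) (φ i j * a))
    (htop : P 0 (x Finset.univ)) (A : Finset ι) : P (Aᶜ.card) (x A) := by
  have hsgn : ∀ (k : ℕ) (b : ι) (B : Finset ι) (a : S), P k a → P k (sgn S b B * a) := by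
    intro k b B a ha
    unfold sgn
    rcases neg_one_pow_eq_or S ((B.filter (· < b)).card) with h | h
    · rw [h, one_mul]; exact ha
    · rw [h, neg_one_mul]; exact hneg _ _ ha
  induction hk : Aᶜ.card using Nat.strong_induction_on generalizing A with
  | _ k ih =>
  by_cases hA : A = Finset.univ
  · subst hA
    rw [Finset.compl_univ, Finset.card_empty] at hk
    subst hk
    exact htop
  obtain ⟨j, hj⟩ : ∃ j, j ∉ A := by
    by_contra h
    push Not at h
    exact hA (Finset.eq_univ_iff_forall.2 h)
  rw [hx.rec_formula hj]
  refine hneg _ _ (hsgn _ _ _ _ ?_)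
  refine Finset.sum_induction _ (P k) (hadd k) (h0 k) fun b _ => ?_
  split_ifs with hb
  · exact h0 k
  · have hc1 : (insert j A).card = A.card + 1 := Finset.card_insert_of_notMem hj
    have hc2 : (insert b (insert j A)).card = (insert j A).card + 1 :=
      Finset.card_insert_of_notMem hb
    have hc3 := Finset.card_add_card_compl A
    have hc4 := Finset.card_add_card_compl (insert b (insert j A))
    have h1 := ih _ (by omega) (insert b (insert j A)) rfl
    rw [mul_assoc]
    refine hsgn _ _ _ _ ?_
    have := hmul _ j b _ h1
    convert this using 1
    omega

lemma IsVac.eq_zero {φ : Matrix ι ι S} {x : Finset ι → S} (hx : IsVac φ x)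
    (h : x Finset.univ = 0) : x = 0 := by
  funext A
  exact hx.induction (fun _ a => a = 0) (fun _ => rfl) (by rintro _ _ _ rfl rfl; simp)
    (by rintro _ _ rfl; simp) (by rintro _ _ _ _ rfl; simp) h A

lemma IsVac.eq_smul_vac {φ : Matrix ι ι S} (h0 : ∀ i, φ i i = 0) (h1 : ∀ i j, φ j i = - φ i j)
    {x : Finset ι → S} (hx : IsVac φ x) : x = x Finset.univ • vac φ := by
  have : IsVac φ (x - x Finset.univ • vac φ) := by
    intro j
    rw [map_sub, map_smul, hx j, vac_isVac h0 h1 j, smul_zero, sub_zero]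
  exact sub_eq_zero.1 (this.eq_zero (by simp [vac_univ]))

lemma vac_parity {φ : Matrix ι ι S} (h0 : ∀ i, φ i i = 0) (h1 : ∀ i j, φ j i = - φ i j)
    (A : Finset ι) (hA : Odd Aᶜ.card) : vac φ A = 0 :=
  (vac_isVac h0 h1).induction (fun k a => Odd k → a = 0) (fun _ _ => rfl)
    (by rintro k a b ha hb hk; rw [ha hk, hb hk, add_zero])
    (by rintro k a ha hk; rw [ha hk, neg_zero])
    (by
      rintro k i j a ha hk
      rw [ha (by rcases hk with ⟨m, hm⟩; exact ⟨m - 1, by omega⟩), mul_zero])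
    (by intro h; simp at h) A hA

/-! #### Change of rings -/

lemma sgn_map {S' : Type} [CommRing S'] (f : S →+* S') (j : ι) (B : Finset ι) :
    f (sgn S j B) = sgn S' j B := by
  simp [sgn]

lemma gd_map {S' : Type} [CommRing S'] (f : S →+* S') (c : ι → Bool → S) (x : Finset ι → S)
    (B : Finset ι) : f (gd c x B) = gd (fun b s => f (c b s)) (fun B => f (x B)) B := by
  simp [gd_apply, sgn_map]

lemma rowCoeff_map {S' : Type} [CommRing S'] (f : S →+* S') (φ : Matrix ι ι S) (j : ι) :
    (fun b s => f (rowCoeff φ j b s)) = rowCoeff (φ.map f) j := by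
  funext b s
  cases s
  · simp [rowCoeff]
  · simp only [rowCoeff]; split_ifs <;> simp

lemma IsVac.map {S' : Type} [CommRing S'] (f : S →+* S') {φ : Matrix ι ι S} {x : Finset ι → S}
    (hx : IsVac φ x) : IsVac (φ.map f) (fun B => f (x B)) := by
  intro j
  funext B
  rw [← rowCoeff_map, ← gd_map, hx j]
  simp

lemma vac_map {S' : Type} [CommRing S'] (f : S →+* S') {φ : Matrix ι ι S}
    (h0 : ∀ i, φ i i = 0) (h1 : ∀ i j, φ j i = - φ i j) (B : Finset ι) :
    f (vac φ B) = vac (φ.map f) B := by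
  have h := ((vac_isVac h0 h1).map f).eq_smul_vac (by simp [h0]) (fun i j => by simp [h1 i j])
  have := congrFun h B
  simpa [vac_univ] using this

end Fock

/-! ### Pfaffians as coordinates of the vacuum vector -/

section Pfaffian

set_option linter.unusedSectionVars false

variable {R : Type} [CommRing R] {n : ℕ}

lemma card_filter_univ_lt (b : Fin n) : (Finset.univ.filter (· < b)).card = b := by
  rw [← Fin.card_Iio b]
  congr 1
  ext a
  simp

lemma card_filter_lt_orderEmbOfFin {S : Finset (Fin n)} {r : ℕ} (h : S.card = r) (i : Fin r) :
    (S.filter (· < S.orderEmbOfFin h i)).card = i := by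
  have : S.filter (· < S.orderEmbOfFin h i) =
      (Finset.univ.filter (· < i)).map (S.orderEmbOfFin h).toEmbedding := by
    ext b
    simp only [Finset.mem_filter, Finset.mem_map, Finset.mem_univ, true_and]
    constructor
    · rintro ⟨hb, hlt⟩
      have : b ∈ Set.range (S.orderEmbOfFin h) := by
        rw [Finset.range_orderEmbOfFin]; exact hb
      obtain ⟨k, rfl⟩ := this
      exact ⟨k, by simpa using hlt, rfl⟩
    · rintro ⟨k, hk, rfl⟩
      exact ⟨Finset.orderEmbOfFin_mem _ _ _, by simpa using hk⟩
  rw [this, Finset.card_map, card_filter_univ_lt]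

lemma orderEmbOfFin_erase_erase {S : Finset (Fin n)} {r : ℕ} (h : S.card = r + 2)
    (t : Fin (r + 1)) (h' : ((S.erase (S.orderEmbOfFin h 0)).erase
      (S.orderEmbOfFin h t.succ)).card = r) (i : Fin r) :
    S.orderEmbOfFin h (t.succAbove i).succ =
      ((S.erase (S.orderEmbOfFin h 0)).erase (S.orderEmbOfFin h t.succ)).orderEmbOfFin h' i := by
  have := Finset.orderEmbOfFin_unique h' (f := fun i => S.orderEmbOfFin h (t.succAbove i).succ)
    (fun i => by
      rw [Finset.mem_erase, Finset.mem_erase]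
      refine ⟨fun hh => ?_, fun hh => ?_, Finset.orderEmbOfFin_mem _ _ _⟩
      · exact Fin.succAbove_ne t i (Fin.succ_injective _ ((S.orderEmbOfFin h).injective hh))
      · exact Fin.succ_ne_zero _ ((S.orderEmbOfFin h).injective hh))
    (fun i j hij => (S.orderEmbOfFin h).strictMono
      (Fin.succ_lt_succ_iff.2 (Fin.strictMono_succAbove t hij)))
  exact congrFun this i

lemma pf_eq_vac {φ : Matrix (Fin n) (Fin n) R} (h0 : ∀ i, φ i i = 0)
    (h1 : ∀ i j, φ j i = - φ i j) (r : ℕ) :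
    ∀ (S : Finset (Fin n)) (h : S.card = r),
      pf r (φ.submatrix (S.orderEmbOfFin h) (S.orderEmbOfFin h)) =
        (-1) ^ (∑ b ∈ S, (b : ℕ) + r / 2) * vac φ Sᶜ := by
  induction r using Nat.strong_induction_on with
  | _ r ih =>
  match r with
  | 0 =>
    intro S h
    obtain rfl := Finset.card_eq_zero.1 h
    simp [pf, vac_univ]
  | 1 =>
    intro S h
    rw [vac_parity h0 h1, mul_zero, pf]
    rw [compl_compl, h]; exact odd_one
  | r + 2 =>
    intro S h
    set j := S.orderEmbOfFin h 0 with hj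
    have hjS : j ∈ S := Finset.orderEmbOfFin_mem _ _ _
    have hjA : j ∉ Sᶜ := by simpa using hjS
    have hmin : ∀ b ∈ S, j ≤ b := by
      intro b hb
      have : b ∈ Set.range (S.orderEmbOfFin h) := by
        rw [Finset.range_orderEmbOfFin]; exact hb
      obtain ⟨k, rfl⟩ := this
      exact (S.orderEmbOfFin h).monotone (Fin.zero_le k)
    rw [pf, (vac_isVac h0 h1).rec_formula hjA]
    have hsum : (∑ b, if b ∈ insert j Sᶜ then 0 else
        sgn R b (insert j Sᶜ) * φ j b * vac φ (insert b (insert j Sᶜ))) =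
        ∑ t : Fin (r + 1), sgn R (S.orderEmbOfFin h t.succ) (insert j Sᶜ) *
          φ j (S.orderEmbOfFin h t.succ) *
          vac φ (insert (S.orderEmbOfFin h t.succ) (insert j Sᶜ)) := by
      rw [← Finset.sum_filter_add_sum_filter_not Finset.univ (fun b => b ∈ insert j Sᶜ),
        Finset.sum_eq_zero (fun b hb => if_pos (Finset.mem_filter.1 hb).2), zero_add]
      symm
      refine Finset.sum_bij (fun t _ => S.orderEmbOfFin h t.succ) (fun t _ => ?_)
        (fun a _ b _ hab => Fin.succ_injective _ ((S.orderEmbOfFin h).injective hab))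
        (fun b hb => ?_) (fun t _ => ?_)
      · simp only [Finset.mem_filter, Finset.mem_univ, true_and, Finset.mem_insert,
          Finset.mem_compl, not_or, not_not]
        exact ⟨fun hh => Fin.succ_ne_zero _ ((S.orderEmbOfFin h).injective hh),
          Finset.orderEmbOfFin_mem _ _ _⟩
      · simp only [Finset.mem_filter, Finset.mem_univ, true_and, Finset.mem_insert,
          Finset.mem_compl, not_or, not_not] at hb
        have : b ∈ Set.range (S.orderEmbOfFin h) := by
          rw [Finset.range_orderEmbOfFin]; exact hb.2
        obtain ⟨k, rfl⟩ := this
        have hk : k ≠ 0 := by rintro rfl; exact hb.1 rfl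
        exact ⟨k.pred hk, Finset.mem_univ _, by simp⟩
      · rw [if_neg]
        simp only [Finset.mem_insert, Finset.mem_compl, not_or, not_not]
        exact ⟨fun hh => Fin.succ_ne_zero _ ((S.orderEmbOfFin h).injective hh),
          Finset.orderEmbOfFin_mem _ _ _⟩
    rw [hsum, mul_neg, Finset.mul_sum, Finset.mul_sum, ← Finset.sum_neg_distrib]
    refine Finset.sum_congr rfl fun t _ => ?_
    set b := S.orderEmbOfFin h t.succ with hb
    have hbS : b ∈ S := Finset.orderEmbOfFin_mem _ _ _
    have hbj : b ≠ j := fun hh => Fin.succ_ne_zero _ ((S.orderEmbOfFin h).injective hh)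
    have hjb : j < b := lt_of_le_of_ne (hmin b hbS) hbj.symm
    have hbS' : b ∈ S.erase j := Finset.mem_erase.2 ⟨hbj, hbS⟩
    have hcard : ((S.erase j).erase b).card = r := by
      rw [Finset.card_erase_of_mem hbS', Finset.card_erase_of_mem hjS, h]; rfl
    have hsub : (φ.submatrix (S.orderEmbOfFin h) (S.orderEmbOfFin h)).submatrix
        (fun i => Fin.succ (t.succAbove i)) (fun i => Fin.succ (t.succAbove i)) =
        φ.submatrix (((S.erase j).erase b).orderEmbOfFin hcard)
          (((S.erase j).erase b).orderEmbOfFin hcard) := by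
      ext u v
      simp only [Matrix.submatrix_apply]
      rw [orderEmbOfFin_erase_erase h t hcard, orderEmbOfFin_erase_erase h t hcard]
    rw [hsub, ih r (by omega) _ hcard]
    have hcompl : ((S.erase j).erase b)ᶜ = insert b (insert j Sᶜ) := by
      rw [Finset.compl_erase, Finset.compl_erase]
    rw [hcompl, Matrix.submatrix_apply]
    have hsj : sgn R j Sᶜ = (-1) ^ (j : ℕ) := by
      unfold sgn
      congr 1
      have : Sᶜ.filter (· < j) = Finset.univ.filter (· < j) := by
        ext a
        simp only [Finset.mem_filter, Finset.mem_compl, Finset.mem_univ, true_and,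
          and_iff_right_iff_imp]
        intro ha haS
        exact (hmin a haS).not_gt ha
      rw [this, card_filter_univ_lt]
    have hsb : sgn R b (insert j Sᶜ) * (-1) ^ (t : ℕ) = (-1) ^ (b : ℕ) := by
      unfold sgn
      rw [← pow_add]
      congr 1
      have e1 : (Finset.univ.filter (· < b)) = (insert j Sᶜ).filter (· < b) ∪
          (S.erase j).filter (· < b) := by
        rw [← Finset.filter_union]
        congr 1
        ext a
        by_cases ha : a = j <;> by_cases haS : a ∈ S <;> simp [ha, haS]
      have e2 : Disjoint ((insert j Sᶜ).filter (· < b)) ((S.erase j).filter (· < b)) := by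
        refine Finset.disjoint_filter_filter ?_
        rw [Finset.disjoint_left]
        intro a ha ha'
        simp only [Finset.mem_insert, Finset.mem_compl, Finset.mem_erase] at ha ha'
        tauto
      have e3 := congrArg Finset.card e1
      rw [Finset.card_union_of_disjoint e2, card_filter_univ_lt] at e3
      have e4 : ((S.erase j).filter (· < b)).card = t := by
        rw [Finset.filter_erase, Finset.card_erase_of_mem (by simp [hjS, hjb]),
          card_filter_lt_orderEmbOfFin]
        simp
      omega
    have hs2 : ∑ c ∈ S, (c : ℕ) = j + (b + ∑ c ∈ (S.erase j).erase b, (c : ℕ)) := by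
      rw [Finset.add_sum_erase _ _ hbS', Finset.add_sum_erase _ _ hjS]
    rw [hs2, hsj]
    have e5 : sgn R b (insert j Sᶜ) = (-1) ^ (b : ℕ) * (-1) ^ (t : ℕ) := by
      rw [← hsb, mul_assoc, ← mul_pow]; simp
    rw [e5]
    have e6 : (r + 2) / 2 = r / 2 + 1 := by omega
    rw [e6]
    have sq : ∀ k : ℕ, ((-1 : R) ^ k) * (-1) ^ k = 1 := fun k => by rw [← mul_pow]; simp
    simp only [pow_add, pow_one]
    linear_combination (-(-1 : R) ^ (t : ℕ) * φ j b * (-1) ^ (∑ c ∈ (S.erase j).erase b, (c : ℕ)) *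
      (-1) ^ (r / 2) * vac φ (insert b (insert j Sᶜ))) * (sq j * ((-1)^(b : ℕ) * (-1)^(b : ℕ)) + sq b)

/-- The ideal generated by the coordinates of the vacuum vector of level at most `q`. -/
def vacIdeal {ι : Type} [Fintype ι] [LinearOrder ι] (φ : Matrix ι ι R) (q : ℕ) : Ideal R :=
  Ideal.span {x | ∃ B : Finset ι, B.card ≤ q ∧ x = vac φ B}

lemma vac_mem_vacIdeal {ι : Type} [Fintype ι] [LinearOrder ι] (φ : Matrix ι ι R) {q : ℕ}
    {B : Finset ι} (h : B.card ≤ q) : vac φ B ∈ vacIdeal φ q := Ideal.subset_span ⟨B, h, rfl⟩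

lemma vac_mem_of_level {ι : Type} [Fintype ι] [LinearOrder ι] {φ : Matrix ι ι R}
    (h0 : ∀ i, φ i i = 0) (h1 : ∀ i j, φ j i = - φ i j) {q : ℕ} {J : Ideal R}
    (hq : q ≤ Fintype.card ι) (hpar : Even (Fintype.card ι + q))
    (hJ : ∀ B : Finset ι, B.card = q → vac φ B ∈ J) (B : Finset ι) (hB : B.card ≤ q) :
    vac φ B ∈ J := by
  induction hk : q - B.card using Nat.strong_induction_on generalizing B with
  | _ k ih =>
  rcases hB.lt_or_eq with hlt | heq
  · obtain ⟨j, hj⟩ : ∃ j, j ∉ B := by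
      by_contra h
      push Not at h
      rw [Finset.eq_univ_iff_forall.2 h, Finset.card_univ] at hlt
      omega
    by_cases hodd : Odd Bᶜ.card
    · rw [vac_parity h0 h1 _ hodd]; exact zero_mem _
    have hcc := Finset.card_add_card_compl B
    rw [Nat.not_odd_iff_even] at hodd
    have hlt2 : B.card + 2 ≤ q := by
      rcases hpar with ⟨u, hu⟩; rcases hodd with ⟨v, hv⟩; omega
    rw [(vac_isVac h0 h1).rec_formula hj]
    refine neg_mem (Ideal.mul_mem_left _ _ (Ideal.sum_mem _ fun b _ => ?_))
    split_ifs with hb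
    · exact zero_mem _
    · refine Ideal.mul_mem_left _ _ ?_
      have hc : (insert b (insert j B)).card = B.card + 2 := by
        rw [Finset.card_insert_of_notMem hb, Finset.card_insert_of_notMem hj]
      exact ih _ (by omega) _ (by omega) rfl
  · exact hJ B heq

lemma pfaffianIdeal_eq_vacIdeal {φ : Matrix (Fin n) (Fin n) R} (h0 : ∀ i, φ i i = 0)
    (h1 : ∀ i j, φ j i = - φ i j) {q : ℕ} (hq : q ≤ n) (hpar : Even (n + q)) :
    pfaffianIdeal n (n - q) φ = vacIdeal φ q := by
  have hunit : ∀ (k : ℕ) (x : R) (J : Ideal R), (-1) ^ k * x ∈ J ↔ x ∈ J := by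
    intro k x J
    rcases neg_one_pow_eq_or R k with h | h <;> simp [h]
  apply le_antisymm
  · rw [pfaffianIdeal, Ideal.span_le]
    rintro x ⟨S, h, rfl⟩
    rw [SetLike.mem_coe, pf_eq_vac h0 h1, hunit]
    refine vac_mem_vacIdeal φ ?_
    rw [Finset.card_compl, h, Fintype.card_fin]; omega
  · rw [vacIdeal, Ideal.span_le]
    rintro x ⟨B, hB, rfl⟩
    refine vac_mem_of_level h0 h1 (by simpa using hq) (by simpa using hpar) (fun B hB => ?_) B hB
    have hc : Bᶜ.card = n - q := by rw [Finset.card_compl, hB, Fintype.card_fin]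
    have := pf_eq_vac h0 h1 _ Bᶜ hc
    rw [compl_compl] at this
    rw [← hunit, ← this]
    exact Ideal.subset_span ⟨_, hc, rfl⟩

end Pfaffian

/-! ### The operator of an alternating matrix -/

section Operator

set_option linter.unusedSectionVars false

open MvPolynomial

variable {ι : Type} [Fintype ι] [LinearOrder ι] {R : Type} [CommRing R]

/-- The linear form attached to a column of `φ`. -/
def ell (φ : Matrix ι ι R) (b : ι) : MvPolynomial ι R := ∑ j, X j * C (φ j b)

/-- The coefficients of the operator of `φ`. -/
def dc (φ : Matrix ι ι R) : ι → Bool → MvPolynomial ι R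
  | b, true => X b
  | b, false => ell φ b

/-- The operator of `φ`, a square-zero operator if `φ` is alternating. -/
abbrev DD (φ : Matrix ι ι R) := gd (dc φ)

/-- The vacuum vector with polynomial coordinates. -/
def Om (φ : Matrix ι ι R) : Finset ι → MvPolynomial ι R := fun B => C (vac φ B)

lemma dc_sum {φ : Matrix ι ι R} (h0 : ∀ i, φ i i = 0) (h1 : ∀ i j, φ j i = - φ i j) :
    ∑ b, dc φ b true * dc φ b false = 0 := by
  have : ∀ b, dc φ b true * dc φ b false = ∑ j, X b * (X j * C (φ j b)) := fun b => by
    simp [dc, ell, Finset.mul_sum]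
  simp_rw [this]
  rw [sum_sum_eq_diag]
  · simp [h0]
  · intro b b' _
    rw [h1 b b', C_neg]; ring

lemma DD_DD {φ : Matrix ι ι R} (h0 : ∀ i, φ i i = 0) (h1 : ∀ i j, φ j i = - φ i j)
    (x : Finset ι → MvPolynomial ι R) : DD φ (DD φ x) = 0 := by
  rw [DD, gd_gd, dc_sum h0 h1, zero_smul]

lemma DD_eq (φ : Matrix ι ι R) (x : Finset ι → MvPolynomial ι R) (B : Finset ι) :
    DD φ x B = ∑ j, X j * gd (rowCoeff (φ.map C) j) x B := by
  simp only [DD, gd_apply, Finset.mul_sum]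
  rw [Finset.sum_comm]
  refine Finset.sum_congr rfl fun b _ => ?_
  have : dc φ b (decide (b ∈ B)) =
      ∑ j, X j * rowCoeff (φ.map (C : R →+* MvPolynomial ι R)) j b (decide (b ∈ B)) := by
    by_cases hb : b ∈ B
    · simp [hb, dc, rowCoeff]
    · simp [hb, dc, rowCoeff, ell]
  rw [this, Finset.mul_sum, Finset.sum_mul]
  exact Finset.sum_congr rfl fun j _ => by ring

lemma DD_Om {φ : Matrix ι ι R} (h0 : ∀ i, φ i i = 0) (h1 : ∀ i j, φ j i = - φ i j) :
    DD φ (Om φ) = 0 := by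
  funext B
  rw [DD_eq]
  refine Finset.sum_eq_zero fun j _ => ?_
  have := congrFun (((vac_isVac h0 h1).map (C : R →+* MvPolynomial ι R)) j) B
  unfold Om
  rw [this]; simp

/-- Polynomials all of whose monomials outside of the variables in `Z` have coefficients
in `𝔟`. -/
def coefIdeal (𝔟 : Ideal R) (Z : Finset ι) : Ideal (MvPolynomial ι R) where
  carrier := {p | ∀ m : ι →₀ ℕ, (∀ z ∈ Z, m z = 0) → coeff m p ∈ 𝔟}
  zero_mem' := fun m _ => by simp
  add_mem' := fun ha hb m hm => by rw [coeff_add]; exact add_mem (ha m hm) (hb m hm)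
  smul_mem' := by
    intro p q hq m hm
    rw [smul_eq_mul, coeff_mul]
    refine Ideal.sum_mem _ fun x hx => Ideal.mul_mem_left _ _ (hq _ fun z hz => ?_)
    have := DFunLike.congr_fun (Finset.HasAntidiagonal.mem_antidiagonal.1 hx) z
    rw [Finsupp.add_apply, hm z hz] at this
    omega

lemma mem_coefIdeal {𝔟 : Ideal R} {Z : Finset ι} {p : MvPolynomial ι R} :
    p ∈ coefIdeal 𝔟 Z ↔ ∀ m : ι →₀ ℕ, (∀ z ∈ Z, m z = 0) → coeff m p ∈ 𝔟 := Iff.rfl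

lemma X_mem_coefIdeal (𝔟 : Ideal R) {Z : Finset ι} {z : ι} (hz : z ∈ Z) :
    (X z : MvPolynomial ι R) ∈ coefIdeal 𝔟 Z := by
  intro m hm
  rw [coeff_X, if_neg]
  · exact zero_mem _
  · intro h
    have := hm z hz
    rw [← h] at this
    simp at this

lemma X_nzd_coefIdeal (𝔟 : Ideal R) {Z : Finset ι} {j : ι} (hj : j ∉ Z) {p : MvPolynomial ι R}
    (h : X j * p ∈ coefIdeal 𝔟 Z) : p ∈ coefIdeal 𝔟 Z := by
  intro m hm
  have := h (Finsupp.single j 1 + m) (fun z hz => by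
    rw [Finsupp.add_apply, hm z hz, Finsupp.single_apply, if_neg]
    rintro rfl; exact hj hz)
  rwa [coeff_X_mul] at this

lemma exists_sub_X_mul {𝔟 : Ideal R} {Z : Finset ι} {j : ι} {p : MvPolynomial ι R}
    (h : p ∈ coefIdeal 𝔟 (insert j Z)) : ∃ v, p - X j * v ∈ coefIdeal 𝔟 Z := by
  refine ⟨divMonomial p (Finsupp.single j 1), fun m hm => ?_⟩
  by_cases hj : m j = 0
  · rw [coeff_sub, coeff_X_mul', if_neg, sub_zero]
    · exact h m fun z hz => by
        rcases Finset.mem_insert.1 hz with rfl | hz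
        · exact hj
        · exact hm z hz
    · simpa using hj
  · have : m = Finsupp.single j 1 + (m - Finsupp.single j 1) := by
      ext a
      by_cases ha : j = a
      · subst ha; simp; omega
      · simp [ha]
    rw [this, coeff_sub, coeff_X_mul, coeff_divMonomial, sub_self]
    exact zero_mem _

lemma coefIdeal_bot_empty : coefIdeal (⊥ : Ideal R) (∅ : Finset ι) = ⊥ := by
  ext p
  rw [mem_coefIdeal]
  simp [MvPolynomial.ext_iff]

/-- Cycles of the operator of `φ` modulo an ideal of the base ring are boundaries up to multiples
of the vacuum vector. -/
lemma exists_DD_of_cycle {φ : Matrix ι ι R} (h0 : ∀ i, φ i i = 0) (h1 : ∀ i j, φ j i = - φ i j)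
    (𝔟 : Ideal R) (x : Finset ι → MvPolynomial ι R) (hx : ∀ B, DD φ x B ∈ coefIdeal 𝔟 ∅) :
    ∃ (y : Finset ι → MvPolynomial ι R) (c : R), ∀ B,
      (x - DD φ y - (C c : MvPolynomial ι R) • Om φ) B ∈ coefIdeal 𝔟 ∅ := by
  have mono : ∀ Z : Finset ι, coefIdeal 𝔟 ∅ ≤ coefIdeal 𝔟 Z := fun Z p hp m _ => hp m (by simp)
  set c := coeff 0 (x Finset.univ) with hc
  have key : ∀ k, ∀ Z : Finset ι, Zᶜ.card = k → ∃ y : Finset ι → MvPolynomial ι R, ∀ B, Z ⊆ B →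
      (x - (C c : MvPolynomial ι R) • Om φ - DD φ y) B ∈ coefIdeal 𝔟 Z := by
    intro k
    induction k with
    | zero =>
      intro Z hZ
      have hZ' : Z = Finset.univ := by
        rwa [Finset.card_eq_zero, Finset.compl_eq_empty_iff] at hZ
      subst hZ'
      refine ⟨0, fun B hB m hm => ?_⟩
      obtain rfl : B = Finset.univ := Finset.univ_subset_iff.1 hB
      obtain rfl : m = 0 := by ext z; simpa using hm z (Finset.mem_univ z)
      simp [Om, vac_univ, hc]
    | succ k ih =>
      intro Z hZ
      obtain ⟨j, hj⟩ : ∃ j, j ∈ Zᶜ := Finset.card_pos.1 (by omega)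
      rw [Finset.mem_compl] at hj
      obtain ⟨y, hy⟩ := ih (insert j Z) (by
        rw [Finset.compl_insert, Finset.card_erase_of_mem (by simpa using hj)]; omega)
      set x' := x - (C c : MvPolynomial ι R) • Om φ - DD φ y with hx'
      have hDx' : DD φ x' = DD φ x := by
        rw [hx', map_sub, map_sub, map_smul, DD_Om h0 h1, DD_DD h0 h1]; simp
      obtain ⟨y', hy'⟩ := gd_eliminate (dc φ) (dc_sum h0 h1) j true Z (coefIdeal 𝔟 Z)
        (fun z hz => X_mem_coefIdeal 𝔟 hz) (fun u hu => X_nzd_coefIdeal 𝔟 hj hu) hj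
        (fun _ => True) (fun _ => True) (by simp) (by simp) x'
        (fun B _ _ => mono Z (by rw [show gd (dc φ) x' = _ from hDx']; exact hx B))
        (fun B _ hB hjB => exists_sub_X_mul (hy B (by
          simp only [decide_eq_true_eq] at hB hjB
          intro z hz
          rcases Finset.mem_insert.1 hz with rfl | hz
          · exact hjB
          · exact hB z hz)))
      refine ⟨y + y', fun B hB => ?_⟩
      have := hy' B trivial (fun z hz => by simpa using hB hz)
      rwa [hx', sub_sub, ← map_add] at this
  obtain ⟨y, hy⟩ := key _ ∅ rfl
  refine ⟨y, c, fun B => ?_⟩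
  have := hy B (by simp)
  rwa [sub_right_comm] at this

/-- Elimination of two coefficients that are units times variables. -/
lemma exists_of_two_units (c : ι → Bool → MvPolynomial ι R) (hc : ∑ b, c b true * c b false = 0)
    {j k : ι} (hjk : j ≠ k) (u v : Rˣ) (hj : c j false = C (u : R) * X k)
    (hk : c k false = C (v : R) * X j) (m : ℕ) (x : Finset ι → MvPolynomial ι R)
    (hx : ∀ B : Finset ι, B.card < m → gd c x B = 0)
    (hx0 : ∀ B : Finset ι, B.card ≤ m → j ∉ B → k ∉ B → x B ∈ coefIdeal (⊥ : Ideal R) {j, k}) :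
    ∃ y, ∀ B : Finset ι, B.card ≤ m → x B = gd c y B := by
  have unit_nzd : ∀ (w : Rˣ) (l : ι) (Z : Finset ι) (p : MvPolynomial ι R), l ∉ Z →
      C (w : R) * X l * p ∈ coefIdeal (⊥ : Ideal R) Z → p ∈ coefIdeal (⊥ : Ideal R) Z := by
    intro w l Z p hl h
    refine X_nzd_coefIdeal ⊥ hl ?_
    have h2 := Ideal.mul_mem_left _ (C ((w⁻¹ : Rˣ) : R)) h
    rwa [← mul_assoc, ← mul_assoc, ← C_mul, Units.inv_mul, C_1, one_mul] at h2
  have unit_sub : ∀ (w : Rˣ) (l : ι) (Z : Finset ι) (p : MvPolynomial ι R),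
      p ∈ coefIdeal (⊥ : Ideal R) (insert l Z) →
      ∃ q, p - C (w : R) * X l * q ∈ coefIdeal (⊥ : Ideal R) Z := by
    intro w l Z p h
    obtain ⟨q, hq⟩ := exists_sub_X_mul h
    refine ⟨C ((w⁻¹ : Rˣ) : R) * q, ?_⟩
    have : C (w : R) * X l * (C ((w⁻¹ : Rˣ) : R) * q) = X l * q := by
      have h2 : (C (w : R) : MvPolynomial ι R) * C ((w⁻¹ : Rˣ) : R) = 1 := by
        rw [← C_mul, Units.mul_inv, C_1]
      linear_combination X l * q * h2
    rwa [this]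
  have hflip : ∀ (l : ι) (B : Finset ι), B.card ≤ m → decide (l ∈ B) ≠ false →
      (flip l B).card < m := by
    intro l B hB hl
    have := card_flip_of_mem (by simpa using hl : l ∈ B)
    omega
  have hflip' : ∀ (B : Finset ι) (b : ι), B.card < m → (flip b B).card ≤ m := fun B b hB =>
    (card_flip_le b B).trans hB
  obtain ⟨y, hy⟩ := gd_eliminate c hc k false {j} (coefIdeal ⊥ {k})
    (fun z hz => by
      rw [Finset.mem_singleton.1 hz, hj]
      exact Ideal.mul_mem_left _ _ (X_mem_coefIdeal _ (by simp)))
    (fun p hp => unit_nzd v j {k} p (by simpa using hjk) (by rwa [hk] at hp))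
    (by simpa using hjk.symm) (fun B => B.card ≤ m) (fun B => B.card < m) (hflip k) hflip' x
    (fun B hB _ => by rw [hx B hB]; exact zero_mem _)
    (fun B hB hjB hkB => by
      rw [hk]
      refine unit_sub v j {k} _ (hx0 B hB ?_ ?_)
      · simpa using hjB
      · simpa using hkB)
  have hD : ∀ B : Finset ι, B.card < m → gd c (x - gd c y) B = 0 := by
    intro B hB
    rw [map_sub, gd_gd, hc, zero_smul, sub_zero, hx B hB]
  obtain ⟨y', hy'⟩ := gd_eliminate c hc j false ∅ (coefIdeal ⊥ ∅) (by simp)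
    (fun p hp => unit_nzd u k ∅ p (by simp) (by rwa [hj] at hp))
    (by simp) (fun B => B.card ≤ m) (fun B => B.card < m) (hflip j) hflip' (x - gd c y)
    (fun B hB _ => by rw [hD B hB]; exact zero_mem _)
    (fun B hB _ hjB => by
      rw [hj]
      exact unit_sub u k ∅ _ (hy B hB (by simpa using hjB)))
  refine ⟨y + y', fun B hB => ?_⟩
  have := hy' B hB (by simp)
  rw [coefIdeal_bot_empty, Ideal.mem_bot] at this
  rw [map_add]
  simp only [Pi.sub_apply, Pi.add_apply] at this ⊢
  linear_combination this

end Operator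

/-! ### Elimination of a unit entry -/

section Elimination

set_option linter.unusedSectionVars false

open MvPolynomial

variable {ι : Type} [Fintype ι] [LinearOrder ι] {R : Type} [CommRing R]

/-- The index set with two indices removed. -/
abbrev Rest (j k : ι) : Type := {i : ι // i ≠ j ∧ i ≠ k}

/-- The inclusion of the remaining indices. -/
abbrev restEmb (j k : ι) : Rest j k ↪ ι := Function.Embedding.subtype _

lemma sum_split {M : Type} [AddCommMonoid M] {j k : ι} (hjk : j ≠ k) (g : ι → M) :
    ∑ i, g i = g j + (g k + ∑ i : Rest j k, g i) := by
  have h1 : ∑ i : Rest j k, g i = ∑ i ∈ (Finset.univ.erase j).erase k, g i := by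
    symm
    apply Finset.sum_subtype
    intro x
    simp only [Finset.mem_erase, Finset.mem_univ, and_true]
    tauto
  rw [h1, Finset.add_sum_erase _ _ (by simp [hjk.symm]), Finset.add_sum_erase _ _ (by simp)]

/-- The Schur complement of a unit entry of an alternating matrix. -/
def schur (φ : Matrix ι ι R) (j k : ι) (u : Rˣ) : Matrix (Rest j k) (Rest j k) R :=
  fun i b => φ i b + ((u⁻¹ : Rˣ) : R) * (φ i j * φ k b - φ i k * φ j b)

lemma schur_diag {φ : Matrix ι ι R} (h0 : ∀ i, φ i i = 0) (h1 : ∀ i j, φ j i = - φ i j)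
    (j k : ι) (u : Rˣ) (i : Rest j k) : schur φ j k u i i = 0 := by
  rw [schur, h0, h1 k i, h1 j i]; ring

lemma schur_skew {φ : Matrix ι ι R} (h1 : ∀ i j, φ j i = - φ i j)
    (j k : ι) (u : Rˣ) (i b : Rest j k) : schur φ j k u b i = - schur φ j k u i b := by
  rw [schur, schur, h1 i b, h1 k i, h1 j i, h1 j b, h1 k b]; ring

/-- The linear form substituted for the variable of index `l`. -/
def substForm (φ : Matrix ι ι R) (j k : ι) (l : ι) (u : Rˣ) : MvPolynomial ι R :=
  C ((u⁻¹ : Rˣ) : R) * ∑ i : Rest j k, X (i : ι) * C (φ i l)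

/-- The coordinate change attached to a unit entry. -/
def coordChange (φ : Matrix ι ι R) (j k : ι) (u : Rˣ) (ε : R) :
    MvPolynomial ι R →ₐ[R] MvPolynomial ι R :=
  aeval fun i => if i = j then X j - C ε * substForm φ j k k u else
    if i = k then X k + C ε * substForm φ j k j u else X i

lemma coordChange_rest (φ : Matrix ι ι R) {j k : ι} (u : Rˣ) (ε : R) (i : Rest j k) :
    coordChange φ j k u ε (X (i : ι)) = X (i : ι) := by
  simp [coordChange, i.2.1, i.2.2]

lemma coordChange_substForm (φ : Matrix ι ι R) {j k : ι} (u : Rˣ) (ε : R) (l : ι) :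
    coordChange φ j k u ε (substForm φ j k l u) = substForm φ j k l u := by
  simp only [substForm, map_mul, map_sum, coordChange_rest, algHom_C, algebraMap_eq]

lemma coordChange_inv (φ : Matrix ι ι R) {j k : ι} (hjk : j ≠ k) (u : Rˣ)
    (p : MvPolynomial ι R) :
    coordChange φ j k u (-1) (coordChange φ j k u 1 p) = p := by
  have : (coordChange φ j k u (-1)).comp (coordChange φ j k u 1) = AlgHom.id R _ := by
    apply MvPolynomial.algHom_ext
    intro i
    rw [AlgHom.comp_apply]
    by_cases hij : i = j
    · subst hij
      have : coordChange φ i k u 1 (X i) = X i - substForm φ i k k u := by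
        simp [coordChange]
      rw [this, map_sub, coordChange_substForm]
      simp [coordChange]
    · by_cases hik : i = k
      · subst hik
        have : coordChange φ j i u 1 (X i) = X i + substForm φ j i j u := by
          simp [coordChange, hij]
        rw [this, map_add, coordChange_substForm]
        simp [coordChange, hij]
      · simp [coordChange, hij, hik]
  exact DFunLike.congr_fun this p

lemma coordChange_inv' (φ : Matrix ι ι R) {j k : ι} (hjk : j ≠ k) (u : Rˣ)
    (p : MvPolynomial ι R) :
    coordChange φ j k u 1 (coordChange φ j k u (-1) p) = p := by
  have : (coordChange φ j k u 1).comp (coordChange φ j k u (-1)) = AlgHom.id R _ := by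
    apply MvPolynomial.algHom_ext
    intro i
    rw [AlgHom.comp_apply]
    by_cases hij : i = j
    · subst hij
      have : coordChange φ i k u (-1) (X i) = X i + substForm φ i k k u := by
        simp [coordChange]
      rw [this, map_add, coordChange_substForm]
      simp [coordChange]
    · by_cases hik : i = k
      · subst hik
        have : coordChange φ j i u (-1) (X i) = X i - substForm φ j i j u := by
          simp [coordChange, hij, sub_eq_add_neg]
        rw [this, map_sub, coordChange_substForm]
        simp [coordChange, hij]
      · simp [coordChange, hij, hik]
  exact DFunLike.congr_fun this p

/-- Setting two variables equal to zero. -/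
def killTwo (R : Type) [CommRing R] (j k : ι) : MvPolynomial ι R →ₐ[R] MvPolynomial (Rest j k) R :=
  aeval fun i => if h : i ≠ j ∧ i ≠ k then X ⟨i, h⟩ else 0

lemma killTwo_left (j k : ι) : killTwo R j k (X j) = 0 := by simp [killTwo]

lemma killTwo_right (j k : ι) : killTwo R j k (X k) = 0 := by simp [killTwo]

lemma killTwo_rest {j k : ι} (i : Rest j k) : killTwo R j k (X (i : ι)) = X i := by
  have := i.2
  rw [killTwo, aeval_X, dif_pos this]

lemma sub_rename_killTwo_mem (j k : ι) (p : MvPolynomial ι R) :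
    p - rename (restEmb j k) (killTwo R j k p) ∈ coefIdeal (⊥ : Ideal R) {j, k} := by
  induction p using MvPolynomial.induction_on with
  | C a => rw [algHom_C, algebraMap_eq, rename_C, sub_self]; exact zero_mem _
  | add p q hp hq =>
    rw [map_add, map_add, add_sub_add_comm]; exact add_mem hp hq
  | mul_X p i hp =>
    by_cases hij : i = j
    · subst hij
      rw [map_mul, killTwo_left, mul_zero, map_zero, sub_zero]
      exact Ideal.mul_mem_left _ _ (X_mem_coefIdeal _ (by simp))
    · by_cases hik : i = k
      · subst hik
        rw [map_mul, killTwo_right, mul_zero, map_zero, sub_zero]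
        exact Ideal.mul_mem_left _ _ (X_mem_coefIdeal _ (by simp))
      · have := killTwo_rest (R := R) (⟨i, hij, hik⟩ : Rest j k)
        rw [map_mul, map_mul]
        simp only at this
        rw [this, rename_X]
        have h2 := Ideal.mul_mem_right (X i) _ hp
        rwa [sub_mul] at h2

/-- The substitution attached to a unit entry. -/
def elimHom (φ : Matrix ι ι R) (j k : ι) (u : Rˣ) :
    MvPolynomial ι R →ₐ[R] MvPolynomial (Rest j k) R :=
  (killTwo R j k).comp (coordChange φ j k u 1)

lemma elimHom_rest (φ : Matrix ι ι R) {j k : ι} (u : Rˣ) (i : Rest j k) :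
    elimHom φ j k u (X (i : ι)) = X i := by
  rw [elimHom, AlgHom.comp_apply, coordChange_rest, killTwo_rest]

lemma coordChange_ell (φ : Matrix ι ι R) (j k b : ι) (hjk : j ≠ k) (u : Rˣ) :
    coordChange φ j k u 1 (ell φ b) = (X j - substForm φ j k k u) * C (φ j b) +
      ((X k + substForm φ j k j u) * C (φ k b) + ∑ i : Rest j k, X (i : ι) * C (φ i b)) := by
  rw [ell, sum_split hjk, map_add, map_add, map_sum]
  simp only [map_mul, coordChange_rest, algHom_C, algebraMap_eq]
  simp [coordChange, hjk.symm]

lemma substForm_mul (φ : Matrix ι ι R) (j k l : ι) (u : Rˣ) :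
    C (u : R) * substForm φ j k l u = ∑ i : Rest j k, X (i : ι) * C (φ i l) := by
  rw [substForm, ← mul_assoc, ← C_mul, Units.mul_inv, C_1, one_mul]

variable {φ : Matrix ι ι R} (h0 : ∀ i, φ i i = 0) (h1 : ∀ i j, φ j i = - φ i j)
  {j k : ι} {u : Rˣ} (hu : φ j k = u)

include h0 h1 hu in
lemma coordChange_ell_left (hjk : j ≠ k) :
    coordChange φ j k u 1 (ell φ j) = C ((-u : Rˣ) : R) * X k := by
  rw [coordChange_ell _ _ _ _ hjk, h0, h1 j k, hu, ← substForm_mul φ j k j u]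
  simp only [C_0, C_neg, Units.val_neg]; ring

include h0 hu in
lemma coordChange_ell_right (hjk : j ≠ k) :
    coordChange φ j k u 1 (ell φ k) = C (u : R) * X j := by
  rw [coordChange_ell _ _ _ _ hjk, h0, hu, ← substForm_mul φ j k k u]
  simp only [C_0]; ring

include hu in
lemma elimHom_ell (hjk : j ≠ k) (b : Rest j k) :
    elimHom φ j k u (ell φ b) = ell (schur φ j k u) b := by
  have hs : ∀ l : ι, killTwo R j k (substForm φ j k l u) =
      ∑ i : Rest j k, X i * C (((u⁻¹ : Rˣ) : R) * φ i l) := by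
    intro l
    simp only [substForm, map_mul, map_sum, killTwo_rest, algHom_C, algebraMap_eq, Finset.mul_sum]
    exact Finset.sum_congr rfl fun i _ => by ring
  rw [elimHom, AlgHom.comp_apply, coordChange_ell _ _ _ _ hjk, map_add, map_add, map_mul, map_mul,
    map_sub, map_add, killTwo_left, killTwo_right, hs, hs, map_sum]
  simp only [map_mul, killTwo_rest, algHom_C, algebraMap_eq, ell, schur]
  rw [zero_sub, zero_add, ← Finset.sum_neg_distrib, Finset.sum_mul, Finset.sum_mul,
    ← Finset.sum_add_distrib, ← Finset.sum_add_distrib]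
  refine Finset.sum_congr rfl fun i _ => ?_
  simp only [map_add, map_mul, map_sub]
  ring

lemma sgn_map_restEmb {S : Type} [CommRing S] (b : Rest j k) (B : Finset (Rest j k)) :
    sgn S (b : ι) (B.map (restEmb j k)) = sgn S b B := by
  unfold sgn
  congr 1
  rw [Finset.filter_map, Finset.card_map]
  rfl

lemma flip_map_restEmb (b : Rest j k) (B : Finset (Rest j k)) :
    flip (b : ι) (B.map (restEmb j k)) = (flip b B).map (restEmb j k) := by
  have e : (b : ι) = restEmb j k b := rfl
  rw [e]
  by_cases hb : b ∈ B
  · rw [flip_of_mem hb, flip_of_mem (Finset.mem_map_of_mem _ hb), Finset.map_erase]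
  · rw [flip_of_notMem hb, flip_of_notMem (by rwa [Finset.mem_map']), Finset.map_insert]

/-- The restriction map of the elimination. -/
def restr (φ : Matrix ι ι R) (j k : ι) (u : Rˣ) (x : Finset ι → MvPolynomial ι R) :
    Finset (Rest j k) → MvPolynomial (Rest j k) R :=
  fun B => elimHom φ j k u (x (B.map (restEmb j k)))

lemma gd_restr {S S' : Type} [CommRing S] [CommRing S'] (f : S →+* S') (hjk : j ≠ k)
    (c : ι → Bool → S) (c' : Rest j k → Bool → S') (hj : f (c j false) = 0)
    (hk : f (c k false) = 0) (hc : ∀ (b : Rest j k) s, f (c b s) = c' b s) (x : Finset ι → S)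
    (B : Finset (Rest j k)) :
    f (gd c x (B.map (restEmb j k))) = gd c' (fun B => f (x (B.map (restEmb j k)))) B := by
  rw [gd_apply, map_sum, sum_split hjk, gd_apply]
  have hjB : j ∉ B.map (restEmb j k) := by simp
  have hkB : k ∉ B.map (restEmb j k) := by simp
  rw [decide_eq_false hjB, decide_eq_false hkB]
  rw [map_mul, map_mul, map_mul, map_mul, hj, hk, mul_zero, zero_mul, mul_zero, zero_mul,
    zero_add, zero_add]
  refine Finset.sum_congr rfl fun b _ => ?_
  have hb : ((b : ι) ∈ B.map (restEmb j k)) ↔ b ∈ B := by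
    have e : (b : ι) = restEmb j k b := rfl
    rw [e, Finset.mem_map']
  rw [map_mul, map_mul, sgn_map_restEmb, flip_map_restEmb, hc, sgn_map, decide_eq_decide.2 hb]

include h0 h1 hu in
lemma restr_DD (hjk : j ≠ k) (x : Finset ι → MvPolynomial ι R) :
    restr φ j k u (DD φ x) = DD (schur φ j k u) (restr φ j k u x) := by
  funext B
  refine gd_restr (elimHom φ j k u : MvPolynomial ι R →+* MvPolynomial (Rest j k) R) hjk (dc φ)
    (dc (schur φ j k u)) ?_ ?_ ?_ x B
  · change elimHom φ j k u (ell φ j) = 0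
    rw [elimHom, AlgHom.comp_apply, coordChange_ell_left h0 h1 hu hjk, map_mul, killTwo_right,
      mul_zero]
  · change elimHom φ j k u (ell φ k) = 0
    rw [elimHom, AlgHom.comp_apply, coordChange_ell_right h0 hu hjk, map_mul, killTwo_left,
      mul_zero]
  · intro b s
    cases s
    · exact elimHom_ell hu hjk b
    · exact elimHom_rest φ u b

include h0 h1 hu in
/-- A cycle in low levels that restricts to zero is a boundary in low levels. -/
lemma exists_DD_of_restr (hjk : j ≠ k) (m : ℕ) (x : Finset ι → MvPolynomial ι R)
    (hx : ∀ B : Finset ι, B.card < m → DD φ x B = 0)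
    (hx0 : ∀ B : Finset (Rest j k), B.card ≤ m → restr φ j k u x B = 0) :
    ∃ y, ∀ B : Finset ι, B.card ≤ m → x B = DD φ y B := by
  set θ := coordChange φ j k u 1 with hθ
  set c : ι → Bool → MvPolynomial ι R := fun b s => θ (dc φ b s) with hc
  have hgd : ∀ (x : Finset ι → MvPolynomial ι R) B, θ (DD φ x B) = gd c (fun B => θ (x B)) B :=
    fun x B => gd_map (θ : MvPolynomial ι R →+* MvPolynomial ι R) (dc φ) x B
  obtain ⟨y, hy⟩ := exists_of_two_units c
    (by
      have := congrArg θ (dc_sum h0 h1)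
      rw [map_sum, map_zero] at this
      rw [← this]
      exact Finset.sum_congr rfl fun b _ => (map_mul θ _ _).symm)
    hjk (-u) u (coordChange_ell_left h0 h1 hu hjk) (coordChange_ell_right h0 hu hjk) m
    (fun B => θ (x B)) (fun B hB => by rw [← hgd, hx B hB, map_zero])
    (fun B hB hjB hkB => by
      have hBm : B = (Finset.univ.filter fun i : Rest j k => (i : ι) ∈ B).map (restEmb j k) := by
        ext a
        simp only [Finset.mem_map, Finset.mem_filter, Finset.mem_univ, true_and]
        constructor
        · intro ha
          exact ⟨⟨a, fun h => hjB (h ▸ ha), fun h => hkB (h ▸ ha)⟩, ha, rfl⟩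
        · rintro ⟨i, hi, rfl⟩; exact hi
      have := hx0 (Finset.univ.filter fun i : Rest j k => (i : ι) ∈ B) (by
        rw [← Finset.card_map (restEmb j k), ← hBm]; exact hB)
      rw [restr, ← hBm, elimHom, AlgHom.comp_apply] at this
      have h2 := sub_rename_killTwo_mem j k (θ (x B))
      rwa [this, map_zero, sub_zero] at h2)
  refine ⟨fun B => coordChange φ j k u (-1) (y B), fun B hB => ?_⟩
  have hinj : Function.Injective θ := Function.LeftInverse.injective (coordChange_inv φ hjk u)
  apply hinj
  rw [hy B hB, hgd]
  simp only [hθ, coordChange_inv' φ hjk u]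

include h1 hu in
lemma vac_compl_pair (h0 : ∀ i, φ i i = 0) (hjk : j ≠ k) :
    ∃ v : Rˣ, vac φ (Finset.univ.map (restEmb j k)) = v := by
  set A := Finset.univ.map (restEmb j k) with hA
  have hmem : ∀ i, i ∈ A ↔ i ≠ j ∧ i ≠ k := fun i => by simp [hA]
  have hj : j ∉ A := by simp [hmem]
  rw [(vac_isVac h0 h1).rec_formula hj, Finset.sum_eq_single k]
  · rw [if_neg (by simp [hmem, hjk.symm])]
    have : insert k (insert j A) = Finset.univ := by
      ext i
      simp only [Finset.mem_insert, hmem, Finset.mem_univ, iff_true]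
      tauto
    rw [this, vac_univ, mul_one, hu]
    unfold sgn
    exact ⟨-((-1) ^ (A.filter (· < j)).card *
      ((-1) ^ ((insert j A).filter (· < k)).card * u)), by push_cast; rfl⟩
  · intro b _ hb
    rw [if_pos]
    simp only [Finset.mem_insert, hmem]
    tauto
  · simp

include h0 h1 hu in
lemma restr_Om (hjk : j ≠ k) : ∃ v : Rˣ, ∀ B : Finset (Rest j k),
    vac φ (B.map (restEmb j k)) = v * vac (schur φ j k u) B := by
  obtain ⟨v, hv⟩ := vac_compl_pair h1 hu h0 hjk
  refine ⟨v, fun B => ?_⟩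
  set x : Finset (Rest j k) → R := fun B => vac φ (B.map (restEmb j k)) with hx
  have hvac : IsVac (schur φ j k u) x := by
    have h := restr_DD h0 h1 hu hjk (Om φ)
    rw [DD_Om h0 h1] at h
    have hr : restr φ j k u (Om φ) = fun B => C (x B) := by
      funext B
      simp [restr, Om, hx, algHom_C]
    rw [hr] at h
    intro i
    funext B
    have h2 := congrFun h B
    rw [DD_eq] at h2
    have h3 : ∀ l, gd (rowCoeff ((schur φ j k u).map C) l)
        (fun B => (C (x B) : MvPolynomial (Rest j k) R)) B
        = C (gd (rowCoeff (schur φ j k u) l) x B) := fun l => by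
      rw [gd_map, rowCoeff_map]
    simp only [h3] at h2
    have h4 := congrArg (coeff (Finsupp.single i 1)) h2
    rw [coeff_sum, Finset.sum_eq_single i] at h4
    · rw [coeff_X_mul', if_pos (by simp)] at h4
      simp only [tsub_self, coeff_zero_C] at h4
      rw [← h4]
      simp [restr]
    · intro l _ hl
      rw [coeff_X_mul', if_neg]
      simp [hl]
    · simp
  have := congrFun (hvac.eq_smul_vac (schur_diag h0 h1 j k u) (schur_skew h1 j k u)) B
  rw [Pi.smul_apply, smul_eq_mul, hx] at this
  rw [← hv]
  exact this

end Elimination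

/-! ### The complexes of an alternating matrix -/

section Complex

set_option linter.unusedSectionVars false

open MvPolynomial

variable {ι : Type} [Fintype ι] [LinearOrder ι] {R : Type} [CommRing R]

lemma gd_congr_flip {S : Type} [CommRing S] {c : ι → Bool → S} {x y : Finset ι → S}
    {B : Finset ι} (h : ∀ b, x (flip b B) = y (flip b B)) : gd c x B = gd c y B := by
  rw [gd_apply, gd_apply]
  exact Finset.sum_congr rfl fun b _ => by rw [h]

lemma even_card_flip {b : ι} {B : Finset ι} {t : ℕ} :
    Even ((flip b B).card + (t + 1)) ↔ Even (B.card + t) := by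
  by_cases hb : b ∈ B
  · have := card_flip_of_mem hb
    rw [← this, show (flip b B).card + 1 + t = (flip b B).card + (t + 1) by ring]
  · rw [card_flip_of_notMem hb, show B.card + 1 + (t + 1) = B.card + t + 2 by ring,
      Nat.even_add (n := 2)]
    simp

lemma isHomogeneous_ell (φ : Matrix ι ι R) (b : ι) : (ell φ b).IsHomogeneous 1 :=
  IsHomogeneous.sum _ _ _ fun j _ => by
    simpa using (isHomogeneous_X R j).mul (isHomogeneous_C ι (φ j b))

lemma isHomogeneous_dc (φ : Matrix ι ι R) (b : ι) (s : Bool) : (dc φ b s).IsHomogeneous 1 := by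
  cases s
  · exact isHomogeneous_ell φ b
  · exact isHomogeneous_X R b

lemma isHomogeneous_sgn (b : ι) (B : Finset ι) :
    (sgn (MvPolynomial ι R) b B).IsHomogeneous 0 := by
  rw [← sgn_map (C : R →+* MvPolynomial ι R)]
  exact isHomogeneous_C _ _

lemma DD_isHomogeneous (φ : Matrix ι ι R) {x : Finset ι → MvPolynomial ι R} {m : ℕ}
    (hx : ∀ B, (x B).IsHomogeneous m) (B : Finset ι) : (DD φ x B).IsHomogeneous (m + 1) := by
  rw [DD, gd_apply]
  refine IsHomogeneous.sum _ _ _ fun b _ => ?_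
  have := ((isHomogeneous_sgn (R := R) b B).mul (isHomogeneous_dc φ b (decide (b ∈ B)))).mul
    (hx (flip b B))
  rwa [zero_add, add_comm] at this

lemma homogeneousComponent_mul_of_one {p q : MvPolynomial ι R} (hq : q.IsHomogeneous 1) (m : ℕ) :
    homogeneousComponent (m + 1) (q * p) = q * homogeneousComponent m p := by
  have hp := sum_homogeneousComponent p
  conv_lhs => rw [← hp, Finset.mul_sum, map_sum]
  have : ∀ i, homogeneousComponent (m + 1) (q * homogeneousComponent i p) =
      if i = m then q * homogeneousComponent m p else 0 := by
    intro i
    have h := hq.mul (homogeneousComponent_isHomogeneous i p)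
    rw [homogeneousComponent_of_mem h]
    by_cases him : i = m
    · subst him; rw [if_pos (by ring), if_pos rfl]
    · rw [if_neg (by omega), if_neg him]
  simp_rw [this]
  rw [Finset.sum_ite_eq']
  split_ifs with h
  · rfl
  · rw [homogeneousComponent_eq_zero, mul_zero]
    simpa using h

lemma homogeneousComponent_zero_mul {p q : MvPolynomial ι R} (hq : q.IsHomogeneous 1) :
    homogeneousComponent 0 (q * p) = 0 := by
  have : constantCoeff q = 0 := hq.coeff_eq_zero (by simp)
  rw [homogeneousComponent_zero, ← constantCoeff_eq, map_mul, this, zero_mul, C_0]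

lemma homogeneousComponent_DD (φ : Matrix ι ι R) (x : Finset ι → MvPolynomial ι R) (m : ℕ)
    (B : Finset ι) : homogeneousComponent (m + 1) (DD φ x B) =
      DD φ (fun B => homogeneousComponent m (x B)) B := by
  rw [DD, gd_apply, gd_apply, map_sum]
  refine Finset.sum_congr rfl fun b _ => ?_
  have := (isHomogeneous_sgn (R := R) b B).mul (isHomogeneous_dc φ b (decide (b ∈ B)))
  rw [zero_add] at this
  exact homogeneousComponent_mul_of_one this m

lemma homogeneousComponent_zero_DD (φ : Matrix ι ι R) (x : Finset ι → MvPolynomial ι R)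
    (B : Finset ι) : homogeneousComponent 0 (DD φ x B) = 0 := by
  rw [DD, gd_apply, map_sum]
  refine Finset.sum_eq_zero fun b _ => ?_
  have := (isHomogeneous_sgn (R := R) b B).mul (isHomogeneous_dc φ b (decide (b ∈ B)))
  rw [zero_add] at this
  exact homogeneousComponent_zero_mul this

lemma homogeneousComponent_eq_self {p : MvPolynomial ι R} {m : ℕ} (h : p.IsHomogeneous m) :
    homogeneousComponent m p = p := by
  rw [homogeneousComponent_of_mem h, if_pos rfl]

/-- The sets supporting the `t`-th term of the complex. -/
def Esupp (q t : ℕ) (B : Finset ι) : Prop :=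
  (t ≤ q ∧ B.card ≤ t ∧ Even (B.card + t)) ∨ (t = q + 1 ∧ B = ∅)

/-- The terms of the complex. -/
def EE (ι : Type) [Fintype ι] [LinearOrder ι] (R : Type) [CommRing R] (q t : ℕ) :
    Submodule R (Finset ι → MvPolynomial ι R) where
  carrier := {x | (∀ B, (x B).IsHomogeneous (q - t)) ∧ ∀ B, ¬ Esupp q t B → x B = 0}
  zero_mem' := ⟨fun _ => isHomogeneous_zero _ _ _, fun _ _ => rfl⟩
  add_mem' := fun ha hb => ⟨fun B => (ha.1 B).add (hb.1 B), fun B hB => by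
    rw [Pi.add_apply, ha.2 B hB, hb.2 B hB, add_zero]⟩
  smul_mem' := fun r x hx => ⟨fun B => by
      rw [Pi.smul_apply, smul_eq_C_mul]
      simpa using (isHomogeneous_C ι r).mul (hx.1 B), fun B hB => by
    rw [Pi.smul_apply, hx.2 B hB, smul_zero]⟩

lemma mem_EE {q t : ℕ} {x : Finset ι → MvPolynomial ι R} : x ∈ EE ι R q t ↔
    (∀ B, (x B).IsHomogeneous (q - t)) ∧ ∀ B, ¬ Esupp q t B → x B = 0 := Iff.rfl

open Classical in
/-- The differential, on all vectors. -/
def dW (φ : Matrix ι ι R) (q t : ℕ) (x : Finset ι → MvPolynomial ι R) :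
    Finset ι → MvPolynomial ι R := fun B =>
  if Esupp q t B then (if t < q then DD φ x B else if t = q then x ∅ * Om φ B else 0) else 0

lemma dW_of_lt (φ : Matrix ι ι R) {q t : ℕ} (h : t < q) (x : Finset ι → MvPolynomial ι R)
    {B : Finset ι} (hB : B.card ≤ t) (hB' : Even (B.card + t)) : dW φ q t x B = DD φ x B := by
  rw [dW, if_pos (show Esupp q t B from Or.inl ⟨h.le, hB, hB'⟩), if_pos h]

lemma dW_self (φ : Matrix ι ι R) {q : ℕ} (x : Finset ι → MvPolynomial ι R)
    {B : Finset ι} (hB : B.card ≤ q) (hB' : Even (B.card + q)) :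
    dW φ q q x B = x ∅ * Om φ B := by
  rw [dW, if_pos (show Esupp q q B from Or.inl ⟨le_rfl, hB, hB'⟩), if_neg (lt_irrefl _), if_pos rfl]

lemma dW_of_gt (φ : Matrix ι ι R) {q t : ℕ} (h : q < t) (x : Finset ι → MvPolynomial ι R) :
    dW φ q t x = 0 := by
  funext B
  rw [dW, if_neg (by omega : ¬ t < q), if_neg (by omega : ¬ t = q)]; simp

lemma dW_mem (φ : Matrix ι ι R) {q t : ℕ} {x : Finset ι → MvPolynomial ι R}
    (hx : x ∈ EE ι R q (t + 1)) : dW φ q t x ∈ EE ι R q t := by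
  refine ⟨fun B => ?_, fun B hB => if_neg hB⟩
  unfold dW
  split_ifs with h1 h2 h3
  · have := DD_isHomogeneous φ hx.1 B
    rwa [show q - (t + 1) + 1 = q - t by omega] at this
  · subst h3
    have := (hx.1 ∅).mul (isHomogeneous_C ι (vac φ B))
    rwa [show t - (t + 1) + 0 = t - t by omega] at this
  · exact isHomogeneous_zero _ _ _
  · exact isHomogeneous_zero _ _ _

/-- The differential of the complex. -/
def dE (φ : Matrix ι ι R) (q t : ℕ) : EE ι R q (t + 1) →ₗ[R] EE ι R q t where
  toFun x := ⟨dW φ q t x, dW_mem φ x.2⟩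
  map_add' x y := by
    ext1; funext B
    simp only [dW, Submodule.coe_add, Pi.add_apply, map_add, DD]
    split_ifs <;> simp [add_mul]
  map_smul' r x := by
    ext1; funext B
    have : DD φ (r • (x : Finset ι → MvPolynomial ι R)) = (C r : MvPolynomial ι R) • DD φ x := by
      rw [← map_smul]
      congr 1
      funext B
      simp [smul_eq_C_mul]
    simp only [dW, Submodule.coe_smul, RingHom.id_apply, this, Pi.smul_apply, smul_eq_C_mul,
      smul_eq_mul]
    split_ifs <;> simp [mul_assoc]

lemma dE_coe (φ : Matrix ι ι R) (q t : ℕ) (x : EE ι R q (t + 1)) :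
    (dE φ q t x : Finset ι → MvPolynomial ι R) = dW φ q t x := rfl

variable {φ : Matrix ι ι R} (h0 : ∀ i, φ i i = 0) (h1 : ∀ i j, φ j i = - φ i j)

lemma EE_eq_zero_of_odd {q t : ℕ} (ht : t ≤ q) {x : Finset ι → MvPolynomial ι R}
    (hx : x ∈ EE ι R q t) {B : Finset ι} (hB : ¬ Even (B.card + t)) : x B = 0 :=
  hx.2 B (by rintro (⟨_, _, h⟩ | ⟨h, _⟩); exacts [hB h, by omega])

lemma DD_eq_zero_of_odd {q t : ℕ} (ht : t ≤ q) {x : Finset ι → MvPolynomial ι R}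
    (hx : x ∈ EE ι R q t) {B : Finset ι} (hB : Even (B.card + t)) : DD φ x B = 0 := by
  have : DD φ x B = DD φ 0 B := gd_congr_flip fun b => by
    rw [EE_eq_zero_of_odd ht hx, Pi.zero_apply]
    intro h
    have h2 : Even ((flip b B).card + (t + 1)) := even_card_flip.2 hB
    rw [← add_assoc, Nat.even_add_one] at h2
    exact h2 h
  rw [this, map_zero]; rfl

include h0 h1 in
lemma dE_dE (q t : ℕ) (x : EE ι R q (t + 1 + 1)) : dE φ q t (dE φ q (t + 1) x) = 0 := by
  ext1
  rw [dE_coe, dE_coe]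
  funext B
  rcases lt_trichotomy t q with h | h | h
  · by_cases hB : B.card ≤ t ∧ Even (B.card + t)
    · rw [dW_of_lt φ h _ hB.1 hB.2]
      have hfl : ∀ b, (flip b B).card ≤ t + 1 ∧ Even ((flip b B).card + (t + 1)) := fun b =>
        ⟨(card_flip_le b B).trans (by omega), even_card_flip.2 hB.2⟩
      rcases (show t + 1 ≤ q from h).lt_or_eq with h2 | h2
      · have : DD φ (dW φ q (t + 1) x) B = DD φ (DD φ x) B := gd_congr_flip fun b =>
          dW_of_lt φ h2 _ (hfl b).1 (hfl b).2
        rw [this, DD_DD h0 h1]; rfl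
      · subst h2
        have : DD φ (dW φ (t + 1) (t + 1) x) B =
            DD φ ((x : Finset ι → MvPolynomial ι R) ∅ • Om φ) B :=
          gd_congr_flip fun b => dW_self φ _ (hfl b).1 (hfl b).2
        rw [this, map_smul, DD_Om h0 h1, smul_zero]; rfl
    · rw [dW, if_neg]; · rfl
      rintro (⟨_, h2⟩ | ⟨h2, _⟩); exacts [hB h2, by omega]
  · subst h
    rw [dW_of_gt φ (Nat.lt_succ_self t)]
    rw [dW]; simp
  · rw [dW_of_gt φ h]; rfl

open Classical in
lemma exists_dE_eq_component (φ : Matrix ι ι R) {q t : ℕ} (ht : t ≤ q)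
    (y : Finset ι → MvPolynomial ι R) (c : R) : ∃ w : EE ι R q (t + 1), ∀ B, Esupp q t B →
      (dE φ q t w : Finset ι → MvPolynomial ι R) B =
        homogeneousComponent (q - t) (DD φ y B + C c * Om φ B) := by
  have hs : ∀ B : Finset ι, Esupp q t B → B.card ≤ t ∧ Even (B.card + t) := by
    rintro B (⟨_, h2⟩ | ⟨h2, _⟩)
    exacts [h2, by omega]
  rcases ht.lt_or_eq with h2 | h2
  · let z : Finset ι → MvPolynomial ι R := fun B =>
      if Esupp q (t + 1) B then homogeneousComponent (q - (t + 1)) (y B) else 0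
    have hz : z ∈ EE ι R q (t + 1) := by
      refine ⟨fun B => ?_, fun B hB => if_neg hB⟩
      simp only [z]
      split_ifs
      · exact homogeneousComponent_isHomogeneous _ _
      · exact isHomogeneous_zero _ _ _
    refine ⟨⟨z, hz⟩, fun B hB => ?_⟩
    replace hB := hs B hB
    rw [dE_coe, dW_of_lt φ h2 _ hB.1 hB.2, show q - t = q - (t + 1) + 1 by omega, map_add,
      homogeneousComponent_DD, Om, ← C_mul, homogeneousComponent_of_mem (isHomogeneous_C ι _),
      if_neg (by omega), add_zero]
    refine gd_congr_flip fun b => ?_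
    simp only [z]
    rw [if_pos (show Esupp q (t + 1) (flip b B) from
      Or.inl ⟨h2, (card_flip_le b B).trans (by omega), even_card_flip.2 hB.2⟩)]
  · subst h2
    let z : Finset ι → MvPolynomial ι R := fun B => if B = ∅ then C c else 0
    have hz : z ∈ EE ι R t (t + 1) := by
      refine ⟨fun B => ?_, fun B hB => if_neg fun h => hB (Or.inr ⟨rfl, h⟩)⟩
      simp only [z]
      rw [show t - (t + 1) = 0 by omega]
      split_ifs
      · exact isHomogeneous_C _ _
      · exact isHomogeneous_zero _ _ _
    refine ⟨⟨z, hz⟩, fun B hB => ?_⟩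
    replace hB := hs B hB
    rw [dE_coe, dW_self φ _ hB.1 hB.2, Nat.sub_self, map_add, homogeneousComponent_zero_DD,
      zero_add, Om, ← C_mul, homogeneousComponent_of_mem (isHomogeneous_C ι _), if_pos rfl]
    simp only [z]
    rw [if_pos trivial, C_mul]

lemma mem_range_dE_of {q t : ℕ} (ht : t ≤ q) (m : EE ι R q t) (y : Finset ι → MvPolynomial ι R)
    (c : R) (h : ∀ B : Finset ι, B.card ≤ t → (m : Finset ι → MvPolynomial ι R) B =
      DD φ y B + C c * Om φ B) : m ∈ LinearMap.range (dE φ q t) := by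
  obtain ⟨w, hw⟩ := exists_dE_eq_component φ ht y c
  refine ⟨w, ?_⟩
  ext1
  funext B
  by_cases hB : Esupp q t B
  · rw [hw B hB, ← h B, homogeneousComponent_eq_self (m.2.1 B)]
    rcases hB with ⟨_, h2, _⟩ | ⟨h2, _⟩
    exacts [h2, by omega]
  · rw [m.2.2 B hB, (dE φ q t w).2.2 B hB]

include h0 h1 in
lemma exists_of_mem_range_dE {q t : ℕ} (hn : Even (Fintype.card ι + q)) (ht : t ≤ q)
    (m : EE ι R q t) (h : m ∈ LinearMap.range (dE φ q t)) :
    ∃ (y : Finset ι → MvPolynomial ι R) (c : R), ∀ B : Finset ι, B.card ≤ t →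
      (m : Finset ι → MvPolynomial ι R) B = DD φ y B + C c * Om φ B := by
  obtain ⟨z, rfl⟩ := h
  rcases ht.lt_or_eq with h2 | h2
  · refine ⟨z, 0, fun B hB => ?_⟩
    rw [C_0, zero_mul, add_zero]
    by_cases hB' : Even (B.card + t)
    · rw [dE_coe, dW_of_lt φ h2 _ hB hB']
    · rw [EE_eq_zero_of_odd ht (dE φ q t z).2 hB', DD_eq_zero_of_odd (q := q) h2 z.2]
      rw [Nat.succ_eq_add_one, ← add_assoc, Nat.even_add_one]; exact hB'
  · subst h2
    have hz : ((z : Finset ι → MvPolynomial ι R) ∅).IsHomogeneous 0 := by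
      have := z.2.1 ∅; rwa [show t - (t + 1) = 0 by omega] at this
    refine ⟨0, coeff 0 ((z : Finset ι → MvPolynomial ι R) ∅), fun B hB => ?_⟩
    rw [map_zero, Pi.zero_apply, zero_add, ← homogeneousComponent_zero,
      homogeneousComponent_eq_self hz]
    by_cases hB' : Even (B.card + t)
    · rw [dE_coe, dW_self φ _ hB hB']
    · rw [EE_eq_zero_of_odd ht (dE φ t t z).2 hB', Om, vac_parity h0 h1, C_0, mul_zero]
      have := Finset.card_add_card_compl B
      rw [← Nat.not_even_iff_odd]
      intro h
      rw [← this, add_right_comm] at hn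
      exact hB' ((Nat.even_add.1 hn).2 h)

lemma dE_eq_zero_iff {q t : ℕ} (ht : t < q) (x : EE ι R q (t + 1)) : dE φ q t x = 0 ↔
    ∀ B : Finset ι, B.card ≤ t → DD φ (x : Finset ι → MvPolynomial ι R) B = 0 := by
  rw [Subtype.ext_iff, dE_coe]
  constructor
  · intro h B hB
    by_cases hB' : Even (B.card + t)
    · rw [← dW_of_lt φ ht _ hB hB', h]; rfl
    · exact DD_eq_zero_of_odd (q := q) ht x.2
        (by rw [Nat.succ_eq_add_one, ← add_assoc, Nat.even_add_one]; exact hB')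
  · intro h
    funext B
    rw [dW]
    split_ifs with h2
    · rcases h2 with ⟨_, h2, _⟩ | ⟨h2, _⟩
      · rw [h B h2]; rfl
      · omega
    · rfl

lemma mem_initSub_self {a : ℕ → R} {s : ℕ} {x : R} : x ∈ initSub a R s ↔ x ∈ initIdeal a s := by
  rw [initSub, smul_eq_mul, Ideal.mul_top]

lemma mem_initSub_EE {q t : ℕ} {a : ℕ → R} {s : ℕ} {x : EE ι R q t} :
    x ∈ initSub a (EE ι R q t) s ↔
      ∀ B m, coeff m ((x : Finset ι → MvPolynomial ι R) B) ∈ initIdeal a s := by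
  classical
  constructor
  · intro h
    refine Submodule.smul_induction_on h (fun r hr y _ B m => ?_) fun x y hx hy B m => ?_
    · rw [Submodule.coe_smul, Pi.smul_apply, coeff_smul, smul_eq_mul]
      exact Ideal.mul_mem_right _ _ hr
    · rw [Submodule.coe_add, Pi.add_apply, coeff_add]; exact add_mem (hx B m) (hy B m)
  · intro h
    let e : Finset ι → (ι →₀ ℕ) → EE ι R q t := fun B m =>
      if hB : Esupp q t B ∧ m.degree = q - t then
        ⟨Pi.single B (monomial m 1), fun B' => by
          rcases eq_or_ne B' B with rfl | hne
          · rw [Pi.single_eq_same]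
            exact isHomogeneous_monomial _ hB.2
          · rw [Pi.single_eq_of_ne hne]; exact isHomogeneous_zero _ _ _,
          fun B' hB' => Pi.single_eq_of_ne (by rintro rfl; exact hB' hB.1) _⟩
      else 0
    have hx : x = ∑ B, ∑ m ∈ ((x : Finset ι → MvPolynomial ι R) B).support,
        coeff m ((x : Finset ι → MvPolynomial ι R) B) • e B m := by
      ext1
      funext B
      rw [Submodule.coe_sum, Finset.sum_apply, Finset.sum_eq_single B]
      · rw [Submodule.coe_sum, Finset.sum_apply]
        conv_lhs => rw [(x.1 B).as_sum]
        refine Finset.sum_congr rfl fun m hm => ?_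
        have hsupp : Esupp q t B := by
          by_contra hB
          rw [x.2.2 B hB] at hm
          simp at hm
        have hdeg : m.degree = q - t := by
          rw [Finsupp.degree_eq_weight_one]
          exact (x.2.1 B) (mem_support_iff.1 hm)
        have : (e B m : Finset ι → MvPolynomial ι R) = Pi.single B (monomial m 1) := by
          simp only [e]; rw [dif_pos ⟨hsupp, hdeg⟩]
        rw [Submodule.coe_smul, this, Pi.smul_apply, Pi.single_eq_same, smul_monomial, smul_eq_mul,
          mul_one]
      · intro B' _ hB'
        rw [Submodule.coe_sum, Finset.sum_apply]
        refine Finset.sum_eq_zero fun m hm => ?_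
        by_cases hh : Esupp q t B' ∧ m.degree = q - t
        · have : (e B' m : Finset ι → MvPolynomial ι R) = Pi.single B' (monomial m 1) := by
            simp only [e]; rw [dif_pos hh]
          rw [Submodule.coe_smul, this, Pi.smul_apply, Pi.single_eq_of_ne hB'.symm, smul_zero]
        · have : e B' m = 0 := dif_neg hh
          rw [this, smul_zero]; rfl
      · simp
    rw [hx]
    exact sum_mem fun B _ => sum_mem fun m _ => Submodule.smul_mem_smul (h B m) trivial

lemma WReg.EE {a : ℕ → R} {r : ℕ} (ha : WReg a R r) (q t : ℕ) : WReg a (EE ι R q t) r := by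
  intro s hs y hy
  rw [mem_initSub_EE] at hy ⊢
  intro B m
  have := hy B m
  rw [Submodule.coe_smul, Pi.smul_apply, coeff_smul, ← mem_initSub_self] at this
  exact mem_initSub_self.1 (ha s hs _ this)

end Complex

/-! ### Localization of the complexes -/

section Localize

set_option linter.unusedSectionVars false

open MvPolynomial

variable {ι : Type} [Fintype ι] [LinearOrder ι] {R : Type} [CommRing R]

lemma DD_map {S : Type} [CommRing S] (f : R →+* S) (φ : Matrix ι ι R)
    (x : Finset ι → MvPolynomial ι R) (B : Finset ι) :
    MvPolynomial.map f (DD φ x B) = DD (φ.map f) (fun B => MvPolynomial.map f (x B)) B := by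
  have : (fun b s => MvPolynomial.map f (dc φ b s)) = dc (φ.map f) := by
    funext b s
    cases s
    · simp [dc, ell, map_sum]
    · simp [dc]
  rw [DD, gd_map, this]

lemma Om_map {S : Type} [CommRing S] (f : R →+* S) {φ : Matrix ι ι R}
    (h0 : ∀ i, φ i i = 0) (h1 : ∀ i j, φ j i = - φ i j) (B : Finset ι) :
    MvPolynomial.map f (Om φ B) = Om (φ.map f) B := by
  rw [Om, map_C, vac_map f h0 h1, Om]

lemma map_skew {S : Type} [CommRing S] (f : R →+* S) {φ : Matrix ι ι R}
    (h1 : ∀ i j, φ j i = - φ i j) (i j : ι) : (φ.map f) j i = - (φ.map f) i j := by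
  simp [h1 i j]

lemma map_diag {S : Type} [CommRing S] (f : R →+* S) {φ : Matrix ι ι R}
    (h0 : ∀ i, φ i i = 0) (i : ι) : (φ.map f) i i = 0 := by
  simp [h0 i]

lemma map_vacIdeal_le {S : Type} [CommRing S] (f : R →+* S) {φ : Matrix ι ι R}
    (h0 : ∀ i, φ i i = 0) (h1 : ∀ i j, φ j i = - φ i j) (q : ℕ) :
    (vacIdeal φ q).map f ≤ vacIdeal (φ.map f) q := by
  rw [vacIdeal, Ideal.map_span, Ideal.span_le]
  rintro _ ⟨_, ⟨B, hB, rfl⟩, rfl⟩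
  rw [vac_map f h0 h1]
  exact vac_mem_vacIdeal _ hB

section Loc

attribute [local instance] MvPolynomial.algebraMvPolynomial

variable (M : Submonoid R) {K : Type} [CommRing K] [Algebra R K] [IsLocalization M K]

include M in
lemma exists_clear {σ τ : Type} [Finite τ] (z : τ → MvPolynomial σ K) :
    ∃ s ∈ M, ∃ z0 : τ → MvPolynomial σ R, ∀ i,
      MvPolynomial.map (algebraMap R K) (z0 i) = C (algebraMap R K s) * z i := by
  obtain ⟨⟨_, s, hs, rfl⟩, h⟩ := IsLocalization.exist_integer_multiples_of_finite
    (M.map (C (σ := σ))) z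
  choose z0 hz0 using h
  refine ⟨s, hs, z0, fun i => ?_⟩
  have := hz0 i
  rw [Algebra.smul_def] at this
  change MvPolynomial.map (algebraMap R K) (z0 i) =
    MvPolynomial.map (algebraMap R K) (C s) * z i at this
  rwa [map_C] at this

include M in
lemma exists_clear_zero {σ τ : Type} [Fintype τ] (z : τ → MvPolynomial σ R)
    (hz : ∀ i, MvPolynomial.map (algebraMap R K) (z i) = 0) : ∃ s ∈ M, ∀ i, C s * z i = 0 := by
  have h1 : ∀ i, ∃ s ∈ M, C s * z i = 0 := by
    intro i
    have h : algebraMap (MvPolynomial σ R) (MvPolynomial σ K) (z i) = 0 := hz i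
    obtain ⟨⟨_, s, hs, rfl⟩, h⟩ :=
      (IsLocalization.map_eq_zero_iff (M.map (C (σ := σ))) (MvPolynomial σ K) (z i)).1 h
    exact ⟨s, hs, h⟩
  choose s hs h using h1
  refine ⟨∏ i, s i, prod_mem fun i _ => hs i, fun i => ?_⟩
  classical
  rw [← Finset.prod_erase_mul _ _ (Finset.mem_univ i), C_mul, mul_assoc, h, mul_zero]

include M in
lemma WReg.localize {a : ℕ → R} {r : ℕ} (ha : WReg a R r) :
    WReg (fun i => algebraMap R K (a i)) K r := by
  have hI : ∀ s, initIdeal (fun i => algebraMap R K (a i)) s =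
      (initIdeal a s).map (algebraMap R K) := by
    intro s
    induction s with
    | zero => simp [initIdeal]
    | succ s ih => rw [initIdeal, ih, initIdeal, Ideal.map_sup, Ideal.map_span,
        Set.image_singleton]
  intro s hs y hy
  rw [mem_initSub_self, hI] at hy ⊢
  obtain ⟨⟨y0, m⟩, rfl⟩ := IsLocalization.mk'_surjective M y
  obtain ⟨⟨⟨z, hz⟩, m'⟩, h⟩ := (IsLocalization.mem_map_algebraMap_iff M K).1 hy
  simp only [smul_eq_mul] at h
  have h2 : algebraMap R K (a s * y0 * m') = algebraMap R K (m * z) := by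
    rw [map_mul, map_mul, map_mul, ← h, ← IsLocalization.mk'_spec K y0 m]
    ring
  obtain ⟨c, hc⟩ := (IsLocalization.eq_iff_exists M K).1 h2
  have h3 : (c : R) * m' * y0 ∈ initIdeal a s := by
    refine mem_initSub_self.1 (ha s hs _ (mem_initSub_self.2 ?_))
    rw [smul_eq_mul, show a s * (c * m' * y0) = c * (a s * y0 * m') by ring, hc]
    exact Ideal.mul_mem_left _ _ (Ideal.mul_mem_left _ _ hz)
  refine (IsLocalization.mem_map_algebraMap_iff M K).2 ⟨⟨⟨_, h3⟩, c * m' * m⟩, ?_⟩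
  simp only [Submonoid.coe_mul, map_mul]
  rw [← IsLocalization.mk'_spec K y0 m]
  ring

include M in
lemma exists_smul_of_localize {φ : Matrix ι ι R} (h0 : ∀ i, φ i i = 0)
    (h1 : ∀ i j, φ j i = - φ i j) {t : ℕ} (x : Finset ι → MvPolynomial ι R)
    (y : Finset ι → MvPolynomial ι K) (c : K)
    (h : ∀ B : Finset ι, B.card ≤ t → MvPolynomial.map (algebraMap R K) (x B) =
      DD (φ.map (algebraMap R K)) y B + C c * Om (φ.map (algebraMap R K)) B) :
    ∃ s ∈ M, ∃ (y0 : Finset ι → MvPolynomial ι R) (c0 : R), ∀ B : Finset ι, B.card ≤ t →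
      C s * x B = DD φ y0 B + C c0 * Om φ B := by
  obtain ⟨s, hs, y0, hy0⟩ := exists_clear M y
  obtain ⟨⟨c0, s'⟩, hc0⟩ := IsLocalization.surj M c
  simp only at hc0
  classical
  obtain ⟨s'', hs'', hz⟩ := exists_clear_zero (K := K) M (fun B : Finset ι => if B.card ≤ t then
    C (s * s') * x B - (C (s' : R) * DD φ y0 B + C (s * c0) * Om φ B) else 0) (by
      intro B
      split_ifs with hB
      · simp only [map_sub, map_add, map_mul, map_C, DD_map, Om_map _ h0 h1, hy0]
        rw [h B hB, ← hc0]
        have : DD (φ.map (algebraMap R K)) (fun B => C (algebraMap R K s) * y B) B =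
            C (algebraMap R K s) * DD (φ.map (algebraMap R K)) y B := by
          have := congrFun (map_smul (DD (φ.map (algebraMap R K)))
            (C (algebraMap R K s) : MvPolynomial ι K) y) B
          exact this
        rw [this]
        simp only [map_mul]
        ring
      · simp)
  refine ⟨s'' * (s * s'), M.mul_mem hs'' (M.mul_mem hs s'.2),
    (C (s'' * s') : MvPolynomial ι R) • y0, s'' * (s * c0), fun B hB => ?_⟩
  have := hz B
  rw [if_pos hB, mul_sub, sub_eq_zero] at this
  rw [C_mul, mul_assoc, this, map_smul, Pi.smul_apply, smul_eq_mul]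
  simp only [map_mul]
  ring

include M in
/-- Membership in the image of the differential can be checked after localization, up to a
denominator. -/
lemma exists_smul_mem_range_dE {φ : Matrix ι ι R} (h0 : ∀ i, φ i i = 0)
    (h1 : ∀ i j, φ j i = - φ i j) {q t : ℕ} (ht : t ≤ q) (m : EE ι R q t)
    (y : Finset ι → MvPolynomial ι K) (c : K)
    (h : ∀ B : Finset ι, B.card ≤ t →
      MvPolynomial.map (algebraMap R K) ((m : Finset ι → MvPolynomial ι R) B) =
      DD (φ.map (algebraMap R K)) y B + C c * Om (φ.map (algebraMap R K)) B) :
    ∃ s ∈ M, s • m ∈ LinearMap.range (dE φ q t) := by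
  obtain ⟨s, hs, y0, c0, h⟩ := exists_smul_of_localize M h0 h1 _ y c h
  refine ⟨s, hs, mem_range_dE_of ht _ y0 c0 fun B hB => ?_⟩
  rw [← h B hB, Submodule.coe_smul, Pi.smul_apply, smul_eq_C_mul]

end Loc

end Localize

/-! ### Elimination of a unit entry -/

section UnitEntry

set_option linter.unusedSectionVars false

open MvPolynomial

variable {ι : Type} [Fintype ι] [LinearOrder ι] {R : Type} [CommRing R]

/-- Exactness of the complex of an alternating matrix at one spot. -/
abbrev ExE (φ : Matrix ι ι R) (q i : ℕ) : Prop := ExactAt (E := fun t => EE ι R q t) (dE φ q) i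

lemma isHomogeneous_elimHom (φ : Matrix ι ι R) (j k : ι) (u : Rˣ) {p : MvPolynomial ι R} {m : ℕ}
    (hp : p.IsHomogeneous m) : (elimHom φ j k u p).IsHomogeneous m := by
  have hs : ∀ (l : ι) (e : R), (C e * substForm φ j k l u).IsHomogeneous 1 := by
    intro l e
    have h1 : (∑ i : Rest j k, X (i : ι) * C (φ i l) : MvPolynomial ι R).IsHomogeneous 1 :=
      IsHomogeneous.sum _ _ _ fun i _ => by
        simpa using (isHomogeneous_X R (i : ι)).mul (isHomogeneous_C ι (φ i l))
    simpa [substForm] using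
      (isHomogeneous_C ι e).mul ((isHomogeneous_C ι ((u⁻¹ : Rˣ) : R)).mul h1)
  have h1 : (coordChange φ j k u 1 p).IsHomogeneous m := by
    have := hp.aeval (fun i => if i = j then X j - C (1 : R) * substForm φ j k k u else
      if i = k then X k + C (1 : R) * substForm φ j k j u else X i) (n := 1) (fun i => by
        split_ifs
        · exact (isHomogeneous_X R j).sub (hs _ _)
        · exact (isHomogeneous_X R k).add (hs _ _)
        · exact isHomogeneous_X R i)
    rwa [one_mul] at this
  have := h1.aeval (fun i => if h : i ≠ j ∧ i ≠ k then
    (X ⟨i, h⟩ : MvPolynomial (Rest j k) R) else 0) (n := 1) (fun i => by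
      split_ifs
      · exact isHomogeneous_X R _
      · exact isHomogeneous_zero _ _ _)
  rwa [one_mul] at this

lemma restr_mem_EE (φ : Matrix ι ι R) (j k : ι) (u : Rˣ) {q t : ℕ}
    {x : Finset ι → MvPolynomial ι R} (hx : x ∈ EE ι R q t) :
    restr φ j k u x ∈ EE (Rest j k) R q t := by
  refine ⟨fun B => isHomogeneous_elimHom φ j k u (hx.1 _), fun B hB => ?_⟩
  rw [restr, hx.2, map_zero]
  simpa [Esupp] using hB

lemma elimHom_rename (φ : Matrix ι ι R) (j k : ι) (u : Rˣ) (p : MvPolynomial (Rest j k) R) :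
    elimHom φ j k u (rename (restEmb j k) p) = p := by
  have : ((elimHom φ j k u).comp (rename (restEmb j k))) = AlgHom.id R _ := by
    apply MvPolynomial.algHom_ext
    intro i
    simp only [AlgHom.comp_apply, rename_X, AlgHom.id_apply]
    exact elimHom_rest φ u i
  exact AlgHom.congr_fun this p

lemma exists_restr_eq (φ : Matrix ι ι R) (j k : ι) (u : Rˣ)
    (y : Finset (Rest j k) → MvPolynomial (Rest j k) R) : ∃ x, restr φ j k u x = y := by
  classical
  refine ⟨fun B => rename (restEmb j k) (y (B.subtype _)), ?_⟩
  funext B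
  have : (B.map (restEmb j k)).subtype (fun i => i ≠ j ∧ i ≠ k) = B := by
    ext i
    simpa [Finset.mem_subtype, not_or] using fun _ => i.2
  rw [restr, this, elimHom_rename]

lemma schur_map {S : Type} [CommRing S] (f : R →+* S) (φ : Matrix ι ι R) (j k : ι) (u : Rˣ) :
    schur (φ.map f) j k (Units.map (f : R →* S) u) = (schur φ j k u).map f := by
  ext a b
  simp [schur, ← map_inv]

variable {φ : Matrix ι ι R} (h0 : ∀ i, φ i i = 0) (h1 : ∀ i j, φ j i = - φ i j)
  {j k : ι} {u : Rˣ} (hu : φ j k = u)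

include h0 h1 hu

lemma vacIdeal_le_schur (hjk : j ≠ k) (q : ℕ) : vacIdeal φ q ≤ vacIdeal (schur φ j k u) q := by
  set J := vacIdeal (schur φ j k u) q with hJ
  set f := Ideal.Quotient.mk J with hf
  have h0' := map_diag f h0
  have h1' := map_skew f h1
  have hu' : (φ.map f) j k = (Units.map (f : R →* R ⧸ J) u : (R ⧸ J)ˣ) := by simp [hu]
  obtain ⟨v, hv⟩ := restr_Om h0' h1' hu' hjk
  obtain ⟨y, hy⟩ := exists_DD_of_restr h0' h1' hu' hjk q (Om (φ.map f))
    (fun B _ => by rw [DD_Om h0' h1']; rfl) (fun B hB => by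
      rw [restr, Om, hv, schur_map, ← vac_map f (schur_diag h0 h1 j k u) (schur_skew h1 j k u),
        Ideal.Quotient.eq_zero_iff_mem.2 (vac_mem_vacIdeal _ hB), mul_zero, C_0, map_zero])
  rw [vacIdeal, Ideal.span_le]
  rintro _ ⟨B, hB, rfl⟩
  refine Ideal.Quotient.eq_zero_iff_mem.1 ?_
  have h2 := congrArg (homogeneousComponent 0) (hy B hB)
  rw [homogeneousComponent_zero_DD, Om, homogeneousComponent_eq_self (isHomogeneous_C _ _), C_eq_zero,
    ← vac_map f h0 h1] at h2
  exact h2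

lemma exists_DD_of_schur_exact (hjk : j ≠ k) {q : ℕ} (hn : Even (Fintype.card (Rest j k) + q))
    (hex : ∀ i, ExE (schur φ j k u) q i) {t : ℕ} (ht : t + 1 ≤ q)
    (x : EE ι R q (t + 1)) (hx : dE φ q t x = 0) :
    ∃ (y : Finset ι → MvPolynomial ι R) (c : R), ∀ B : Finset ι, B.card ≤ t + 1 →
      (x : Finset ι → MvPolynomial ι R) B = DD φ y B + C c * Om φ B := by
  have hs0 := schur_diag h0 h1 j k u
  have hs1 := schur_skew h1 j k u
  have hcyc := (dE_eq_zero_iff ht x).1 hx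
  let x' : EE (Rest j k) R q (t + 1) := ⟨restr φ j k u x, restr_mem_EE φ j k u x.2⟩
  have hx' : dE (schur φ j k u) q t x' = 0 := by
    rw [dE_eq_zero_iff ht]
    intro B hB
    change DD _ (restr φ j k u x) B = 0
    rw [← restr_DD h0 h1 hu hjk, restr, hcyc _ (by simpa using hB), map_zero]
  obtain ⟨y', c', h'⟩ := exists_of_mem_range_dE hs0 hs1 hn ht x' (hex t x' hx')
  obtain ⟨y, rfl⟩ := exists_restr_eq φ j k u y'
  obtain ⟨v, hv⟩ := restr_Om h0 h1 hu hjk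
  set c := c' * ((v⁻¹ : Rˣ) : R) with hc
  obtain ⟨y2, hy2⟩ := exists_DD_of_restr h0 h1 hu hjk (t + 1)
    ((x : Finset ι → MvPolynomial ι R) - DD φ y - (C c : MvPolynomial ι R) • Om φ) (by
      intro B hB
      rw [map_sub, map_sub, map_smul, DD_DD h0 h1, DD_Om h0 h1]
      simp [hcyc B (by omega)]) (by
      intro B hB
      have h2 : restr φ j k u x B = _ := h' B hB
      rw [← restr_DD h0 h1 hu hjk] at h2
      have h3 : restr φ j k u ((x : Finset ι → MvPolynomial ι R) - DD φ y -
          (C c : MvPolynomial ι R) • Om φ) B = restr φ j k u x B - restr φ j k u (DD φ y) B -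
          C c * elimHom φ j k u (Om φ (B.map (restEmb j k))) := by
        simp only [restr, Pi.sub_apply, Pi.smul_apply, map_sub, smul_eq_mul, map_mul]
        congr 2
        exact (elimHom φ j k u).commutes c
      rw [h3, h2, Om, Om, hv]
      have h4 : elimHom φ j k u (C (v * vac (schur φ j k u) B)) =
        C (v * vac (schur φ j k u) B) := (elimHom φ j k u).commutes _
      rw [h4, ← C_mul, ← C_mul, hc, show c' * ((v⁻¹ : Rˣ) : R) * (v * vac (schur φ j k u) B) =
        (((v⁻¹ : Rˣ) : R) * v) * (c' * vac (schur φ j k u) B) by ring, Units.inv_mul, one_mul]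
      ring)
  refine ⟨y + y2, c, fun B hB => ?_⟩
  have := hy2 B hB
  simp only [Pi.sub_apply, Pi.smul_apply, smul_eq_mul] at this
  rw [map_add, Pi.add_apply, ← this]
  ring

lemma eq_zero_of_schur_exact (hjk : j ≠ k) {q : ℕ}
    (hex : ExE (schur φ j k u) q q)
    (z : R) (hz : ∀ B : Finset ι, B.card ≤ q → z * vac φ B = 0) : z = 0 := by
  have hs0 := schur_diag h0 h1 j k u
  have hs1 := schur_skew h1 j k u
  obtain ⟨v, hv⟩ := restr_Om h0 h1 hu hjk
  classical
  let x : EE (Rest j k) R q (q + 1) := ⟨fun B => if B = ∅ then C z else 0, by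
    refine ⟨fun B => ?_, fun B hB => if_neg fun h => hB (Or.inr ⟨rfl, h⟩)⟩
    rw [show q - (q + 1) = 0 by omega]
    dsimp only
    split_ifs
    · exact isHomogeneous_C _ _
    · exact isHomogeneous_zero _ _ _⟩
  have hx : dE (schur φ j k u) q q x = 0 := by
    ext1
    rw [dE_coe]
    funext B
    by_cases hB : B.card ≤ q ∧ Even (B.card + q)
    · rw [dW_self _ _ hB.1 hB.2]
      simp only [x, if_pos]
      rw [Om, ← C_mul]
      have := hz (B.map (restEmb j k)) (by simpa using hB.1)
      rw [hv, mul_left_comm, v.isUnit.mul_right_eq_zero] at this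
      rw [this, C_0]; rfl
    · rw [dW, if_neg]
      · rfl
      rintro (⟨_, h2⟩ | ⟨h2, _⟩)
      exacts [hB h2, by omega]
  obtain ⟨y, hy⟩ := hex x hx
  have := congrFun (congrArg Subtype.val hy) ∅
  rw [dE_coe, dW_of_gt _ (Nat.lt_succ_self q)] at this
  simpa [x] using this.symm

end UnitEntry

/-! ### Exactness of the complexes -/

section Exactness

set_option linter.unusedSectionVars false

open MvPolynomial

lemma WReg.mono {R : Type} [CommRing R] {M : Type} [AddCommGroup M] [Module R M] {a : ℕ → R}
    {r s : ℕ} (h : WReg a M r) (hs : s ≤ r) : WReg a M s := fun i hi => h i (hi.trans_le hs)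

/-- The depth condition on the ideals of Pfaffians. -/
def VacDepth {ι : Type} [Fintype ι] [LinearOrder ι] {R : Type} [CommRing R] (φ : Matrix ι ι R)
    (q : ℕ) : Prop :=
  ∀ q', Odd q' → q' + 2 ≤ Fintype.card ι → ∃ a : ℕ → R,
    (∀ i < min (q + 1) (q' + 1), a i ∈ vacIdeal φ q') ∧ WReg a R (min (q + 1) (q' + 1))

variable {ι : Type} [Fintype ι] [LinearOrder ι] {R : Type} [CommRing R]

lemma card_rest {j k : ι} (hjk : j ≠ k) : Fintype.card (Rest j k) + 2 = Fintype.card ι := by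
  have := sum_split hjk (fun _ => (1 : ℕ))
  simp only [Finset.sum_const, Finset.card_univ, smul_eq_mul, mul_one] at this
  omega

lemma vacIdeal_le_entries {φ : Matrix ι ι R} (h0 : ∀ i, φ i i = 0) (h1 : ∀ i j, φ j i = - φ i j)
    {q : ℕ} (hq : q < Fintype.card ι) {J : Ideal R} (hJ : ∀ i j, i ≠ j → φ i j ∈ J) :
    vacIdeal φ q ≤ J := by
  rw [vacIdeal, Ideal.span_le]
  rintro _ ⟨B, hB, rfl⟩
  obtain ⟨j, hj⟩ : ∃ j, j ∉ B := by
    by_contra! h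
    have : B = Finset.univ := by ext; simp [h]
    rw [this, Finset.card_univ] at hB
    omega
  rw [(vac_isVac h0 h1).rec_formula hj]
  refine J.neg_mem (J.mul_mem_left _ (sum_mem fun b _ => ?_))
  split_ifs with hb
  · exact J.zero_mem
  · refine J.mul_mem_right _ (J.mul_mem_left _ (hJ j b ?_))
    rintro rfl
    exact hb (Finset.mem_insert_self _ _)

lemma VacDepth.schur {φ : Matrix ι ι R} (h0 : ∀ i, φ i i = 0) (h1 : ∀ i j, φ j i = - φ i j)
    {q : ℕ} (h : VacDepth φ q) (M : Submonoid R) {K : Type} [CommRing K] [Algebra R K]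
    [IsLocalization M K] {j k : ι} (hjk : j ≠ k) {u : Kˣ} (hu : algebraMap R K (φ j k) = u) :
    VacDepth (Paper.schur (φ.map (algebraMap R K)) j k u) q := by
  intro q' hq' hn
  obtain ⟨a, ha, hreg⟩ := h q' hq' (by have := card_rest hjk; omega)
  refine ⟨fun i => algebraMap R K (a i), fun i hi => ?_, hreg.localize M⟩
  exact vacIdeal_le_schur (map_diag _ h0) (map_skew _ h1) (by simpa using hu) hjk q'
    (map_vacIdeal_le _ h0 h1 q' (Ideal.mem_map_of_mem _ (ha i hi)))

lemma EE_eq_zero {q t : ℕ} (ht : q + 2 ≤ t) (x : EE ι R q t) : x = 0 := by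
  ext1
  funext B
  exact x.2.2 B (by rintro (⟨h, _⟩ | ⟨h, _⟩) <;> omega)

lemma mem_coefIdeal_empty {𝔟 : Ideal R} {p : MvPolynomial ι R} :
    p ∈ coefIdeal 𝔟 (∅ : Finset ι) ↔ ∀ m, coeff m p ∈ 𝔟 := by
  rw [mem_coefIdeal]
  simp

/-- In high degrees the complex is exact modulo every initial part of every sequence. -/
lemma exactMod_dE_of_card_le {φ : Matrix ι ι R} (h0 : ∀ i, φ i i = 0)
    (h1 : ∀ i j, φ j i = - φ i j) {q t : ℕ} (hn : Fintype.card ι ≤ t + 1) (ht : t + 1 ≤ q)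
    (a : ℕ → R) (s : ℕ) : ExactMod (E := fun t => EE ι R q t) (dE φ q) a s t := by
  intro x hx
  rw [mem_initSub_EE] at hx
  have hcyc : ∀ B, DD φ (x : Finset ι → MvPolynomial ι R) B ∈ coefIdeal (initIdeal a s) ∅ := by
    intro B
    rw [mem_coefIdeal_empty]
    intro m
    by_cases hB : B.card ≤ t ∧ Even (B.card + t)
    · have := hx B m
      rwa [dE_coe, dW_of_lt φ ht _ hB.1 hB.2] at this
    · have h2 : Even (B.card + (t + 1)) := by
        by_cases h3 : Even (B.card + t)
        · have h4 := Finset.card_le_univ B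
          have h5 : B.card = t + 1 := by
            by_contra h5
            exact hB ⟨by omega, h3⟩
          rw [h5]; exact ⟨t + 1, rfl⟩
        · rw [← add_assoc, Nat.even_add_one]; exact h3
      rw [DD_eq_zero_of_odd ht x.2 h2, coeff_zero]
      exact Ideal.zero_mem _
  obtain ⟨y, c, h⟩ := exists_DD_of_cycle h0 h1 _ _ hcyc
  obtain ⟨w, hw⟩ := exists_dE_eq_component φ ht y c
  refine Submodule.mem_sup.2 ⟨_, ⟨w, rfl⟩, x - dE φ q (t + 1) w, ?_, add_sub_cancel _ _⟩
  rw [mem_initSub_EE]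
  intro B m
  rw [Submodule.coe_sub, Pi.sub_apply]
  by_cases hB : Esupp q (t + 1) B
  · rw [hw B hB, ← homogeneousComponent_eq_self (x.2.1 B), ← map_sub, coeff_homogeneousComponent]
    split_ifs
    · have := mem_coefIdeal_empty.1 (h B) m
      rwa [Pi.sub_apply, Pi.sub_apply, Pi.smul_apply, smul_eq_mul, sub_sub] at this
    · exact Ideal.zero_mem _
  · rw [x.2.2 B hB, (dE φ q (t + 1) w).2.2 B hB, sub_zero, coeff_zero]
    exact Ideal.zero_mem _

lemma exactAt_dE_of_entries {φ : Matrix ι ι R} (h0 : ∀ i, φ i i = 0)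
    (h1 : ∀ i j, φ j i = - φ i j) (hn : Odd (Fintype.card ι)) {q : ℕ} (hq : Odd q)
    (hG : VacDepth φ q)
    (hloc : ∀ i, ∀ x : EE ι R q (i + 1), dE φ q i x = 0 → ∀ j k, j ≠ k →
      ∃ N : ℕ, φ j k ^ N • x ∈ LinearMap.range (dE φ q (i + 1))) (i : ℕ) : ExE φ q i := by
  set n := Fintype.card ι with hn'
  obtain ⟨T, hT⟩ : ∃ T, (n ≤ q ∧ T = n) ∨ (q + 2 ≤ n ∧ T = q + 2) := by
    obtain ⟨r, hr⟩ := hn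
    obtain ⟨s, hs⟩ := hq
    by_cases h : n ≤ q
    · exact ⟨n, Or.inl ⟨h, rfl⟩⟩
    · exact ⟨q + 2, Or.inr ⟨by omega, rfl⟩⟩
  have htop : ∀ a s t, t + 1 = T → ExactMod (E := fun t => EE ι R q t) (dE φ q) a s t := by
    intro a s t ht
    rcases hT with ⟨h, rfl⟩ | ⟨h, rfl⟩
    · exact exactMod_dE_of_card_le h0 h1 ht.ge (ht.trans_le h) a s
    · intro y _
      rw [EE_eq_zero (by omega) y]
      exact zero_mem _
  have hbig : ∀ i, T ≤ i + 1 → ExE φ q i := by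
    intro i hi y hy
    by_cases hiq : q + 1 ≤ i
    · rw [EE_eq_zero (by omega) y]
      exact zero_mem _
    rcases hT with ⟨h, rfl⟩ | ⟨h, rfl⟩
    · rcases (show i ≤ q by omega).lt_or_eq with h2 | h2
      · have := exactMod_dE_of_card_le h0 h1 hi h2 (fun _ => 0) 0 y
          (by rw [hy]; exact zero_mem _)
        rwa [initSub_zero, sup_bot_eq] at this
      · subst h2
        have h3 := congrFun (congrArg Subtype.val hy) Finset.univ
        rw [dE_coe, dW_self φ _ (by rw [Finset.card_univ]; exact h)
          (by rw [Finset.card_univ]; exact hn.add_odd hq), Om, vac_univ, C_1, mul_one] at h3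
        have : y = 0 := by
          ext1
          funext B
          by_cases hB : B = ∅
          · rw [hB, h3]; rfl
          · exact y.2.2 B (by rintro (⟨h, _⟩ | ⟨_, h⟩); exacts [by omega, hB h])
        rw [this]
        exact zero_mem _
    · omega
  have key : ∀ p i, i + 1 + (p + 1) = T → ExE φ q i := by
    intro p
    induction p using Nat.strong_induction_on with
    | _ p ihp =>
    intro i hi y hy
    have hex : ∀ j < p, ExE φ q (i + 1 + j) := by
      intro j hj
      exact ihp (p - 1 - j) (by omega) _ (by omega)
    have hn3 : n - 2 + 2 = n := by
      obtain ⟨r, hr⟩ := hn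
      obtain ⟨s, hs⟩ := hq
      omega
    obtain ⟨a, ha, hreg⟩ := hG (n - 2) (by
      rw [← hn3, Nat.odd_add] at hn
      exact hn.2 even_two) hn3.le
    have hlen : p + 1 ≤ min (q + 1) (n - 2 + 1) := by
      rw [le_min_iff]
      omega
    refine exactAt_of_pow_smul_mem (E := fun j => EE ι R q (i + 1 + j))
      (d := fun j => dE φ q (i + 1 + j)) (a := a) (fun j x => dE_dE h0 h1 q _ x) p
      (fun j => (hreg.mono hlen).EE q _) hex (htop a _ _ (by omega)) y fun l hl => ?_
    let J : Ideal R := Submodule.comap (LinearMap.toSpanSingleton R _ y)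
      (LinearMap.range (dE φ q (i + 1)))
    have hJ : vacIdeal φ (n - 2) ≤ J.radical := by
      refine vacIdeal_le_entries h0 h1 (by omega) fun j k hjk => ?_
      obtain ⟨N, hN⟩ := hloc i y hy j k hjk
      exact ⟨N, hN⟩
    obtain ⟨N, hN⟩ := hJ (ha l (by omega))
    exact ⟨N, hN⟩
  by_cases hi : T ≤ i + 1
  · exact hbig i hi
  · exact key (T - (i + 1) - 1) i (by omega)

theorem exactAt_dE (φ : Matrix ι ι R) (h0 : ∀ i, φ i i = 0) (h1 : ∀ i j, φ j i = - φ i j)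
    (hn : Odd (Fintype.card ι)) {q : ℕ} (hq : Odd q) (hG : VacDepth φ q) (i : ℕ) : ExE φ q i := by
  obtain ⟨N, hN⟩ := hn
  induction N generalizing ι R i with
  | zero =>
    refine exactAt_dE_of_entries h0 h1 ⟨_, hN⟩ hq hG (fun i x _ j k hjk => ?_) i
    have := card_rest hjk
    omega
  | succ N ih =>
    refine exactAt_dE_of_entries h0 h1 ⟨_, hN⟩ hq hG (fun i x hx j k hjk => ?_) i
    set M := Submonoid.powers (φ j k) with hM
    set K := Localization.Away (φ j k) with hK
    set f := algebraMap R K with hf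
    obtain ⟨u, hu⟩ := IsLocalization.Away.algebraMap_isUnit (S := K) (φ j k)
    have hu' : (φ.map f) j k = u := by simp [hu, hf]
    have h0' := map_diag f h0
    have h1' := map_skew f h1
    have hcard := card_rest hjk
    have hex : ∀ i, ExE (schur (φ.map f) j k u) q i := fun i =>
      ih _ (schur_diag h0' h1' j k u) (schur_skew h1' j k u) (hG.schur h0 h1 M hjk hu.symm) i
        (by omega)
    have hxK : ∀ m : MvPolynomial ι R, ∀ d, m.IsHomogeneous d →
        (MvPolynomial.map f m).IsHomogeneous d := fun m d h => h.map f
    have hxm : (fun B => MvPolynomial.map f ((x : Finset ι → MvPolynomial ι R) B)) ∈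
        EE ι K q (i + 1) :=
      ⟨fun B => hxK _ _ (x.2.1 B), fun B hB => by
        dsimp only
        rw [x.2.2 B hB, map_zero]⟩
    by_cases hiq : i + 1 ≤ q
    · have hcyc := (dE_eq_zero_iff hiq x).1 hx
      obtain ⟨y, c, h⟩ := exists_DD_of_schur_exact h0' h1' hu' hjk
        (Odd.add_odd ⟨N, by omega⟩ hq) hex hiq ⟨_, hxm⟩ (by
          rw [dE_eq_zero_iff hiq]
          intro B hB
          rw [← DD_map, hcyc B hB, map_zero])
      obtain ⟨_, ⟨N, rfl⟩, hs⟩ := exists_smul_mem_range_dE M h0 h1 hiq x y c h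
      exact ⟨N, hs⟩
    · by_cases hiq2 : q + 1 ≤ i
      · refine ⟨0, ?_⟩
        rw [EE_eq_zero (by omega) x, smul_zero]
        exact zero_mem _
      obtain rfl : i = q := by omega
      have hz := x.2.1 ∅
      rw [show i - (i + 1) = 0 by omega] at hz
      set z := coeff 0 ((x : Finset ι → MvPolynomial ι R) ∅) with hz'
      have hxz : (x : Finset ι → MvPolynomial ι R) ∅ = C z := by
        rw [hz', ← homogeneousComponent_zero, homogeneousComponent_eq_self hz]
      have hzv : ∀ B : Finset ι, B.card ≤ i → z * vac φ B = 0 := by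
        intro B hB
        by_cases hB' : Even (B.card + i)
        · have := congrFun (congrArg Subtype.val hx) B
          rw [dE_coe, dW_self _ _ hB hB', hxz, Om, ← C_mul] at this
          exact C_eq_zero.1 this
        · rw [vac_parity h0 h1, mul_zero]
          have h2 := Finset.card_add_card_compl B
          rw [← Nat.not_even_iff_odd]
          intro h
          have hodd : Odd (Fintype.card ι) := ⟨_, hN⟩
          rw [← h2, Nat.odd_add] at hodd
          exact hB' ((hodd.2 h).add_odd hq)
      have hfz : f z = 0 := eq_zero_of_schur_exact h0' h1' hu' hjk (hex i) _ fun B hB => by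
        rw [← vac_map f h0 h1, ← map_mul, hzv B hB, map_zero]
      obtain ⟨⟨_, N, rfl⟩, hN⟩ := (IsLocalization.map_eq_zero_iff M K z).1 hfz
      refine ⟨N, ?_⟩
      have : φ j k ^ N • x = 0 := by
        ext1
        funext B
        by_cases hB : B = ∅
        · rw [hB, Submodule.coe_smul, Pi.smul_apply, hxz, smul_eq_C_mul, ← C_mul]
          simp only at hN
          rw [hN, C_0]; rfl
        · exact (φ j k ^ N • x).2.2 B (by
            rintro (⟨h, _⟩ | ⟨_, h⟩); exacts [by omega, hB h])
      rw [this]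
      exact zero_mem _

end Exactness

section Grade
open Abelian

variable {A : Type} [CommRing A] [IsLocalRing A] [IsNoetherianRing A]

theorem subsingleton_ext_of_mul_surj (N M : ModuleCat.{0} A) [Module.Finite A N]
    [Module.Finite A M] {x : A} (hx : x ∈ IsLocalRing.maximalIdeal A) (hreg : IsSMulRegular N x)
    (i : ℕ) (h : Subsingleton (Abelian.Ext (ModuleCat.of A (QuotSMulTop x N)) M (i + 1))) :
    Subsingleton (Abelian.Ext N M i) := by
  have hS := hreg.smulShortComplex_shortExact
  have hsurj : ∀ e : Abelian.Ext N M i, ∃ e', x • e' = e := by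
    intro e
    obtain ⟨e', he'⟩ := Abelian.Ext.contravariant_sequence_exact₁ hS M (n₁ := i + 1) e (by omega)
      (h.elim _ _)
    have key : ∀ e' : Abelian.Ext N M i,
        (Abelian.Ext.mk₀ (x • 𝟙 N)).comp e' (zero_add i) = x • e' := fun e' => by
      rw [Abelian.Ext.mk₀_smul]
      simp
    exact ⟨e', (key e').symm.trans he'⟩
  have hfin : Module.Finite A (Abelian.Ext N M i) := inferInstance
  have : (⊤ : Submodule A (Abelian.Ext N M i)) = ⊥ := by
    refine Submodule.eq_bot_of_le_smul_of_le_jacobson_bot (Ideal.span {x}) ⊤ hfin.1 ?_ ?_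
    · intro e _
      obtain ⟨e', rfl⟩ := hsurj e
      exact Submodule.smul_mem_smul (Ideal.mem_span_singleton_self x) trivial
    · rw [IsLocalRing.jacobson_eq_maximalIdeal _ bot_ne_top, Ideal.span_singleton_le_iff_mem]
      exact hx
  exact (Submodule.subsingleton_iff A).mp (subsingleton_of_bot_eq_top this.symm)

/-- Ischebeck's vanishing theorem. -/
theorem subsingleton_ext_of_coheight (M : ModuleCat.{0} A) [Module.Finite A M] (rs : List A)
    (hmem : ∀ r ∈ rs, r ∈ IsLocalRing.maximalIdeal A)
    (hreg : RingTheory.Sequence.IsRegular M rs) (r : ℕ) :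
    ∀ (N : Type) [AddCommGroup N] [Module A N] [Module.Finite A N],
      (∀ p ∈ Module.support A N, Order.coheight p ≤ r) → ∀ i, i + r < rs.length →
      Subsingleton (Abelian.Ext (ModuleCat.of A N) M i) := by
  induction r using Nat.strong_induction_on with
  | _ r ih =>
  intro N _ _ hfin
  induction hfin using IsNoetherianRing.induction_on_isQuotientEquivQuotientPrime with
  | subsingleton N =>
    intro _ i _
    have hz : Limits.IsZero (ModuleCat.of A N) := ModuleCat.isZero_of_subsingleton _
    exact ⟨fun a b => by
      have h0 : ∀ a : Abelian.Ext (ModuleCat.of A N) M i, a = 0 := fun a => by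
        rw [← Abelian.Ext.mk₀_id_comp a, hz.eq_of_src (𝟙 _) 0, Abelian.Ext.mk₀_zero,
          Abelian.Ext.zero_comp]
      rw [h0 a, h0 b]⟩
  | quotient N p e =>
    intro hN i hi
    have hlt : IsLocalRing.maximalIdeal A • (⊤ : Submodule A M) < ⊤ := by
      have : Nontrivial M := hreg.nontrivial
      refine lt_top_iff_ne_top.2 fun h => ?_
      exact top_ne_bot (α := Submodule A M) (Submodule.eq_bot_of_le_smul_of_le_jacobson_bot _ ⊤
        (Module.Finite.fg_top) h.ge (IsLocalRing.jacobson_eq_maximalIdeal _ bot_ne_top).ge)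
    have hsupp : Module.support A N = PrimeSpectrum.zeroLocus p.1 := by
      rw [e.support_eq, Module.support_eq_zeroLocus, Ideal.annihilator_quotient]
    by_cases hp : p.1 = IsLocalRing.maximalIdeal A
    · exact ModuleCat.subsingleton_ext_of_exists_isRegular (IsLocalRing.maximalIdeal A)
        (ModuleCat.of A N) (by rw [← hp]; exact hsupp.le) M hlt rs hmem hreg i (by omega)
    · have hlt' : p.1 < IsLocalRing.maximalIdeal A :=
        lt_of_le_of_ne (IsLocalRing.le_maximalIdeal p.2.ne_top) hp
      obtain ⟨x, hx, hxp⟩ := SetLike.exists_of_lt hlt'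
      have hxreg : IsSMulRegular N x := by
        rw [isSMulRegular_iff_right_eq_zero_of_smul]
        intro y hy
        obtain ⟨a, ha⟩ := Ideal.Quotient.mk_surjective (e y)
        have h1 : x • e y = 0 := by rw [← map_smul, hy, map_zero]
        rw [← ha, Algebra.smul_def, Ideal.Quotient.algebraMap_eq, ← map_mul,
          Ideal.Quotient.eq_zero_iff_mem] at h1
        have h2 : e y = 0 := by
          rw [← ha]; exact Ideal.Quotient.eq_zero_iff_mem.2 ((p.2.mem_or_mem h1).resolve_left hxp)
        simpa using h2
      have hpN : Order.coheight p ≤ r := hN p (by rw [hsupp]; exact fun _ h => h)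
      have hco : ∀ p' ∈ Module.support A (QuotSMulTop x N), Order.coheight p' + 1 ≤ r := by
        intro p' hp'
        rw [Module.support_quotSMulTop, hsupp] at hp'
        refine le_trans (Order.coheight_add_one_le (lt_of_le_of_ne hp'.1 ?_)) hpN
        rintro rfl
        exact hxp (hp'.2 rfl)
      rcases Nat.eq_zero_or_pos r with rfl | hr
      · have : Subsingleton (QuotSMulTop x N) := by
          rw [← Module.support_eq_empty_iff (R := A), Set.eq_empty_iff_forall_notMem]
          intro p' hp'
          have := hco p' hp'
          simp at this
        refine subsingleton_ext_of_mul_surj (ModuleCat.of A N) M hx hxreg i ?_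
        have hz : Limits.IsZero (ModuleCat.of A (QuotSMulTop x N)) :=
          ModuleCat.isZero_of_subsingleton _
        exact ⟨fun a b => by
          have h0 : ∀ a : Abelian.Ext (ModuleCat.of A (QuotSMulTop x N)) M (i + 1), a = 0 :=
            fun a => by
            rw [← Abelian.Ext.mk₀_id_comp a, hz.eq_of_src (𝟙 _) 0, Abelian.Ext.mk₀_zero,
              Abelian.Ext.zero_comp]
          rw [h0 a, h0 b]⟩
      · refine subsingleton_ext_of_mul_surj (ModuleCat.of A N) M hx hxreg i ?_
        refine ih (r - 1) (by omega) (QuotSMulTop x N) (fun p' hp' => ?_) (i + 1) (by omega)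
        have := hco p' hp'
        rw [show (r : ℕ∞) = ((r - 1 : ℕ) : ℕ∞) + 1 by exact_mod_cast (Nat.sub_add_cancel hr).symm]
          at this
        exact (ENat.add_le_add_iff_right (by simp)).1 this
  | exact N₁ N₂ N₃ f g hf hg hfg h1 h3 =>
    intro hN i hi
    have hsub := Module.support_of_exact hfg hf hg
    have i1 := h1 (fun p hp => hN p (by rw [hsub]; exact Or.inl hp)) i hi
    have i3 := h3 (fun p hp => hN p (by rw [hsub]; exact Or.inr hp)) i hi
    let S : ShortComplex (ModuleCat A) := ShortComplex.mk (ModuleCat.ofHom f) (ModuleCat.ofHom g)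
      (by ext x; simpa using hfg.apply_apply_eq_zero x)
    have hS : S.ShortExact :=
      { exact := by
          rw [ShortComplex.ShortExact.moduleCat_exact_iff_function_exact]
          exact hfg
        mono_f := (ModuleCat.mono_iff_injective _).2 hf
        epi_g := (ModuleCat.epi_iff_surjective _).2 hg }
    refine ⟨fun a b => ?_⟩
    have h0 : ∀ a : Abelian.Ext (ModuleCat.of A N₂) M i, a = 0 := fun a => by
      obtain ⟨x, rfl⟩ := Abelian.Ext.contravariant_sequence_exact₂ hS M a (i1.elim _ _)
      rw [i3.elim x 0, Abelian.Ext.comp_zero]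
    rw [h0 a, h0 b]

end Grade

section Grade

variable {A : Type} [CommRing A]

lemma initIdeal_eq_ofList (rs : List A) {s : ℕ} (hs : s ≤ rs.length) :
    initIdeal (fun i => rs.getD i 0) s = Ideal.ofList (rs.take s) := by
  induction s with
  | zero => simp [initIdeal, Ideal.ofList]
  | succ s ih =>
    rw [initIdeal, ih (by omega), ← List.take_append_getElem (by omega : s < rs.length),
      Ideal.ofList_append, Ideal.ofList_singleton]
    rw [List.getD_eq_getElem _ _ (by omega : s < rs.length)]

lemma wreg_iff_isWeaklyRegular (rs : List A) (M : Type) [AddCommGroup M] [Module A M] :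
    WReg (fun i => rs.getD i 0) M rs.length ↔ RingTheory.Sequence.IsWeaklyRegular M rs := by
  rw [RingTheory.Sequence.isWeaklyRegular_iff]
  refine forall₂_congr fun s hs => ?_
  rw [isSMulRegular_quotient_iff_mem_of_smul_mem, ← initIdeal_eq_ofList rs hs.le]
  simp only [List.getD_eq_getElem _ _ hs]
  rfl

lemma initIdeal_congr {a b : ℕ → A} {s : ℕ} (h : ∀ i < s, a i = b i) :
    initIdeal a s = initIdeal b s := by
  induction s with
  | zero => rfl
  | succ s ih => rw [initIdeal, initIdeal, ih fun i hi => h i (by omega), h s (by omega)]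

lemma WReg.congr {a b : ℕ → A} {r : ℕ} {M : Type} [AddCommGroup M] [Module A M]
    (hM : WReg a M r) (h : ∀ i < r, a i = b i) : WReg b M r := by
  intro s hs y hy
  have e : initIdeal b s = initIdeal a s := initIdeal_congr fun i hi => (h i (by omega)).symm
  rw [initSub, e] at hy ⊢
  exact hM s hs y (by rw [h s hs]; exact hy)

/-- In a Cohen-Macaulay local ring, an ideal of height at least `k` contains a regular sequence
of length `k`. -/
theorem exists_wreg_of_height [IsLocalRing A] [IsNoetherianRing A] {d : ℕ} (x : ℕ → A)
    (hx : ∀ i < d, x i ∈ IsLocalRing.maximalIdeal A) (hreg : WReg x A d)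
    (hdim : ringKrullDim A ≤ d) (𝔞 : Ideal A) (k : ℕ) (hk : k ≤ d)
    (hht : ∀ p : PrimeSpectrum A, 𝔞 ≤ p.asIdeal → (k : ℕ∞) ≤ Order.height p) :
    ∃ a : ℕ → A, (∀ i < k, a i ∈ 𝔞) ∧ WReg a A k := by
  by_cases htop : 𝔞 = ⊤
  · exact ⟨x, fun i _ => htop ▸ trivial, hreg.mono hk⟩
  set rs : List A := (List.range d).map x with hrs
  have hlen : rs.length = d := by simp [hrs]
  have hget : ∀ i < d, rs.getD i 0 = x i := fun i hi => by
    rw [List.getD_eq_getElem _ _ (by omega)]; simp [hrs]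
  have hmem : ∀ r ∈ rs, r ∈ IsLocalRing.maximalIdeal A := by
    intro r hr
    obtain ⟨i, hi, rfl⟩ := List.mem_map.1 hr
    exact hx i (List.mem_range.1 hi)
  have hw : RingTheory.Sequence.IsWeaklyRegular A rs := by
    rw [← wreg_iff_isWeaklyRegular, hlen]
    exact hreg.congr fun i hi => (hget i hi).symm
  have hR : RingTheory.Sequence.IsRegular A rs := by
    refine ⟨hw, fun h => ?_⟩
    have h1 : Ideal.ofList rs ≤ IsLocalRing.maximalIdeal A := by
      rw [Ideal.ofList, Ideal.span_le]
      exact fun r hr => hmem r hr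
    have h2 : (1 : A) ∈ Ideal.ofList rs • (⊤ : Submodule A A) := h ▸ trivial
    have h3 : (1 : A) ∈ Ideal.ofList rs := by simpa using h2
    exact (Ideal.ne_top_iff_one _).1 (IsLocalRing.maximalIdeal.isMaximal A).ne_top (h1 h3)
  have hsupp : Module.support A (A ⧸ 𝔞) = PrimeSpectrum.zeroLocus 𝔞 := by
    rw [Module.support_eq_zeroLocus, Ideal.annihilator_quotient]
  have hext : ∀ i < k, Subsingleton (Abelian.Ext (ModuleCat.of A (A ⧸ 𝔞)) (ModuleCat.of A A) i) := by
    intro i hi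
    refine subsingleton_ext_of_coheight (ModuleCat.of A A) rs hmem hR (d - k) (A ⧸ 𝔞) ?_ i
      (by omega)
    intro p hp
    rw [hsupp] at hp
    have h1 := hht p hp
    have h2 : Order.height p + Order.coheight p ≤ (d : ℕ∞) := by
      have h3 := le_iSup (fun p : PrimeSpectrum A => Order.height p + Order.coheight p) p
      have h4 : Order.krullDim (PrimeSpectrum A) ≤ ((d : ℕ∞) : WithBot ℕ∞) := hdim
      have : Nonempty (PrimeSpectrum A) := ⟨p⟩
      rw [Order.krullDim_eq_iSup_height_add_coheight_of_nonempty, WithBot.coe_le_coe] at h4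
      exact h3.trans h4
    have h5 : (k : ℕ∞) + Order.coheight p ≤ k + ((d - k : ℕ) : ℕ∞) := by
      refine le_trans (by gcongr) (h2.trans (le_of_eq ?_))
      exact_mod_cast (by omega : d = k + (d - k))
    exact (ENat.add_le_add_iff_left (by simp)).1 h5
  obtain ⟨ys, hyl, hym, hyr⟩ := ModuleCat.exists_isRegular_of_exists_subsingleton_ext 𝔞 k
    (ModuleCat.of A A) (by simpa [lt_top_iff_ne_top] using htop) (ModuleCat.of A (A ⧸ 𝔞)) hsupp hext
  refine ⟨fun i => ys.getD i 0, fun i hi => ?_, ?_⟩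
  · simp only [List.getD_eq_getElem _ _ (by omega : i < ys.length)]
    exact hym _ (List.getElem_mem _)
  · rw [← hyl, wreg_iff_isWeaklyRegular]
    exact hyr.toIsWeaklyRegular

/-- A regular sequence can be replaced by one in a given power of an ideal containing it. -/
theorem exists_wreg_pow [IsNoetherianRing A] (𝔪 : Ideal A) (hm : 𝔪 ≠ ⊤) (rs : List A)
    (hmem : ∀ r ∈ rs, r ∈ 𝔪) (hreg : RingTheory.Sequence.IsRegular A rs) (t : ℕ) :
    ∃ a : ℕ → A, (∀ i < rs.length, a i ∈ 𝔪 ^ t) ∧ WReg a A rs.length := by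
  rcases Nat.eq_zero_or_pos t with rfl | ht
  · exact ⟨fun i => rs.getD i 0, fun i _ => by simp, (wreg_iff_isWeaklyRegular rs A).2 hreg.1⟩
  have hpow : 𝔪 ^ t ≤ 𝔪 := Ideal.pow_le_self (by omega)
  have hsupp : Module.support A (A ⧸ 𝔪 ^ t) = PrimeSpectrum.zeroLocus ↑(𝔪 ^ t) := by
    rw [Module.support_eq_zeroLocus, Ideal.annihilator_quotient]
  have hz : PrimeSpectrum.zeroLocus (↑(𝔪 ^ t) : Set A) = PrimeSpectrum.zeroLocus 𝔪 :=
    PrimeSpectrum.zeroLocus_pow 𝔪 (by omega)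
  have hext := ModuleCat.subsingleton_ext_of_exists_isRegular 𝔪 (ModuleCat.of A (A ⧸ 𝔪 ^ t))
    (hsupp.trans hz).le (ModuleCat.of A A) (by simpa [lt_top_iff_ne_top] using hm) rs hmem hreg
  obtain ⟨ys, hyl, hym, hyr⟩ := ModuleCat.exists_isRegular_of_exists_subsingleton_ext (𝔪 ^ t)
    rs.length (ModuleCat.of A A)
    (by
      have : 𝔪 ^ t ≠ ⊤ := fun h => hm (top_le_iff.1 (h.ge.trans hpow))
      simpa only [smul_eq_mul, Ideal.mul_top, lt_top_iff_ne_top] using this)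
    (ModuleCat.of A (A ⧸ 𝔪 ^ t)) hsupp hext
  refine ⟨fun i => ys.getD i 0, fun i hi => ?_, ?_⟩
  · simp only [List.getD_eq_getElem _ _ (by omega : i < ys.length)]
    exact hym _ (List.getElem_mem _)
  · rw [← hyl, wreg_iff_isWeaklyRegular]
    exact hyr.toIsWeaklyRegular

end Grade

section Minors

set_option linter.unusedSectionVars false

variable {ι : Type} [Fintype ι] [LinearOrder ι]

lemma det_eq_zero_of_vac {K : Type} [Field K] {ψ : Matrix ι ι K} (h0 : ∀ i, ψ i i = 0)
    (h1 : ∀ i j, ψ j i = - ψ i j) {q : ℕ} (hq : ∀ B : Finset ι, B.card ≤ q → vac ψ B = 0)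
    (hodd : Odd (Fintype.card ι)) (hqo : Odd q) {r : ℕ} (hr : Fintype.card ι ≤ r + q + 1)
    (f g : Fin r → ι) : (ψ.submatrix f g).det = 0 := by
  classical
  obtain ⟨B, hB, hmin⟩ : ∃ B : Finset ι, vac ψ B ≠ 0 ∧ ∀ B', vac ψ B' ≠ 0 → B.card ≤ B'.card := by
    have hne : (Finset.univ.filter fun B : Finset ι => vac ψ B ≠ 0).Nonempty :=
      ⟨Finset.univ, by simp [vac_univ]⟩
    obtain ⟨B, hB, h⟩ := Finset.exists_min_image _ Finset.card hne
    exact ⟨B, by simpa using hB, fun B' hB' => h B' (by simpa using hB')⟩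
  have hBq : q + 2 ≤ B.card := by
    by_contra hlt
    have h2 : ¬ B.card ≤ q := fun h => hB (hq B h)
    refine hB (vac_parity h0 h1 B ?_)
    rw [Finset.card_compl]
    have : B.card ≤ Fintype.card ι := Finset.card_le_univ B
    obtain ⟨a, ha⟩ := hodd
    obtain ⟨b, hb⟩ := hqo
    exact ⟨a - b - 1, by omega⟩
  by_contra hdet
  set v : ι → Fin r → K := fun c i => ψ (f i) c with hv
  set W : Submodule K (Fin r → K) := Submodule.span K (↑(Bᶜ.image v) : Set (Fin r → K)) with hW
  have hmem : ∀ c, v c ∈ W := by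
    intro b
    by_cases hb : b ∈ B
    · have hrel : ∑ c, (if c ∈ B.erase b then 0 else
          (sgn K c (B.erase b) * vac ψ (flip c (B.erase b))) • v c) = 0 := by
        funext i
        have h := congrFun (vac_isVac h0 h1 (f i)) (B.erase b)
        have hz : (if f i ∈ B.erase b then
            sgn K (f i) (B.erase b) * vac ψ (flip (f i) (B.erase b)) else 0) = 0 := by
          split_ifs with hi
          · have hc : (flip (f i) (B.erase b)).card < B.card := by
              have h3 := card_flip_of_mem hi
              have h4 := Finset.card_erase_add_one hb
              omega
            rw [of_not_not fun hne => absurd (hmin _ hne) (by omega), mul_zero]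
          · rfl
        rw [row_apply, hz, zero_add] at h
        simp only [Finset.sum_apply, Pi.zero_apply] at h ⊢
        rw [← h]
        refine Finset.sum_congr rfl fun c _ => ?_
        split_ifs
        · rfl
        · simp only [Pi.smul_apply, smul_eq_mul, hv]; ring
      rw [← Finset.add_sum_erase _ _ (Finset.mem_univ b), if_neg (by simp),
        flip_of_notMem (by simp), Finset.insert_erase hb] at hrel
      have hsum : ∑ c ∈ Finset.univ.erase b, (if c ∈ B.erase b then 0 else
          (sgn K c (B.erase b) * vac ψ (flip c (B.erase b))) • v c) ∈ W := by
        refine Submodule.sum_mem _ fun c hc => ?_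
        split_ifs with h
        · exact W.zero_mem
        · refine W.smul_mem _ (Submodule.subset_span ?_)
          simp only [Finset.coe_image, Set.mem_image, Finset.mem_coe, Finset.mem_compl]
          refine ⟨c, fun hcB => h ?_, rfl⟩
          exact Finset.mem_erase.2 ⟨(Finset.mem_erase.1 hc).1, hcB⟩
      rw [add_eq_zero_iff_eq_neg] at hrel
      have h5 : (sgn K b (B.erase b) * vac ψ B) • v b ∈ W := hrel ▸ W.neg_mem hsum
      have h6 : sgn K b (B.erase b) * vac ψ B ≠ 0 :=
        mul_ne_zero (fun h => by simpa [h] using sgn_mul_self (S := K) b (B.erase b)) hB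
      exact (W.smul_mem_iff h6).1 h5
    · exact Submodule.subset_span (by simpa using ⟨b, hb, rfl⟩)
  have hli := Matrix.linearIndependent_cols_of_det_ne_zero hdet
  have hcard : Module.finrank K W ≤ Bᶜ.card :=
    (finrank_span_finset_le_card _).trans Finset.card_image_le
  have hli' : LinearIndependent K (fun i : Fin r => (⟨v (g i), hmem _⟩ : W)) := by
    refine LinearIndependent.of_comp W.subtype ?_
    exact hli
  have h7 := hli'.fintype_card_le_finrank
  rw [Fintype.card_fin] at h7
  rw [Finset.card_compl] at hcard
  have : 1 ≤ r ∨ r = 0 := by omega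
  have : B.card ≤ Fintype.card ι := Finset.card_le_univ B
  omega

/-- A prime containing the lower Pfaffians contains the corresponding minors. -/
theorem minorsIdeal_le_of_vacIdeal_le {R : Type} [CommRing R] {n : ℕ}
    {φ : Matrix (Fin n) (Fin n) R} (h0 : ∀ i, φ i i = 0) (h1 : ∀ i j, φ j i = - φ i j)
    (hn : Odd n) {q : ℕ} (hq : Odd q) {r : ℕ} (hr : n ≤ r + q + 1) (P : Ideal R) [P.IsPrime]
    (hP : vacIdeal φ q ≤ P) : minorsIdeal n r φ ≤ P := by
  rw [minorsIdeal, Ideal.span_le]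
  rintro _ ⟨f, g, rfl⟩
  let F : R →+* FractionRing (R ⧸ P) :=
    (algebraMap (R ⧸ P) (FractionRing (R ⧸ P))).comp (Ideal.Quotient.mk P)
  have hF : ∀ x, F x = 0 ↔ x ∈ P := fun x => by
    simp only [F, RingHom.comp_apply]
    rw [map_eq_zero_iff _ (IsFractionRing.injective _ _), Ideal.Quotient.eq_zero_iff_mem]
  refine (hF _).1 ?_
  rw [RingHom.map_det]
  refine det_eq_zero_of_vac (ψ := φ.map F) (q := q) (by simp [h0]) (fun i j => by simp [h1 i j])
    (fun B hB => ?_) (by simpa using hn) hq (by simpa using hr) f g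
  rw [← vac_map F h0 h1]
  exact (hF _).2 (hP (vac_mem_vacIdeal φ hB))

end Minors

section Graded

variable {R : Type} [CommRing R] (𝒜 : ℤ → AddSubgroup R) [GradedRing 𝒜]

lemma proj_mem (c : ℤ) (r : R) : GradedRing.proj 𝒜 c r ∈ 𝒜 c :=
  (DirectSum.decompose 𝒜 r c).2

lemma proj_of_mem {i : ℤ} {r : R} (h : r ∈ 𝒜 i) (c : ℤ) :
    GradedRing.proj 𝒜 c r = if c = i then r else 0 := by
  rw [GradedRing.proj_apply]
  split_ifs with hc
  · subst hc; exact DirectSum.decompose_of_mem_same 𝒜 h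
  · exact DirectSum.decompose_of_mem_ne 𝒜 h (Ne.symm hc)

lemma proj_mul_left {i : ℤ} {a : R} (h : a ∈ 𝒜 i) (c : ℤ) (b : R) :
    GradedRing.proj 𝒜 c (a * b) = a * GradedRing.proj 𝒜 (c - i) b := by
  have := DirectSum.coe_decompose_mul_add_of_left_mem 𝒜 (j := c - i) (b := b) h
  rwa [show i + (c - i) = c by ring] at this

lemma proj_mul_right {i : ℤ} {b : R} (h : b ∈ 𝒜 i) (c : ℤ) (a : R) :
    GradedRing.proj 𝒜 c (a * b) = GradedRing.proj 𝒜 (c - i) a * b := by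
  rw [mul_comm, proj_mul_left 𝒜 h, mul_comm]

lemma sum_proj (r : R) : ∃ s : Finset ℤ, ∀ t : Finset ℤ, s ⊆ t →
    ∑ i ∈ t, GradedRing.proj 𝒜 i r = r := by
  classical
  refine ⟨(DirectSum.decompose 𝒜 r).support, fun t ht => ?_⟩
  rw [← Finset.sum_subset ht fun i _ hi => ?_]
  · exact DirectSum.sum_support_decompose 𝒜 r
  · have := DFinsupp.notMem_support_iff.1 hi
    rw [GradedRing.proj_apply, this]; rfl

lemma mem_of_proj_mem (I : Ideal R) (r : R) (h : ∀ c, GradedRing.proj 𝒜 c r ∈ I) : r ∈ I := by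
  obtain ⟨s, hs⟩ := sum_proj 𝒜 r
  rw [← hs s le_rfl]
  exact I.sum_mem fun i _ => h i

variable {𝒜}

lemma proj_neg (hneg : ∀ i : ℤ, i < 0 → 𝒜 i = ⊥) {c : ℤ} (hc : c < 0) (r : R) :
    GradedRing.proj 𝒜 c r = 0 := by
  have := proj_mem 𝒜 c r
  rw [hneg c hc] at this
  simpa using this

lemma proj_zero_mul (hneg : ∀ i : ℤ, i < 0 → 𝒜 i = ⊥) (a b : R) :
    GradedRing.proj 𝒜 0 (a * b) = GradedRing.proj 𝒜 0 a * GradedRing.proj 𝒜 0 b := by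
  induction b using DirectSum.Decomposition.inductionOn 𝒜 with
  | zero => simp only [mul_zero, map_zero]
  | @homogeneous i b =>
    rw [proj_mul_right 𝒜 b.2, proj_of_mem 𝒜 b.2]
    rcases lt_trichotomy i 0 with h | h | h
    · have hb : (b : R) ∈ (⊥ : AddSubgroup R) := (hneg i h).le b.2
      have : (b : R) = 0 := by simpa using hb
      rw [this]; simp
    · subst h; simp
    · rw [proj_neg hneg (by omega), if_neg (by omega)]; simp
  | add m m' h h' => simp only [mul_add, map_add, h, h']

/-- The projection onto degree zero, as a ring homomorphism. -/
def projZeroHom (hneg : ∀ i : ℤ, i < 0 → 𝒜 i = ⊥) : R →+* 𝒜 0 where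
  toFun r := ⟨GradedRing.proj 𝒜 0 r, proj_mem 𝒜 0 r⟩
  map_one' := by
    ext
    simp only [SetLike.GradeZero.coe_one]
    rw [proj_of_mem 𝒜 (SetLike.GradedOne.one_mem)]; simp
  map_mul' a b := by ext; exact proj_zero_mul hneg a b
  map_zero' := by ext; simp only [map_zero]; rfl
  map_add' a b := by ext; simp only [map_add]; rfl

lemma mem_maxHomIdeal_iff (hneg : ∀ i : ℤ, i < 0 → 𝒜 i = ⊥) [IsLocalRing (𝒜 0)] (r : R) :
    r ∈ maxHomIdeal 𝒜 ↔ ¬ IsUnit (projZeroHom hneg r) := by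
  have hle : maxHomIdeal 𝒜 ≤ (IsLocalRing.maximalIdeal (𝒜 0)).comap (projZeroHom hneg) := by
    rw [maxHomIdeal, Ideal.span_le]
    rintro x (⟨h, hx⟩ | hx)
    · have : projZeroHom hneg x = ⟨x, h⟩ := by
        ext; exact (proj_of_mem 𝒜 h 0).trans (if_pos rfl)
      simpa [this] using hx
    · simp only [Set.mem_iUnion, SetLike.mem_coe] at hx
      obtain ⟨i, hi, hx⟩ := hx
      have : projZeroHom hneg x = 0 := by
        ext; exact (proj_of_mem 𝒜 hx 0).trans (if_neg (Ne.symm hi))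
      simp [this]
  constructor
  · intro h; exact hle h
  · intro h
    refine mem_of_proj_mem 𝒜 _ r fun c => Ideal.subset_span ?_
    by_cases hc : c = 0
    · subst hc; exact Or.inl ⟨proj_mem 𝒜 0 r, h⟩
    · exact Or.inr (Set.mem_iUnion₂.2 ⟨c, hc, proj_mem 𝒜 c r⟩)

lemma maxHomIdeal_isMaximal (hneg : ∀ i : ℤ, i < 0 → 𝒜 i = ⊥) [IsLocalRing (𝒜 0)] :
    (maxHomIdeal 𝒜).IsMaximal := by
  have : maxHomIdeal 𝒜 = (IsLocalRing.maximalIdeal (𝒜 0)).comap (projZeroHom hneg) := by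
    ext r; rw [mem_maxHomIdeal_iff hneg]; rfl
  rw [this]
  have hsurj : Function.Surjective (projZeroHom hneg) := fun y => ⟨(y : R), by
    ext; exact (proj_of_mem 𝒜 y.2 0).trans (if_pos rfl)⟩
  exact Ideal.comap_isMaximal_of_surjective _ hsurj

/-- The degree zero component of an element outside the maximal homogeneous ideal
has an inverse of degree zero. -/
lemma exists_inv_of_notMem (hneg : ∀ i : ℤ, i < 0 → 𝒜 i = ⊥) [IsLocalRing (𝒜 0)] {s : R}
    (hs : s ∉ maxHomIdeal 𝒜) : ∃ u ∈ 𝒜 0, u * GradedRing.proj 𝒜 0 s = 1 := by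
  rw [mem_maxHomIdeal_iff hneg, not_not] at hs
  obtain ⟨u, hu⟩ := hs.exists_left_inv
  exact ⟨u, u.2, congrArg Subtype.val hu⟩

lemma mem_maxHomIdeal_of_ne {i : ℤ} (hi : i ≠ 0) {r : R} (h : r ∈ 𝒜 i) : r ∈ maxHomIdeal 𝒜 :=
  Ideal.subset_span (Or.inr (Set.mem_iUnion₂.2 ⟨i, hi, h⟩))

end Graded

section Height

variable {R : Type} [CommRing R]

lemma vacIdeal_mono {n : ℕ} (φ : Matrix (Fin n) (Fin n) R) {q q' : ℕ} (h : q ≤ q') :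
    vacIdeal φ q ≤ vacIdeal φ q' := by
  rw [vacIdeal, Ideal.span_le]
  rintro _ ⟨B, hB, rfl⟩
  exact vac_mem_vacIdeal φ (hB.trans h)

theorem vacDepth_of_height [IsNoetherianRing R] (𝔪 : Ideal R) [𝔪.IsPrime] {d n : ℕ}
    (hd1 : 1 ≤ d) (hdn : d ≤ n) (hnodd : Odd n) (hdeven : Even d)
    (hdim : ringKrullDim R = (d : WithBot (WithTop ℕ))) (x : ℕ → R) (hx : ∀ i < d, x i ∈ 𝔪)
    (hreg : WReg x R d) (φ : Matrix (Fin n) (Fin n) R) (h0 : ∀ i, φ i i = 0)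
    (h1 : ∀ i j, φ j i = - φ i j)
    (hF : ∀ i : ℕ, (n : ℤ) - d ≤ i → (i : ℤ) ≤ (n : ℤ) - 1 →
      ((n - i : ℕ) : ℕ∞) ≤ idealHeight (minorsIdeal n i φ)) :
    VacDepth (φ.map (algebraMap R (Localization.AtPrime 𝔪))) (d - 1) := by
  intro q' hq' hq'n
  rw [Fintype.card_fin] at hq'n
  set A := Localization.AtPrime 𝔪
  have hnA : IsNoetherianRing A := IsLocalization.isNoetherianRing 𝔪.primeCompl A inferInstance
  refine exists_wreg_of_height (fun i => algebraMap R A (x i)) (d := d) (fun i hi => ?_)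
    (hreg.localize 𝔪.primeCompl) ?_ (vacIdeal _ q') _ (by omega) ?_
  · have := hx i hi
    rwa [← IsLocalization.AtPrime.to_map_mem_maximal_iff A 𝔪] at this
  · have h := IsLocalization.AtPrime.ringKrullDim_eq_height 𝔪 A
    have h2 : ringKrullDim A ≤ ringKrullDim R := by
      rw [h]
      exact Ideal.height_le_ringKrullDim_of_ne_top (Ideal.IsPrime.ne_top inferInstance)
    rw [hdim] at h2
    exact h2
  · intro P hP
    set q'' := min q' (d - 1) with hq''
    have hq''o : Odd q'' := by
      rcases min_choice q' (d - 1) with h | h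
      · rw [hq'', h]; exact hq'
      · rw [hq'', h]; exact Nat.Even.sub_odd hd1 hdeven odd_one
    set p : Ideal R := P.asIdeal.under R with hp
    have hpp : p.IsPrime := inferInstance
    have hle : vacIdeal φ q'' ≤ p := by
      refine (vacIdeal_mono φ (min_le_left _ _)).trans ?_
      rw [hp, Ideal.under_def, ← Ideal.map_le_iff_le_comap]
      exact le_trans (by
        rw [Ideal.map_le_iff_le_comap, vacIdeal, Ideal.span_le]
        rintro _ ⟨B, hB, rfl⟩
        simp only [Ideal.coe_comap, Set.mem_preimage, SetLike.mem_coe]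
        rw [vac_map _ h0 h1]
        exact vac_mem_vacIdeal _ hB) hP
    have hmin : minorsIdeal n (n - q'' - 1) φ ≤ p :=
      minorsIdeal_le_of_vacIdeal_le h0 h1 hnodd hq''o (by omega) p hle
    have h3 := hF (n - q'' - 1) (by omega) (by omega)
    have h4 : idealHeight (minorsIdeal n (n - q'' - 1) φ) ≤ Order.height (⟨p, hpp⟩ : PrimeSpectrum R) :=
      iInf₂_le (⟨p, hpp⟩ : PrimeSpectrum R) hmin
    have h5 := PrimeSpectrum.height_eq_orderHeight (⟨p, hpp⟩ : PrimeSpectrum R)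
    have h6 : p.height = P.asIdeal.height := IsLocalization.height_under 𝔪.primeCompl P.asIdeal
    rw [← PrimeSpectrum.height_eq_orderHeight, ← h6]
    refine le_trans ?_ ((h3.trans h4).trans h5.ge)
    have : min (d - 1 + 1) (q' + 1) = n - (n - q'' - 1) := by omega
    rw [this]

end Height

/-! ### Graded modules and descent from the localization at the maximal homogeneous ideal -/

section GradedModule

set_option linter.unusedSectionVars false

variable {R : Type} [CommRing R] (𝒜 : ℤ → AddSubgroup R) [GradedRing 𝒜]

/-- A family of homogeneous projections on a module over a graded ring. -/
structure HomProj (M : Type) [AddCommGroup M] [Module R M] where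
  pr : ℤ → M →+ M
  pr_smul : ∀ {i : ℤ} {r : R}, r ∈ 𝒜 i → ∀ (c : ℤ) (m : M), pr c (r • m) = r • pr (c - i) m
  pr_pr : ∀ (c c' : ℤ) (m : M), pr c (pr c' m) = if c = c' then pr c m else 0
  sum : ∀ m, ∃ s : Finset ℤ, ∀ t, s ⊆ t → ∑ c ∈ t, pr c m = m

variable {𝒜} {M : Type} [AddCommGroup M] [Module R M]

lemma HomProj.pr_smul_pr (G : HomProj 𝒜 M) (r : R) (c : ℤ) (m : M) :
    G.pr c (r • G.pr c m) = GradedRing.proj 𝒜 0 r • G.pr c m := by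
  induction r using DirectSum.Decomposition.inductionOn 𝒜 with
  | zero => simp
  | @homogeneous i r =>
    rw [G.pr_smul r.2, G.pr_pr, proj_of_mem 𝒜 r.2]
    by_cases hi : i = 0
    · subst hi; simp
    · rw [if_neg (by omega), if_neg (by omega)]; simp
  | add m m' h h' => simp only [add_smul, map_add, h, h']

lemma HomProj.mem_of_pr_mem (G : HomProj 𝒜 M) (N : AddSubgroup M) (m : M)
    (h : ∀ c, G.pr c m ∈ N) : m ∈ N := by
  obtain ⟨s, hs⟩ := G.sum m
  rw [← hs s le_rfl]
  exact N.sum_mem fun i _ => h i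

lemma HomProj.mem_of_smul_mem (G : HomProj 𝒜 M) (hneg : ∀ i : ℤ, i < 0 → 𝒜 i = ⊥)
    [IsLocalRing (𝒜 0)] (N : Submodule R M) (hN : ∀ c, ∀ m ∈ N, G.pr c m ∈ N) (m : M)
    (h : ∀ c, ∃ s, s ∉ maxHomIdeal 𝒜 ∧ s • G.pr c m ∈ N) : m ∈ N := by
  refine G.mem_of_pr_mem N.toAddSubgroup m fun c => ?_
  obtain ⟨s, hs, hm⟩ := h c
  obtain ⟨u, _, hu⟩ := exists_inv_of_notMem hneg hs
  have h1 := N.smul_mem u (hN c _ hm)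
  rw [G.pr_smul_pr, smul_smul, hu, one_smul] at h1
  exact h1

/-- The ring as a graded module over itself. -/
def HomProj.self : HomProj 𝒜 R where
  pr c := GradedRing.proj 𝒜 c
  pr_smul h c m := proj_mul_left 𝒜 h c m
  pr_pr c c' m := by
    rw [proj_of_mem 𝒜 (proj_mem 𝒜 c' m)]
    split_ifs with h
    · rw [h]
    · rfl
  sum := sum_proj 𝒜

variable {σ : Type}

open MvPolynomial

variable (𝒜) in
/-- Coefficientwise homogeneous components of a polynomial. -/
def prP (c : ℤ) : MvPolynomial σ R →+ MvPolynomial σ R :=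
  AddMonoidHom.mk' (fun p => ∑ m ∈ p.support, monomial m (GradedRing.proj 𝒜 c (coeff m p))) (by
    classical
    have key : ∀ (p : MvPolynomial σ R) m, coeff m (∑ m ∈ p.support,
        monomial m (GradedRing.proj 𝒜 c (coeff m p))) = GradedRing.proj 𝒜 c (coeff m p) := by
      intro p m
      rw [coeff_sum]
      simp only [coeff_monomial]
      rw [Finset.sum_ite_eq']
      split_ifs with h
      · rfl
      · rw [notMem_support_iff.1 h, map_zero]
    intro a b
    ext m
    rw [coeff_add, key, key, key, coeff_add, map_add])

lemma coeff_prP (c : ℤ) (p : MvPolynomial σ R) (m : σ →₀ ℕ) :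
    coeff m (prP 𝒜 c p) = GradedRing.proj 𝒜 c (coeff m p) := by
  classical
  change coeff m (∑ m ∈ p.support, monomial m (GradedRing.proj 𝒜 c (coeff m p))) = _
  rw [coeff_sum]
  simp only [coeff_monomial]
  rw [Finset.sum_ite_eq']
  split_ifs with h
  · rfl
  · rw [notMem_support_iff.1 h, map_zero]

lemma prP_C_mul {i : ℤ} {r : R} (h : r ∈ 𝒜 i) (c : ℤ) (p : MvPolynomial σ R) :
    prP 𝒜 c (C r * p) = C r * prP 𝒜 (c - i) p := by
  ext m
  rw [coeff_prP, coeff_C_mul, coeff_C_mul, coeff_prP, proj_mul_left 𝒜 h]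

lemma prP_X_mul (c : ℤ) (b : σ) (p : MvPolynomial σ R) :
    prP 𝒜 c (X b * p) = X b * prP 𝒜 c p := by
  classical
  ext m
  rw [coeff_prP, coeff_X_mul', coeff_X_mul']
  split_ifs
  · rw [coeff_prP]
  · rw [map_zero]

lemma prP_prP (c c' : ℤ) (p : MvPolynomial σ R) :
    prP 𝒜 c (prP 𝒜 c' p) = if c = c' then prP 𝒜 c p else 0 := by
  ext m
  rw [coeff_prP, coeff_prP, proj_of_mem 𝒜 (proj_mem 𝒜 c' _)]
  split_ifs with h
  · rw [h, coeff_prP]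
  · simp

lemma sum_prP (p : MvPolynomial σ R) : ∃ s : Finset ℤ, ∀ t, s ⊆ t → ∑ c ∈ t, prP 𝒜 c p = p := by
  choose s hs using fun m => sum_proj 𝒜 (coeff m p)
  classical
  refine ⟨p.support.biUnion s, fun t ht => ?_⟩
  ext m
  rw [coeff_sum]
  simp only [coeff_prP]
  by_cases hm : m ∈ p.support
  · exact hs m t ((Finset.subset_biUnion_of_mem s hm).trans ht)
  · rw [notMem_support_iff.1 hm]; simp

lemma prP_isHomogeneous {c : ℤ} {p : MvPolynomial σ R} {k : ℕ} (h : p.IsHomogeneous k) :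
    (prP 𝒜 c p).IsHomogeneous k := by
  intro m hm
  rw [coeff_prP] at hm
  exact h fun h0 => hm (by rw [h0, map_zero])

end GradedModule

section GradedComplex

set_option linter.unusedSectionVars false

open MvPolynomial

variable {ι : Type} [Fintype ι] [LinearOrder ι] {R : Type} [CommRing R]
  {𝒜 : ℤ → AddSubgroup R} [GradedRing 𝒜]

/-- The degree shift at a position of the complex. -/
def wt (ι : Type) [Fintype ι] (q t : ℕ) (B : Finset ι) : ℤ :=
  if t ≤ q then (((t + B.card) / 2 : ℕ) : ℤ) else (((Fintype.card ι + q) / 2 : ℕ) : ℤ)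

variable (𝒜) in
/-- The graded structure on the terms of the complex. -/
def HomProj.EE (q t : ℕ) : HomProj 𝒜 (EE ι R q t) where
  pr c := AddMonoidHom.mk' (fun x => ⟨fun B => prP 𝒜 (c - wt ι q t B) (x.1 B),
    fun B => prP_isHomogeneous (x.2.1 B), fun B hB => by dsimp only; rw [x.2.2 B hB, map_zero]⟩) (by
      intro x y
      ext1; funext B
      simp)
  pr_smul {i r} h c m := by
    ext1; funext B
    change prP 𝒜 _ (r • m.1 B) = r • prP 𝒜 _ (m.1 B)
    rw [smul_eq_C_mul, smul_eq_C_mul, prP_C_mul h]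
    congr 2
    ring_nf
  pr_pr c c' m := by
    ext1; funext B
    change prP 𝒜 _ (prP 𝒜 _ (m.1 B)) = _
    rw [prP_prP]
    by_cases h : c = c'
    · rw [if_pos (by rw [h]), if_pos h]; rfl
    · rw [if_neg (by intro h'; exact h (by linarith)), if_neg h]; rfl
  sum m := by
    classical
    choose s hs using fun B => sum_prP (𝒜 := 𝒜) (m.1 B)
    refine ⟨Finset.univ.biUnion fun B => (s B).image fun c => c + wt ι q t B, fun T hT => ?_⟩
    ext1; funext B
    rw [AddSubmonoidClass.coe_finsetSum, Finset.sum_apply]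
    change ∑ c ∈ T, prP 𝒜 (c - wt ι q t B) (m.1 B) = m.1 B
    have h := hs B (T.image fun c => c - wt ι q t B) ?_
    · rwa [Finset.sum_image fun a _ b _ h => by simpa using h] at h
    · intro c hc
      refine Finset.mem_image.2 ⟨c + wt ι q t B, hT ?_, by ring⟩
      exact Finset.mem_biUnion.2 ⟨B, Finset.mem_univ _, Finset.mem_image.2 ⟨c, hc, rfl⟩⟩

lemma HomProj.EE_apply (q t : ℕ) (c : ℤ) (x : Paper.EE ι R q t) (B : Finset ι) :
    (((HomProj.EE 𝒜 q t).pr c x : Paper.EE ι R q t) : Finset ι → MvPolynomial ι R) B =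
      prP 𝒜 (c - wt ι q t B) ((x : Finset ι → MvPolynomial ι R) B) := rfl

variable {φ : Matrix ι ι R} (h0 : ∀ i, φ i i = 0) (h1 : ∀ i j, φ j i = - φ i j)
  (hlin : ∀ i j, φ i j ∈ 𝒜 1)

include h0 h1 hlin in
lemma vac_mem_graded (B : Finset ι) : vac φ B ∈ 𝒜 ((Bᶜ.card / 2 : ℕ) : ℤ) := by
  refine (vac_isVac h0 h1).induction (fun k a => a ∈ 𝒜 ((k / 2 : ℕ) : ℤ))
    (fun k => zero_mem _) (fun k a b => add_mem) (fun k a => neg_mem) (fun k i j a ha => ?_) ?_ B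
  · have := SetLike.GradedMul.mul_mem (hlin i j) ha
    rwa [show (1 : ℤ) + ((k / 2 : ℕ) : ℤ) = (((k + 2) / 2 : ℕ) : ℤ) by omega] at this
  · rw [vac_univ]
    simpa using SetLike.GradedOne.one_mem (A := 𝒜)

include hlin in
lemma prP_ell_mul (c : ℤ) (b : ι) (p : MvPolynomial ι R) :
    prP 𝒜 c (ell φ b * p) = ell φ b * prP 𝒜 (c - 1) p := by
  rw [ell, Finset.sum_mul, Finset.sum_mul, map_sum]
  refine Finset.sum_congr rfl fun j _ => ?_
  rw [mul_assoc, prP_X_mul, prP_C_mul (hlin j b), mul_assoc]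

include h0 h1 hlin in
lemma dE_pr (hn : Odd (Fintype.card ι)) {q : ℕ} (hq : Odd q) (t : ℕ) (c : ℤ)
    (x : EE ι R q (t + 1)) :
    dE φ q t ((HomProj.EE 𝒜 q (t + 1)).pr c x) = (HomProj.EE 𝒜 q t).pr c (dE φ q t x) := by
  ext1; funext B
  rw [HomProj.EE_apply, dE_coe, dE_coe]
  by_cases hB : Esupp q t B
  · rcases hB with ⟨htq, hBt, hBe⟩ | ⟨ht, hB⟩
    · rcases htq.lt_or_eq with htq | rfl
      · rw [dW_of_lt _ htq _ hBt hBe, dW_of_lt _ htq _ hBt hBe, DD, gd_apply, gd_apply, map_sum]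
        refine Finset.sum_congr rfl fun b _ => ?_
        rw [HomProj.EE_apply, wt, wt, if_pos (by omega), if_pos (by omega)]
        have hs : ∀ (c : ℤ) (p : MvPolynomial ι R), prP 𝒜 c (sgn (MvPolynomial ι R) b B * p) =
            sgn (MvPolynomial ι R) b B * prP 𝒜 c p := by
          intro c p
          unfold sgn
          rcases neg_one_pow_eq_or (MvPolynomial ι R) ((B.filter (· < b)).card) with h | h
          · rw [h, one_mul, one_mul]
          · rw [h, neg_one_mul, neg_one_mul, map_neg]
        rw [mul_assoc, mul_assoc, hs]
        congr 1
        by_cases hb : b ∈ B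
        · have := card_flip_of_mem hb
          simp only [hb, decide_true, dc]
          rw [prP_X_mul, show t + 1 + (flip b B).card = t + B.card by omega]
        · have := card_flip_of_notMem hb
          simp only [hb, decide_false, dc]
          rw [prP_ell_mul hlin]
          congr 3
          omega
      · rw [dW_self _ _ hBt hBe, dW_self _ _ hBt hBe, HomProj.EE_apply, Om, mul_comm, mul_comm _ (C _),
          prP_C_mul (vac_mem_graded h0 h1 hlin B), wt, wt, if_neg (by omega), if_pos (by omega)]
        congr 3
        have h2 := Finset.card_add_card_compl B
        have h3 : Even Bᶜ.card := by
          rw [← h2, Nat.odd_add] at hn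
          refine hn.1 ?_
          rw [← Nat.not_even_iff_odd]
          intro h
          rw [Nat.even_add] at hBe
          exact Nat.not_even_iff_odd.2 hq (hBe.1 h)
        obtain ⟨u, hu⟩ := h3
        obtain ⟨v, hv⟩ := hBe
        omega
    · subst ht
      rw [dW_of_gt _ (by omega), dW_of_gt _ (by omega)]; simp
  · rw [dW, dW, if_neg hB, if_neg hB, map_zero]

end GradedComplex

section Descent

set_option linter.unusedSectionVars false

open MvPolynomial

variable {ι : Type} [Fintype ι] [LinearOrder ι] {R : Type} [CommRing R]

/-- Base change of the terms of the complex. -/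
def EE.map {S : Type} [CommRing S] (f : R →+* S) {q t : ℕ} (x : EE ι R q t) : EE ι S q t :=
  ⟨fun B => MvPolynomial.map f ((x : Finset ι → MvPolynomial ι R) B),
    fun B => (x.2.1 B).map f, fun B hB => by dsimp only; rw [x.2.2 B hB, map_zero]⟩

lemma EE.map_apply {S : Type} [CommRing S] (f : R →+* S) {q t : ℕ} (x : EE ι R q t)
    (B : Finset ι) : ((EE.map f x : EE ι S q t) : Finset ι → MvPolynomial ι S) B =
      MvPolynomial.map f ((x : Finset ι → MvPolynomial ι R) B) := rfl

variable {φ : Matrix ι ι R} (h0 : ∀ i, φ i i = 0) (h1 : ∀ i j, φ j i = - φ i j)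

include h0 h1 in
lemma dE_map {S : Type} [CommRing S] (f : R →+* S) {q t : ℕ} (x : EE ι R q (t + 1)) :
    dE (φ.map f) q t (EE.map f x) = EE.map f (dE φ q t x) := by
  ext1; funext B
  rw [EE.map_apply, dE_coe, dE_coe]
  unfold dW
  split_ifs
  · rw [DD_map]; rfl
  · rw [map_mul, Om_map _ h0 h1]; rfl
  · simp
  · simp

include h0 h1 in
lemma map_mem_range_dE (M : Submonoid R) {K : Type} [CommRing K] [Algebra R K]
    [IsLocalization M K] (hn : Odd (Fintype.card ι)) {q t : ℕ} (hq : Odd q) (x : EE ι R q t)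
    (hx : EE.map (algebraMap R K) x ∈ LinearMap.range (dE (φ.map (algebraMap R K)) q t)) :
    ∃ s ∈ M, s • x ∈ LinearMap.range (dE φ q t) := by
  by_cases ht : t ≤ q
  · obtain ⟨y, c, h⟩ := exists_of_mem_range_dE (map_diag _ h0) (map_skew _ h1) (hn.add_odd hq) ht _ hx
    exact exists_smul_mem_range_dE M h0 h1 ht x y c h
  · obtain ⟨y, hy⟩ := hx
    rw [EE_eq_zero (by omega) y, map_zero] at hy
    obtain ⟨s, hs, h⟩ := exists_clear_zero (K := K) M (x : Finset ι → MvPolynomial ι R)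
      fun B => by rw [← EE.map_apply, ← hy]; rfl
    refine ⟨s, hs, ?_⟩
    have : s • x = 0 := by
      ext1; funext B
      rw [Submodule.coe_smul, Pi.smul_apply, smul_eq_C_mul, h B]; rfl
    rw [this]; exact zero_mem _

variable {𝒜 : ℤ → AddSubgroup R} [GradedRing 𝒜]

include h0 h1 in
lemma mem_range_dE_of_localization (hlin : ∀ i j, φ i j ∈ 𝒜 1)
    (hneg : ∀ i : ℤ, i < 0 → 𝒜 i = ⊥) [IsLocalRing (𝒜 0)] [(maxHomIdeal 𝒜).IsPrime]
    (hn : Odd (Fintype.card ι)) {q t : ℕ} (hq : Odd q) (x : EE ι R q t)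
    (hx : ∀ c, EE.map (algebraMap R (Localization.AtPrime (maxHomIdeal 𝒜)))
      ((HomProj.EE 𝒜 q t).pr c x) ∈ LinearMap.range
        (dE (φ.map (algebraMap R (Localization.AtPrime (maxHomIdeal 𝒜)))) q t)) :
    x ∈ LinearMap.range (dE φ q t) := by
  refine (HomProj.EE 𝒜 q t).mem_of_smul_mem hneg _ ?_ x fun c => ?_
  · rintro c _ ⟨y, rfl⟩
    exact ⟨(HomProj.EE 𝒜 q (t + 1)).pr c y, dE_pr h0 h1 hlin hn hq t c y⟩
  · exact map_mem_range_dE h0 h1 (maxHomIdeal 𝒜).primeCompl hn hq _ (hx c)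

include h0 h1 in
theorem exactAt_dE_of_localization (hlin : ∀ i j, φ i j ∈ 𝒜 1)
    (hneg : ∀ i : ℤ, i < 0 → 𝒜 i = ⊥) [IsLocalRing (𝒜 0)] [(maxHomIdeal 𝒜).IsPrime]
    (hn : Odd (Fintype.card ι)) {q : ℕ} (hq : Odd q) (i : ℕ)
    (hex : ExE (φ.map (algebraMap R (Localization.AtPrime (maxHomIdeal 𝒜)))) q i) :
    ExE φ q i := by
  intro y hy
  refine mem_range_dE_of_localization h0 h1 hlin hneg hn hq y fun c => hex _ ?_
  rw [dE_map h0 h1, dE_pr h0 h1 hlin hn hq, hy, map_zero]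
  ext1; funext B
  rw [EE.map_apply]; simp

end Descent

/-! ### The presentation of the ideal of submaximal Pfaffians -/

section Presentation

set_option linter.unusedSectionVars false

open MvPolynomial

variable {ι : Type} [Fintype ι] [LinearOrder ι] {R : Type} [CommRing R]

lemma DD_empty (φ : Matrix ι ι R) (y : Finset ι → MvPolynomial ι R) :
    DD φ y ∅ = ∑ b, ell φ b * y {b} := by
  rw [DD, gd_apply]
  refine Finset.sum_congr rfl fun b _ => ?_
  rw [flip_of_notMem (Finset.notMem_empty b)]
  simp [sgn, dc]

variable {φ : Matrix ι ι R} (h0 : ∀ i, φ i i = 0) (h1 : ∀ i j, φ j i = - φ i j)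

include h0 h1 in
lemma Om_empty (hn : Odd (Fintype.card ι)) : Om φ ∅ = 0 := by
  rw [Om, vac_parity h0 h1 _ (by simpa using hn), C_0]

include h0 h1 in
lemma mem_range_dE_zero_iff (hn : Odd (Fintype.card ι)) {q : ℕ} (hq : Odd q) (m : EE ι R q 0) :
    m ∈ LinearMap.range (dE φ q 0) ↔
      (m : Finset ι → MvPolynomial ι R) ∅ ∈ Ideal.span (Set.range (ell φ)) := by
  constructor
  · intro h
    obtain ⟨y, c, h⟩ := exists_of_mem_range_dE h0 h1 (hn.add_odd hq) (Nat.zero_le _) m h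
    rw [h ∅ (by simp), Om_empty h0 h1 hn, mul_zero, add_zero, DD_empty]
    exact sum_mem fun b _ => Ideal.mul_mem_right _ _ (Ideal.subset_span ⟨b, rfl⟩)
  · intro h
    obtain ⟨g, hg⟩ := (Submodule.mem_span_range_iff_exists_fun _).1 h
    refine mem_range_dE_of (Nat.zero_le _) m (fun B => if h : B.Nonempty then g (B.min' h) else 0) 0
      fun B hB => ?_
    obtain rfl : B = ∅ := by simpa using hB
    rw [DD_empty, ← hg, C_0, zero_mul, add_zero]
    refine Finset.sum_congr rfl fun b _ => ?_
    simp [mul_comm]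

include h0 h1 in
lemma X_mul_vac_sub_mem (j k : ι) :
    X j * C (vac φ {k}) - X k * C (vac φ {j}) ∈ Ideal.span (Set.range (ell φ)) := by
  wlog hjk : j < k generalizing j k
  · rcases (not_lt.1 hjk).lt_or_eq with h | rfl
    · have := Ideal.neg_mem_iff _ |>.2 (this k j h)
      rwa [neg_sub] at this
    · rw [sub_self]; exact zero_mem _
  have h := congrFun (DD_Om h0 h1) {j, k}
  rw [DD, gd_apply] at h
  have hne : j ≠ k := hjk.ne
  rw [← Finset.sum_sdiff (Finset.subset_univ {j, k}), Finset.sum_pair hne] at h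
  have hs1 : sgn (MvPolynomial ι R) j {j, k} = 1 := by
    rw [sgn, Finset.filter_false_of_mem, Finset.card_empty, pow_zero]
    intro x hx
    rcases Finset.mem_insert.1 hx with rfl | hx
    · exact lt_irrefl _
    · rw [Finset.mem_singleton.1 hx]; exact hjk.le.not_gt
  have hs2 : sgn (MvPolynomial ι R) k {j, k} = -1 := by
    have : ({j, k} : Finset ι).filter (· < k) = {j} := by
      ext x
      simp only [Finset.mem_filter, Finset.mem_insert, Finset.mem_singleton]
      constructor
      · rintro ⟨rfl | rfl, h⟩
        · rfl
        · exact (lt_irrefl _ h).elim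
      · rintro rfl; exact ⟨Or.inl rfl, hjk⟩
    rw [sgn, this]; simp
  rw [hs1, hs2, flip_of_mem (by simp), flip_of_mem (by simp)] at h
  have he1 : ({j, k} : Finset ι).erase j = {k} := by
    ext x; simp only [Finset.mem_erase, Finset.mem_insert, Finset.mem_singleton]; grind
  have he2 : ({j, k} : Finset ι).erase k = {j} := by
    ext x; simp only [Finset.mem_erase, Finset.mem_insert, Finset.mem_singleton]; grind
  rw [he1, he2] at h
  simp only [Finset.mem_insert, Finset.mem_singleton, true_or, or_true, decide_true, dc, Om,
    one_mul] at h
  have h2 : X j * C (vac φ {k}) - X k * C (vac φ {j}) = -∑ b ∈ Finset.univ \ {j, k},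
      sgn (MvPolynomial ι R) b {j, k} * dc φ b (decide (b = j ∨ b = k)) * C (vac φ (flip b {j, k})) := by
    simp only [dc]
    simp only [Pi.zero_apply] at h
    linear_combination h
  rw [h2, Ideal.neg_mem_iff]
  refine sum_mem fun b hb => Ideal.mul_mem_right _ _ (Ideal.mul_mem_left _ _ ?_)
  have : ¬ (b = j ∨ b = k) := by simpa using hb
  rw [decide_eq_false this]
  exact Ideal.subset_span ⟨b, rfl⟩

/-- A linear form as an element of the complex. -/
def linE (v : ι → R) : EE ι R 1 0 :=
  ⟨fun B => if B = ∅ then ∑ j, X j * C (v j) else 0, fun B => by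
    dsimp only
    split_ifs
    · refine IsHomogeneous.sum _ _ _ fun j _ => ?_
      simpa using (isHomogeneous_X R j).mul (isHomogeneous_C ι (v j))
    · exact isHomogeneous_zero _ _ _, fun B hB => if_neg (by
      rintro rfl; exact hB (Or.inl ⟨by simp, by simp, by simp⟩))⟩

lemma linE_empty (v : ι → R) :
    (linE v : Finset ι → MvPolynomial ι R) ∅ = ∑ j, X j * C (v j) := by
  simp [linE]

lemma VacDepth.mono {q q' : ℕ} (h : VacDepth φ q') (hq : q ≤ q') : VacDepth φ q := by
  intro p hp hpn
  obtain ⟨a, ha, hreg⟩ := h p hp hpn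
  exact ⟨a, fun i hi => ha i (by omega), hreg.mono (by omega)⟩

include h0 h1 in
lemma linE_mem_range (hn : Odd (Fintype.card ι)) (hG : VacDepth φ 1) (a : ℕ → R)
    (ha : ∀ i < 3, a i ∈ vacIdeal φ 1) (hreg : WReg a R 3) (v : ι → R)
    (hv : ∑ j, v j * vac φ {j} = 0) : linE v ∈ LinearMap.range (dE φ 1 0) := by
  have hmul : ∀ r ∈ vacIdeal φ 1, r • linE v ∈ LinearMap.range (dE φ 1 0) := by
    intro r hr
    have hle : vacIdeal φ 1 ≤ (Submodule.comap (LinearMap.toSpanSingleton R _ (linE v))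
        (LinearMap.range (dE φ 1 0))) := by
      rw [vacIdeal, Ideal.span_le]
      rintro _ ⟨B, hB, rfl⟩
      change vac φ B • linE v ∈ LinearMap.range (dE φ 1 0)
      rcases Nat.le_one_iff_eq_zero_or_eq_one.1 hB with hB | hB
      · rw [Finset.card_eq_zero.1 hB, vac_parity h0 h1 _ (by simpa using hn), zero_smul]
        exact zero_mem _
      obtain ⟨k, rfl⟩ := Finset.card_eq_one.1 hB
      rw [mem_range_dE_zero_iff h0 h1 hn odd_one, Submodule.coe_smul, Pi.smul_apply, linE_empty,
        smul_eq_C_mul]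
      have h2 : C (vac φ {k}) * ∑ j, X j * C (v j) = ∑ j, C (v j) *
          (X j * C (vac φ {k}) - X k * C (vac φ {j})) + X k * C (∑ j, v j * vac φ {j}) := by
        rw [map_sum, Finset.mul_sum, Finset.mul_sum, ← Finset.sum_add_distrib]
        refine Finset.sum_congr rfl fun j _ => ?_
        rw [C_mul]; ring
      rw [h2, hv, C_0, mul_zero, add_zero]
      exact sum_mem fun j _ => Ideal.mul_mem_left _ _ (X_mul_vac_sub_mem h0 h1 j k)
    exact hle hr
  refine exactAt_of_pow_smul_mem (E := fun t => EE ι R 1 t) (d := dE φ 1) (a := a)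
    (fun i x => dE_dE h0 h1 1 i x) 2 (fun i => hreg.EE 1 i)
    (fun i _ => exactAt_dE φ h0 h1 hn odd_one hG i) ?_ (linE v)
    (fun i hi => ⟨1, by rw [pow_one]; exact hmul _ (ha i hi)⟩)
  intro y _
  rw [EE_eq_zero (by omega) y]
  exact zero_mem _

variable {𝒜 : ℤ → AddSubgroup R} [GradedRing 𝒜]

include h0 h1 in
theorem linE_mem_range_of_localization (hlin : ∀ i j, φ i j ∈ 𝒜 1)
    (hneg : ∀ i : ℤ, i < 0 → 𝒜 i = ⊥) [IsLocalRing (𝒜 0)] [(maxHomIdeal 𝒜).IsPrime]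
    (hn : Odd (Fintype.card ι))
    (hG : VacDepth (φ.map (algebraMap R (Localization.AtPrime (maxHomIdeal 𝒜)))) 1)
    (a : ℕ → Localization.AtPrime (maxHomIdeal 𝒜))
    (ha : ∀ i < 3, a i ∈ vacIdeal (φ.map (algebraMap R (Localization.AtPrime (maxHomIdeal 𝒜)))) 1)
    (hreg : WReg a (Localization.AtPrime (maxHomIdeal 𝒜)) 3) (v : ι → R)
    (hv : ∑ j, v j * vac φ {j} = 0) : linE v ∈ LinearMap.range (dE φ 1 0) := by
  set f := algebraMap R (Localization.AtPrime (maxHomIdeal 𝒜)) with hf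
  refine mem_range_dE_of_localization h0 h1 hlin hneg hn odd_one _ fun c => ?_
  have h2 : EE.map f ((HomProj.EE 𝒜 1 0).pr c (linE v)) =
      linE fun j => f (GradedRing.proj 𝒜 c (v j)) := by
    ext1; funext B
    rw [EE.map_apply, HomProj.EE_apply]
    by_cases hB : B = ∅
    · subst hB
      rw [linE_empty, linE_empty, wt, if_pos (by omega), map_sum, map_sum]
      refine Finset.sum_congr rfl fun j _ => ?_
      rw [prP_X_mul, map_mul, map_X]
      congr 1
      have : prP 𝒜 c (C (v j) : MvPolynomial ι R) = C (GradedRing.proj 𝒜 c (v j)) := by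
        classical
        ext m
        rw [coeff_prP, coeff_C, coeff_C]
        split_ifs
        · rfl
        · simp
      simp [this]
    · simp [linE, hB]
  rw [h2]
  refine linE_mem_range (map_diag _ h0) (map_skew _ h1) hn hG a ha hreg _ ?_
  set e : ℤ := (((Fintype.card ι - 1) / 2 : ℕ) : ℤ) with he
  have h3 : ∀ j, vac φ {j} ∈ 𝒜 e := by
    intro j
    have := vac_mem_graded h0 h1 hlin {j}
    rwa [Finset.card_compl, Finset.card_singleton] at this
  have h4 := congrArg (GradedRing.proj 𝒜 (c + e)) hv
  rw [map_sum, map_zero] at h4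
  simp_rw [← vac_map f h0 h1, ← map_mul]
  rw [← map_sum, ← map_zero f, ← h4]
  congr 1
  refine Finset.sum_congr rfl fun j _ => ?_
  rw [proj_mul_right 𝒜 (h3 j), add_sub_cancel_right]

end Presentation

/-! ### Symmetric powers in terms of polynomials -/

section SymmetricPower

set_option linter.unusedSectionVars false

open MvPolynomial

variable {ι : Type} {R : Type} [CommRing R]

/-- The exponent vector of a product of variables. -/
def expo {m : ℕ} (f : Fin m → ι) : ι →₀ ℕ := ∑ i, Finsupp.single (f i) 1

lemma prod_X_eq {m : ℕ} (f : Fin m → ι) :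
    (∏ i, X (f i) : MvPolynomial ι R) = monomial (expo f) 1 := by
  rw [expo, monomial_sum_one]
  rfl

lemma exists_perm_of_expo_eq {m : ℕ} {f g : Fin m → ι} (h : expo f = expo g) :
    ∃ σ : Equiv.Perm (Fin m), f = g ∘ σ := by
  classical
  have hc : ∀ (f : Fin m → ι) a, expo f a = Fintype.card {i // f i = a} := by
    intro f a
    rw [expo, Finsupp.finsetSum_apply, Fintype.card_subtype, Finset.card_filter]
    exact Finset.sum_congr rfl fun i _ => by rw [Finsupp.single_apply]
  have he : ∀ a, Nonempty ({i // f i = a} ≃ {i // g i = a}) := fun a =>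
    Fintype.card_eq.1 (by rw [← hc, ← hc, h])
  refine ⟨Equiv.ofFiberEquiv fun a => (he a).some, ?_⟩
  funext i
  exact (Equiv.ofFiberEquiv_map _ i).symm

lemma exists_expo_eq {m : ℕ} {a : ι →₀ ℕ} (h : a.degree = m) : ∃ f : Fin m → ι, expo f = a := by
  induction m generalizing a with
  | zero =>
    refine ⟨Fin.elim0, ?_⟩
    rw [(Finsupp.degree_eq_zero_iff a).1 h]
    simp [expo]
  | succ m ih =>
    obtain ⟨j, hj⟩ : ∃ j, a j ≠ 0 := by
      by_contra! h0
      rw [show a = 0 from Finsupp.ext h0] at h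
      simp at h
    have ha : Finsupp.single j 1 + (a - Finsupp.single j 1) = a :=
      add_tsub_cancel_of_le (Finsupp.single_le_iff.2 (Nat.one_le_iff_ne_zero.2 hj))
    obtain ⟨f, hf⟩ := ih (a := a - Finsupp.single j 1) (by
      rw [← ha, map_add, Finsupp.degree_single] at h
      omega)
    refine ⟨Fin.cons j f, ?_⟩
    rw [expo, Fin.sum_univ_succ, ← ha, ← hf]
    simp [expo]

lemma isHomogeneous_mem_span {m : ℕ} {p : MvPolynomial ι R} (hp : p.IsHomogeneous m) :
    p ∈ Submodule.span R (Set.range fun f : Fin m → ι => ∏ i, X (f i)) := by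
  rw [p.as_sum]
  refine sum_mem fun a ha => ?_
  obtain ⟨f, hf⟩ := exists_expo_eq (m := m) (a := a) (by
    have := hp (mem_support_iff.1 ha)
    rwa [Finsupp.degree_eq_weight_one])
  have : monomial a (coeff a p) = coeff a p • (∏ i, X (f i) : MvPolynomial ι R) := by
    rw [prod_X_eq, hf, smul_monomial, smul_eq_mul, mul_one]
  rw [this]
  exact Submodule.smul_mem _ _ (Submodule.subset_span ⟨f, rfl⟩)

variable {Q : Type} [AddCommGroup Q] [Module R Q]

variable (R Q) in
/-- The product of elements in the symmetric power. -/
def symProd (m : ℕ) : MultilinearMap R (fun _ : Fin m => Q) (SymPow (R := R) Q m) :=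
  (Submodule.mkQ _).compMultilinearMap (PiTensorProduct.tprod R)

lemma symProd_perm {m : ℕ} (v : Fin m → Q) (σ : Equiv.Perm (Fin m)) :
    symProd R Q m (v ∘ σ) = symProd R Q m v := by
  have h : PiTensorProduct.tprod R v - PiTensorProduct.tprod R (v ∘ σ) ∈ Submodule.span R
      { x : ⨂[R]^m Q | ∃ (v : Fin m → Q) (σ : Equiv.Perm (Fin m)),
        x = (PiTensorProduct.tprod R v) - (PiTensorProduct.tprod R (v ∘ σ)) } :=
    Submodule.subset_span ⟨v, σ, rfl⟩
  exact ((Submodule.Quotient.eq _).2 h).symm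

lemma span_symProd (m : ℕ) : Submodule.span R (Set.range (symProd R Q m)) = ⊤ := by
  have h : Set.range (symProd R Q m) =
      (Submodule.mkQ _ : (⨂[R]^m Q) →ₗ[R] SymPow (R := R) Q m) ''
        Set.range (PiTensorProduct.tprod R) := by
    rw [← Set.range_comp]; rfl
  rw [h, Submodule.span_image, PiTensorProduct.span_tprod_eq_top, Submodule.map_top,
    Submodule.range_mkQ]

open Classical in
/-- The map from polynomials to the symmetric power determined by the images of the variables. -/
def polyToSym (e : ι → Q) (m : ℕ) : MvPolynomial ι R →ₗ[R] SymPow (R := R) Q m :=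
  (basisMonomials ι R).constr R fun a =>
    if h : ∃ f : Fin m → ι, expo f = a then symProd R Q m (e ∘ h.choose) else 0

lemma polyToSym_prod (e : ι → Q) {m : ℕ} (f : Fin m → ι) :
    polyToSym (R := R) e m (∏ i, X (f i)) = symProd R Q m (e ∘ f) := by
  have h : ∃ f' : Fin m → ι, expo f' = expo f := ⟨f, rfl⟩
  have h2 : (∏ i, X (f i) : MvPolynomial ι R) = basisMonomials ι R (expo f) := by
    rw [prod_X_eq, coe_basisMonomials]
  rw [h2, polyToSym, Module.Basis.constr_basis, dif_pos h]
  obtain ⟨σ, hσ⟩ := exists_perm_of_expo_eq h.choose_spec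
  rw [hσ, ← Function.comp_assoc, symProd_perm]

variable [Fintype ι]

lemma polyToSym_prod_linear (e : ι → Q) {m : ℕ} (v : Fin m → ι → R) :
    polyToSym (R := R) e m (∏ i, ∑ j, X j * C (v i j)) =
      symProd R Q m fun i => ∑ j, v i j • e j := by
  classical
  rw [Finset.prod_univ_sum, map_sum, MultilinearMap.map_sum]
  refine Finset.sum_congr (by simp) fun f _ => ?_
  rw [Finset.prod_mul_distrib, ← map_prod, mul_comm, ← smul_eq_C_mul, map_smul, polyToSym_prod,
    MultilinearMap.map_smul_univ]
  rfl

lemma polyToSym_surjective (e : ι → Q) (he : ∀ x : Q, ∃ v : ι → R, ∑ j, v j • e j = x) {m : ℕ}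
    (z : SymPow (R := R) Q m) :
    ∃ p : MvPolynomial ι R, p.IsHomogeneous m ∧ polyToSym (R := R) e m p = z := by
  have hz : z ∈ Submodule.map (polyToSym (R := R) e m) (homogeneousSubmodule ι R m) := by
    have : Submodule.span R (Set.range (symProd R Q m)) ≤
        Submodule.map (polyToSym (R := R) e m) (homogeneousSubmodule ι R m) := by
      rw [Submodule.span_le]
      rintro _ ⟨u, rfl⟩
      choose v hv using fun i => he (u i)
      refine ⟨_, ?_, (polyToSym_prod_linear e v).trans (by simp only [hv])⟩
      have := IsHomogeneous.prod Finset.univ (fun i : Fin m => (∑ j, X j * C (v i j) :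
        MvPolynomial ι R)) (fun _ => 1) (fun i _ => IsHomogeneous.sum _ _ _ fun j _ => by
          simpa using (isHomogeneous_X R j).mul (isHomogeneous_C ι (v i j)))
      simpa using this
    exact this (by rw [span_symProd]; trivial)
  obtain ⟨p, hp, h⟩ := hz
  exact ⟨p, hp, h⟩

lemma polyToSym_linear_mul (e : ι → Q) {m : ℕ} (v : ι → R) (hv : ∑ j, v j • e j = 0)
    {p : MvPolynomial ι R} (hp : p.IsHomogeneous m) :
    polyToSym (R := R) e (m + 1) ((∑ j, X j * C (v j)) * p) = 0 := by
  classical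
  have h := isHomogeneous_mem_span hp
  clear hp
  induction h using Submodule.span_induction with
  | mem x hx =>
    obtain ⟨f, rfl⟩ := hx
    have h2 := polyToSym_prod_linear (R := R) e (m := m + 1)
      (Fin.cons v fun i => Pi.single (f i) 1)
    rw [Fin.prod_univ_succ] at h2
    simp only [Fin.cons_zero, Fin.cons_succ] at h2
    have h3 : ∀ i, (∑ j, X j * C ((Pi.single (f i) 1 : ι → R) j) : MvPolynomial ι R) = X (f i) := by
      intro i
      rw [Finset.sum_eq_single (f i)]
      · simp
      · intro b _ hb; rw [Pi.single_eq_of_ne hb]; simp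
      · simp
    simp only [h3] at h2
    rw [h2]
    refine MultilinearMap.map_coord_zero _ 0 ?_
    simpa using hv
  | zero => simp
  | add x y _ _ hx hy => rw [mul_add, map_add, hx, hy, add_zero]
  | smul a x _ hx => rw [mul_smul_comm, map_smul, hx, smul_zero]

lemma mem_of_polyToSym_eq_zero (e : ι → Q) (he : ∀ x : Q, ∃ v : ι → R, ∑ j, v j • e j = x)
    (L : Ideal (MvPolynomial ι R))
    (hL : ∀ v : ι → R, ∑ j, v j • e j = 0 → ∑ j, X j * C (v j) ∈ L) {m : ℕ}
    {p : MvPolynomial ι R} (hp : p.IsHomogeneous m) (h : polyToSym (R := R) e m p = 0) : p ∈ L := by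
  classical
  set π : (ι → R) →ₗ[R] Q := Fintype.linearCombination R e with hπ
  have hπs : Function.Surjective π := fun x => by
    obtain ⟨v, hv⟩ := he x
    exact ⟨v, hv⟩
  set ψ0 : (ι → R) →ₗ[R] (MvPolynomial ι R ⧸ L) :=
    Fintype.linearCombination R fun j => Ideal.Quotient.mk L (X j) with hψ0
  have hker : LinearMap.ker π ≤ LinearMap.ker ψ0 := by
    intro v hv
    have h2 := hL v hv
    rw [LinearMap.mem_ker, hψ0, Fintype.linearCombination_apply]
    rw [← Ideal.Quotient.eq_zero_iff_mem, map_sum] at h2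
    rw [← h2]
    refine Finset.sum_congr rfl fun j _ => ?_
    rw [mul_comm, ← smul_eq_C_mul]
    rfl
  set ψ : Q →ₗ[R] (MvPolynomial ι R ⧸ L) := ((LinearMap.ker π).liftQ ψ0 hker).comp
    (π.quotKerEquivOfSurjective hπs).symm.toLinearMap with hψ
  have hψe : ∀ j, ψ (e j) = Ideal.Quotient.mk L (X j) := by
    intro j
    have h2 : π (Pi.single j 1) = e j := by simp [hπ]
    have h3 : (π.quotKerEquivOfSurjective hπs).symm (e j) =
        Submodule.Quotient.mk (Pi.single j 1) := by
      rw [LinearEquiv.symm_apply_eq, ← h2]; rfl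
    rw [hψ, LinearMap.comp_apply, LinearEquiv.coe_coe, h3, Submodule.liftQ_apply]
    simp [hψ0]
  set F0 := (MultilinearMap.mkPiAlgebra R (Fin m) (MvPolynomial ι R ⧸ L)).compLinearMap
    (fun _ => ψ) with hF0
  set F : SymPow (R := R) Q m →ₗ[R] (MvPolynomial ι R ⧸ L) :=
    Submodule.liftQ _ (PiTensorProduct.lift F0) (by
      rw [Submodule.span_le]
      rintro _ ⟨v, σ, rfl⟩
      rw [SetLike.mem_coe, LinearMap.mem_ker, map_sub, PiTensorProduct.lift.tprod,
        PiTensorProduct.lift.tprod, sub_eq_zero]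
      simp only [hF0, MultilinearMap.compLinearMap_apply, MultilinearMap.mkPiAlgebra_apply,
        Function.comp_apply]
      exact (Equiv.prod_comp σ fun i => ψ (v i)).symm) with hF
  have hFs : ∀ u : Fin m → Q, F (symProd R Q m u) = ∏ i, ψ (u i) := by
    intro u
    change PiTensorProduct.lift F0 (PiTensorProduct.tprod R u) = _
    rw [PiTensorProduct.lift.tprod]
    simp [hF0]
  have hFG : ∀ p ∈ Submodule.span R (Set.range fun f : Fin m → ι => (∏ i, X (f i) :
      MvPolynomial ι R)), F (polyToSym e m p) = Ideal.Quotient.mk L p := by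
    intro p hp
    induction hp using Submodule.span_induction with
    | mem x hx =>
      obtain ⟨f, rfl⟩ := hx
      simp only
      rw [polyToSym_prod, hFs, map_prod]
      simp only [Function.comp_apply, hψe]
    | zero => simp
    | add x y _ _ hx hy => rw [map_add, map_add, map_add, hx, hy]
    | smul a x _ hx => rw [map_smul, map_smul, hx]; rfl
  rw [← Ideal.Quotient.eq_zero_iff_mem, ← hFG p (isHomogeneous_mem_span hp), h, map_zero]

end SymmetricPower

/-! ### Torsion of the symmetric power through the complex -/

section TorsionOfSym

open MvPolynomial

variable {ι : Type} [Fintype ι] [LinearOrder ι] {R : Type} [CommRing R]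
  {φ : Matrix ι ι R} (h0 : ∀ i, φ i i = 0) (h1 : ∀ i j, φ j i = - φ i j)

include h0 h1 in
lemma sum_mul_vac_singleton (b : ι) : ∑ j, φ j b * vac φ {j} = 0 := by
  have h := congrFun (vac_isVac h0 h1 b) ∅
  rw [gd_apply] at h
  rw [← neg_eq_zero, ← Finset.sum_neg_distrib]
  refine (Finset.sum_congr rfl fun j _ => ?_).trans h
  rw [flip_of_notMem (Finset.notMem_empty j)]
  simp [sgn, rowCoeff, h1 b j]

include h0 h1 in
lemma exists_vac_combination (hn : Odd (Fintype.card ι)) {x : R} (hx : x ∈ vacIdeal φ 1) :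
    ∃ v : ι → R, ∑ j, v j * vac φ {j} = x := by
  have hle : vacIdeal φ 1 ≤ Ideal.span (Set.range fun j => vac φ {j}) := by
    rw [vacIdeal, Ideal.span_le]
    rintro _ ⟨B, hB, rfl⟩
    rcases Nat.le_one_iff_eq_zero_or_eq_one.1 hB with hB | hB
    · rw [Finset.card_eq_zero.1 hB, vac_parity h0 h1 _ (by simpa using hn)]
      exact zero_mem _
    · obtain ⟨k, rfl⟩ := Finset.card_eq_one.1 hB
      exact Ideal.subset_span ⟨k, rfl⟩
  exact (Submodule.mem_span_range_iff_exists_fun R).1 (hle hx)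

/-- The element of the last term of the complex given by a polynomial. -/
def polyE (q : ℕ) (p : MvPolynomial ι R) (hp : p.IsHomogeneous q) : EE ι R q 0 :=
  ⟨fun B => if B = ∅ then p else 0, fun B => by
    dsimp only
    split_ifs
    · exact hp
    · exact isHomogeneous_zero _ _ _, fun B hB => if_neg (by
      rintro rfl; exact hB (Or.inl ⟨by simp, by simp, by simp⟩))⟩

lemma polyE_empty (q : ℕ) (p : MvPolynomial ι R) (hp : p.IsHomogeneous q) :
    (polyE q p hp : Finset ι → MvPolynomial ι R) ∅ = p := by
  simp [polyE]

include h0 h1 in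
lemma polyToSym_eq_zero_iff (hn : Odd (Fintype.card ι)) {q : ℕ} (hq : Odd q)
    (hpres : ∀ v : ι → R, ∑ j, v j * vac φ {j} = 0 → linE v ∈ LinearMap.range (dE φ 1 0))
    {I : Ideal R} (hI : I = vacIdeal φ 1) (e : ι → I) (he : ∀ j, (e j : R) = vac φ {j})
    (m : EE ι R q 0) :
    polyToSym (R := R) e q ((m : Finset ι → MvPolynomial ι R) ∅) = 0 ↔
      m ∈ LinearMap.range (dE φ q 0) := by
  have hcoe : ∀ v : ι → R, ((∑ j, v j • e j : I) : R) = ∑ j, v j * vac φ {j} := by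
    intro v
    rw [AddSubmonoidClass.coe_finsetSum]
    exact Finset.sum_congr rfl fun j _ => by rw [← he j]; rfl
  constructor
  · intro h
    rw [mem_range_dE_zero_iff h0 h1 hn hq]
    refine mem_of_polyToSym_eq_zero e (fun x => ?_) _ (fun v hv => ?_) (m.2.1 ∅) h
    · obtain ⟨v, hv⟩ := exists_vac_combination h0 h1 hn (hI.le x.2)
      exact ⟨v, Subtype.ext ((hcoe v).trans hv)⟩
    · have := hpres v (by rw [← hcoe, hv]; rfl)
      rwa [mem_range_dE_zero_iff h0 h1 hn odd_one, linE_empty] at this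
  · rintro ⟨y, rfl⟩
    obtain ⟨k, rfl⟩ : ∃ k, q = k + 1 := ⟨q - 1, by have := hq.pos; omega⟩
    rw [dE_coe, dW_of_lt φ (Nat.succ_pos k) _ (by simp) (by simp), DD_empty, map_sum]
    refine Finset.sum_eq_zero fun b _ => ?_
    exact polyToSym_linear_mul e (fun j => φ j b)
      (Subtype.ext ((hcoe _).trans (sum_mul_vac_singleton h0 h1 b))) (y.2.1 {b})

include h0 h1 in
theorem mem_annihilator_torsion_iff (hn : Odd (Fintype.card ι)) {q : ℕ} (hq : Odd q)
    (hpres : ∀ v : ι → R, ∑ j, v j * vac φ {j} = 0 → linE v ∈ LinearMap.range (dE φ 1 0))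
    {I : Ideal R} (hI : I = vacIdeal φ 1) (𝔪 : Ideal R) (r : R) :
    r ∈ Module.annihilator R ↥(torsionSubmodule 𝔪 (SymPow (R := R) ↥I q)) ↔
      ∀ m : EE ι R q 0, (∃ t : ℕ, ∀ s ∈ 𝔪 ^ t, s • m ∈ LinearMap.range (dE φ q 0)) →
        r • m ∈ LinearMap.range (dE φ q 0) := by
  set e : ι → I := fun j => ⟨vac φ {j}, by rw [hI]; exact vac_mem_vacIdeal _ (by simp)⟩
  have key := polyToSym_eq_zero_iff h0 h1 hn hq hpres hI e (fun _ => rfl)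
  have hsm : ∀ (s : R) (m : EE ι R q 0),
      polyToSym (R := R) e q (((s • m : EE ι R q 0) : Finset ι → MvPolynomial ι R) ∅) =
        s • polyToSym (R := R) e q ((m : Finset ι → MvPolynomial ι R) ∅) := by
    intro s m
    rw [Submodule.coe_smul, Pi.smul_apply, map_smul]
  rw [Module.mem_annihilator]
  constructor
  · rintro h m ⟨t, ht⟩
    have := h ⟨polyToSym (R := R) e q ((m : Finset ι → MvPolynomial ι R) ∅), t, fun s hs => by
      rw [← hsm, key]; exact ht s hs⟩
    rw [← key, hsm]
    exact congrArg Subtype.val this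
  · rintro h ⟨z, t, ht⟩
    obtain ⟨p, hp, rfl⟩ := polyToSym_surjective e (fun x => by
      obtain ⟨v, hv⟩ := exists_vac_combination h0 h1 hn (hI.le x.2)
      refine ⟨v, Subtype.ext (Eq.trans ?_ hv)⟩
      rw [AddSubmonoidClass.coe_finsetSum]
      rfl) z
    refine Subtype.ext ?_
    change r • polyToSym (R := R) e q p = 0
    have h2 := h (polyE q p hp) ⟨t, fun s hs => by
      rw [← key, hsm, polyE_empty]; exact ht s hs⟩
    rwa [← key, hsm, polyE_empty] at h2

end TorsionOfSym

/-! ### Consequences of the height conditions -/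

section HeightConsequences

variable {R : Type} [CommRing R]

theorem exists_wreg_vacIdeal_localization [IsNoetherianRing R] (𝔪 : Ideal R) [𝔪.IsPrime] {d n : ℕ}
    (hdim : ringKrullDim R = (d : WithBot (WithTop ℕ))) (x : ℕ → R) (hx : ∀ i < d, x i ∈ 𝔪)
    (hreg : WReg x R d) (φ : Matrix (Fin n) (Fin n) R) (h0 : ∀ i, φ i i = 0)
    (h1 : ∀ i j, φ j i = - φ i j) {k q : ℕ} (hk : k ≤ d)
    (hht : (k : ℕ∞) ≤ idealHeight (vacIdeal φ q)) :
    ∃ a : ℕ → Localization.AtPrime 𝔪,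
      (∀ i < k, a i ∈ vacIdeal (φ.map (algebraMap R (Localization.AtPrime 𝔪))) q) ∧
        WReg a (Localization.AtPrime 𝔪) k := by
  set A := Localization.AtPrime 𝔪
  have hnA : IsNoetherianRing A := IsLocalization.isNoetherianRing 𝔪.primeCompl A inferInstance
  refine exists_wreg_of_height (fun i => algebraMap R A (x i)) (d := d) (fun i hi => ?_)
    (hreg.localize 𝔪.primeCompl) ?_ (vacIdeal _ q) _ hk ?_
  · have := hx i hi
    rwa [← IsLocalization.AtPrime.to_map_mem_maximal_iff A 𝔪] at this
  · have h := IsLocalization.AtPrime.ringKrullDim_eq_height 𝔪 A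
    have h2 : ringKrullDim A ≤ ringKrullDim R := by
      rw [h]
      exact Ideal.height_le_ringKrullDim_of_ne_top (Ideal.IsPrime.ne_top inferInstance)
    rw [hdim] at h2
    exact h2
  · intro P hP
    set p : Ideal R := P.asIdeal.under R with hp
    have hpp : p.IsPrime := inferInstance
    have hle : vacIdeal φ q ≤ p := by
      rw [hp, Ideal.under_def, ← Ideal.map_le_iff_le_comap]
      exact (map_vacIdeal_le _ h0 h1 q).trans hP
    have h4 : idealHeight (vacIdeal φ q) ≤ Order.height (⟨p, hpp⟩ : PrimeSpectrum R) :=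
      iInf₂_le (⟨p, hpp⟩ : PrimeSpectrum R) hle
    have h5 := PrimeSpectrum.height_eq_orderHeight (⟨p, hpp⟩ : PrimeSpectrum R)
    have h6 : p.height = P.asIdeal.height := IsLocalization.height_under 𝔪.primeCompl P.asIdeal
    rw [← PrimeSpectrum.height_eq_orderHeight, ← h6]
    exact (hht.trans h4).trans h5.ge

lemma le_idealHeight_vacIdeal {d n : ℕ} (hd1 : 1 ≤ d) (hdn : d ≤ n) (hnodd : Odd n)
    (hdeven : Even d) (φ : Matrix (Fin n) (Fin n) R) (h0 : ∀ i, φ i i = 0)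
    (h1 : ∀ i j, φ j i = - φ i j)
    (hF : ∀ i : ℕ, (n : ℤ) - d ≤ i → (i : ℤ) ≤ (n : ℤ) - 1 →
      ((n - i : ℕ) : ℕ∞) ≤ idealHeight (minorsIdeal n i φ)) :
    (d : ℕ∞) ≤ idealHeight (vacIdeal φ (d - 1)) := by
  refine le_iInf₂ fun p hp => ?_
  have ho : Odd (d - 1) := Nat.Even.sub_odd hd1 hdeven odd_one
  have hmin := minorsIdeal_le_of_vacIdeal_le h0 h1 hnodd ho (r := n - (d - 1) - 1) (by omega)
    p.asIdeal hp
  have h3 := hF (n - (d - 1) - 1) (by omega) (by omega)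
  rw [show n - (n - (d - 1) - 1) = d by omega] at h3
  exact h3.trans (iInf₂_le p hmin)

variable {𝒜 : ℤ → AddSubgroup R} [GradedRing 𝒜]

lemma maxHomIdeal_pow_isHomogeneous (N : ℕ) : ((maxHomIdeal 𝒜) ^ N).IsHomogeneous 𝒜 := by
  induction N with
  | zero => rw [pow_zero, Ideal.one_eq_top]; exact Ideal.IsHomogeneous.top 𝒜
  | succ N ih =>
    rw [pow_succ]
    refine ih.mul (Ideal.homogeneous_span 𝒜 _ ?_)
    rintro x (⟨h, -⟩ | h)
    · exact ⟨0, h⟩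
    · obtain ⟨i, -, h⟩ := Set.mem_iUnion₂.1 h
      exact ⟨i, h⟩

lemma proj_mem_maxHomIdeal_pow {N : ℕ} {x : R} (hx : x ∈ (maxHomIdeal 𝒜) ^ N) (c : ℤ) :
    GradedRing.proj 𝒜 c x ∈ (maxHomIdeal 𝒜) ^ N :=
  maxHomIdeal_pow_isHomogeneous N c hx

/-- A homogeneous ideal of maximal height contains a power of the maximal homogeneous ideal. -/
lemma exists_maxHomIdeal_pow_le [IsNoetherianRing R] (hneg : ∀ i : ℤ, i < 0 → 𝒜 i = ⊥)
    [IsLocalRing (𝒜 0)] {d : ℕ} (hdim : ringKrullDim R = (d : WithBot (WithTop ℕ)))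
    (J : Ideal R) (hJ : J.IsHomogeneous 𝒜) (hht : (d : ℕ∞) ≤ idealHeight J) :
    ∃ N, (maxHomIdeal 𝒜) ^ N ≤ J := by
  have hmax := maxHomIdeal_isMaximal (𝒜 := 𝒜) hneg
  set 𝔪 := maxHomIdeal 𝒜
  have hpr : 𝔪.IsPrime := hmax.isPrime
  set A := Localization.AtPrime 𝔪
  have hnA : IsNoetherianRing A := IsLocalization.isNoetherianRing 𝔪.primeCompl A inferInstance
  obtain ⟨N, hN⟩ := Ideal.exists_radical_pow_le_of_fg (J.map (algebraMap R A))
    ((isNoetherianRing_iff_ideal_fg A).1 hnA _)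
  refine ⟨N, fun m hm => ?_⟩
  have key : ∀ m ∈ 𝔪 ^ N, ∃ s, s ∉ 𝔪 ∧ s • m ∈ J := by
    intro m hm
    have h1 : 𝔪.map (algebraMap R A) ≤ (J.map (algebraMap R A)).radical := by
      rw [Ideal.radical_eq_sInf]
      refine le_sInf fun P ⟨hJP, hP⟩ => ?_
      set p : Ideal R := P.under R with hp
      have hpp : p.IsPrime := inferInstance
      have hle : J ≤ p := by rwa [hp, Ideal.under_def, ← Ideal.map_le_iff_le_comap]
      have h4 : idealHeight J ≤ Order.height (⟨p, hpp⟩ : PrimeSpectrum R) :=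
        iInf₂_le (⟨p, hpp⟩ : PrimeSpectrum R) hle
      have hpm : p ≤ 𝔪 := by
        intro y hy
        by_contra hy2
        exact hP.ne_top (Ideal.eq_top_of_isUnit_mem P hy
          (IsLocalization.map_units A (⟨y, hy2⟩ : 𝔪.primeCompl)))
      rw [Ideal.map_le_iff_le_comap]
      change 𝔪 ≤ p
      rcases hpm.lt_or_eq with hlt | heq
      · exfalso
        have h7 : ((d : ℕ∞)) + 1 ≤ Order.height (⟨𝔪, hpr⟩ : PrimeSpectrum R) :=
          (add_le_add_left (hht.trans h4) 1).trans
            (Order.height_add_one_le (show (⟨p, hpp⟩ : PrimeSpectrum R) < ⟨𝔪, hpr⟩ from hlt))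
        rw [← PrimeSpectrum.height_eq_orderHeight] at h7
        have h8 := Ideal.height_le_ringKrullDim_of_ne_top hpr.ne_top
        rw [hdim] at h8
        have h9 : 𝔪.height ≤ (d : ℕ∞) := WithBot.coe_le_coe.1 h8
        have := h7.trans h9
        exact absurd this (by exact_mod_cast (by omega : ¬ d + 1 ≤ d))
      · exact heq.ge
    have h2 : algebraMap R A m ∈ J.map (algebraMap R A) := by
      refine hN (Ideal.pow_right_mono h1 N ?_)
      rw [← Ideal.map_pow]
      exact Ideal.mem_map_of_mem _ hm
    obtain ⟨⟨⟨j, hj⟩, s⟩, h⟩ := (IsLocalization.mem_map_algebraMap_iff 𝔪.primeCompl A).1 h2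
    rw [← map_mul] at h
    obtain ⟨c, hc⟩ := (IsLocalization.eq_iff_exists 𝔪.primeCompl A).1 h
    refine ⟨c * s, (c * s).2, ?_⟩
    rw [smul_eq_mul, show (c : R) * s * m = c * (m * s) by ring, hc]
    exact J.mul_mem_left _ hj
  exact (HomProj.self (𝒜 := 𝒜)).mem_of_smul_mem hneg J (fun c m hm => hJ c hm) m fun c =>
    key _ (proj_mem_maxHomIdeal_pow hm c)

lemma vacIdeal_isHomogeneous {n : ℕ} {φ : Matrix (Fin n) (Fin n) R} (h0 : ∀ i, φ i i = 0)
    (h1 : ∀ i j, φ j i = - φ i j) (hlin : ∀ i j, φ i j ∈ 𝒜 1) (q : ℕ) :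
    (vacIdeal φ q).IsHomogeneous 𝒜 := by
  refine Ideal.homogeneous_span 𝒜 _ ?_
  rintro x ⟨B, -, rfl⟩
  exact ⟨_, vac_mem_graded h0 h1 hlin B⟩

end HeightConsequences

/-! ### The type of a Cohen-Macaulay ring -/

section CanonicalType

open Abelian

variable {R : Type} [CommRing R]

lemma ext_smul_eq_zero (𝔪 : Ideal R) (M : ModuleCat.{0} R) (i : ℕ) {r : R} (hr : r ∈ 𝔪)
    (e : Abelian.Ext (ModuleCat.of R (R ⧸ 𝔪)) M i) : r • e = 0 := by
  have h : r • 𝟙 (ModuleCat.of R (R ⧸ 𝔪)) = 0 := by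
    refine ModuleCat.hom_ext (LinearMap.ext fun x => ?_)
    obtain ⟨x, rfl⟩ := Ideal.Quotient.mk_surjective x
    change r • Ideal.Quotient.mk 𝔪 x = 0
    rw [← Ideal.Quotient.mk_eq_mk, ← Submodule.Quotient.mk_smul, Submodule.Quotient.mk_eq_zero]
    exact 𝔪.mul_mem_right _ hr
  have h2 : (Abelian.Ext.mk₀ (r • 𝟙 (ModuleCat.of R (R ⧸ 𝔪)))).comp e (zero_add i) = r • e := by
    rw [Abelian.Ext.mk₀_smul]
    simp
  rw [← h2, h, Abelian.Ext.mk₀_zero, Abelian.Ext.zero_comp]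

lemma ext_comp_smul_eq_zero (𝔪 : Ideal R) (M : Type) [AddCommGroup M] [Module R M] (i : ℕ) {r : R}
    (hr : r ∈ 𝔪) (e : Abelian.Ext (ModuleCat.of R (R ⧸ 𝔪)) (ModuleCat.of R M) i) :
    e.comp (Abelian.Ext.mk₀ ((ModuleCat.of R M).smulShortComplex r).f) (add_zero i) = 0 := by
  rw [ModuleCat.smulShortComplex_f_eq_smul_id]
  exact (Abelian.Ext.smul_eq_comp_mk₀ e r).symm.trans (ext_smul_eq_zero 𝔪 _ i hr e)

/-- Rees' theorem. -/
theorem ext_residue_of_isWeaklyRegular (𝔪 : Ideal R) (rs : List R) (hmem : ∀ r ∈ rs, r ∈ 𝔪) :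
    ∀ (M : Type) [AddCommGroup M] [Module R M], RingTheory.Sequence.IsWeaklyRegular M rs →
      (∀ i < rs.length, Subsingleton (Abelian.Ext (ModuleCat.of R (R ⧸ 𝔪)) (ModuleCat.of R M) i)) ∧
      Nonempty (Abelian.Ext (ModuleCat.of R (R ⧸ 𝔪)) (ModuleCat.of R M) rs.length ≃ₗ[R]
        ((R ⧸ 𝔪) →ₗ[R] M ⧸ (Ideal.ofList rs • ⊤ : Submodule R M))) := by
  induction rs with
  | nil =>
    intro M _ _ _
    refine ⟨fun i hi => by simp at hi, ⟨?_⟩⟩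
    have hbot : (Ideal.ofList ([] : List R) • ⊤ : Submodule R M) = ⊥ := by simp
    let e1 : Abelian.Ext (ModuleCat.of R (R ⧸ 𝔪)) (ModuleCat.of R M) 0 ≃ₗ[R]
        (ModuleCat.of R (R ⧸ 𝔪) ⟶ ModuleCat.of R M) := Abelian.Ext.linearEquiv₀
    let e2 : (ModuleCat.of R (R ⧸ 𝔪) ⟶ ModuleCat.of R M) ≃ₗ[R] ((R ⧸ 𝔪) →ₗ[R] M) :=
      ModuleCat.homLinearEquiv
    let e3 : M ≃ₗ[R] (M ⧸ (Ideal.ofList ([] : List R) • ⊤ : Submodule R M)) :=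
      (Submodule.quotEquivOfEqBot _ hbot).symm
    let e4 : ((R ⧸ 𝔪) →ₗ[R] M) ≃ₗ[R]
        ((R ⧸ 𝔪) →ₗ[R] M ⧸ (Ideal.ofList ([] : List R) • ⊤ : Submodule R M)) :=
      LinearEquiv.congrRight e3
    exact (e1.trans e2).trans e4
  | cons r rs ih =>
    intro M _ _ hreg
    rw [RingTheory.Sequence.isWeaklyRegular_cons_iff] at hreg
    obtain ⟨hr, hrs⟩ := hreg
    obtain ⟨hvan, ⟨eq⟩⟩ := ih (fun x hx => hmem x (List.mem_cons_of_mem _ hx)) _ hrs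
    have hr𝔪 : r ∈ 𝔪 := hmem r List.mem_cons_self
    have hS := IsSMulRegular.smulShortComplex_shortExact (M := ModuleCat.of R M) hr
    have hvan2 : ∀ i < (r :: rs).length,
        Subsingleton (Abelian.Ext (ModuleCat.of R (R ⧸ 𝔪)) (ModuleCat.of R M) i) := by
      intro i hi
      rw [List.length_cons] at hi
      have h0 : ∀ e : Abelian.Ext (ModuleCat.of R (R ⧸ 𝔪)) (ModuleCat.of R M) i, e = 0 := by
        intro e
        have he := ext_comp_smul_eq_zero 𝔪 M i hr𝔪 e
        rcases Nat.eq_zero_or_pos i with rfl | hpos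
        · have hinj := Abelian.Ext.postcomp_mk₀_injective_of_mono (ModuleCat.of R (R ⧸ 𝔪)) _
            (hf := hS.mono_f)
          exact hinj (he.trans (map_zero _).symm)
        · obtain ⟨x3, hx3⟩ := Abelian.Ext.covariant_sequence_exact₁ _ hS e he
            (n₀ := i - 1) (by omega)
          have := hvan (i - 1) (by omega)
          have h3 : x3 = 0 := Subsingleton.elim (α := Abelian.Ext (ModuleCat.of R (R ⧸ 𝔪))
            (ModuleCat.of R (QuotSMulTop r M)) (i - 1)) _ _
          subst h3
          exact hx3.symm.trans (Abelian.Ext.zero_comp ..)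
      exact ⟨fun a b => by rw [h0 a, h0 b]⟩
    refine ⟨hvan2, ⟨?_⟩⟩
    let δ : Abelian.Ext (ModuleCat.of R (R ⧸ 𝔪)) (ModuleCat.of R (QuotSMulTop r M)) rs.length →ₗ[R]
        Abelian.Ext (ModuleCat.of R (R ⧸ 𝔪)) (ModuleCat.of R M) (rs.length + 1) :=
      (Abelian.Ext.bilinearCompOfLinear R _ _ _ rs.length 1 (rs.length + 1) rfl).flip hS.extClass
    have hδ : Function.Bijective δ := by
      constructor
      · rw [injective_iff_map_eq_zero]
        intro x hx
        obtain ⟨x2, hx2⟩ := Abelian.Ext.covariant_sequence_exact₃ _ hS x rfl hx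
        have := hvan2 rs.length (by simp)
        have h3 : x2 = 0 := Subsingleton.elim (α := Abelian.Ext (ModuleCat.of R (R ⧸ 𝔪))
            (ModuleCat.of R M) rs.length) _ _
        subst h3
        exact hx2.symm.trans (Abelian.Ext.zero_comp ..)
      · intro x
        exact Abelian.Ext.covariant_sequence_exact₁ _ hS x
          (ext_comp_smul_eq_zero 𝔪 M _ hr𝔪 x) rfl
    let e1 : (QuotSMulTop r M ⧸ (Ideal.ofList rs • ⊤ : Submodule R (QuotSMulTop r M))) ≃ₗ[R]
        (M ⧸ (Ideal.ofList (r :: rs) • ⊤ : Submodule R M)) :=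
      (Submodule.quotOfListConsSMulTopEquivQuotSMulTopInner M r rs).symm
    let e2 : ((R ⧸ 𝔪) →ₗ[R] QuotSMulTop r M ⧸
        (Ideal.ofList rs • ⊤ : Submodule R (QuotSMulTop r M))) ≃ₗ[R]
        ((R ⧸ 𝔪) →ₗ[R] M ⧸ (Ideal.ofList (r :: rs) • ⊤ : Submodule R M)) :=
      LinearEquiv.congrRight e1
    exact (LinearEquiv.ofBijective δ hδ).symm.trans (eq.trans e2)

/-- The two descriptions of `Ext`, by derived functors and by the derived category, agree. -/
theorem nonempty_extModule_equiv (A B : Type) [AddCommGroup A] [Module R A] [AddCommGroup B]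
    [Module R B] (p : ℕ) :
    Nonempty (extModule R A B (p + 1) ≃ₗ[R]
      Abelian.Ext (ModuleCat.of R A) (ModuleCat.of R B) (p + 1)) := by
  let P := projectiveResolution (ModuleCat.of R A)
  let K := P.complex.linearYonedaObj R (ModuleCat.of R B)
  let S := K.sc' p (p + 1) (p + 2)
  have i1 : extModule R A B (p + 1) ≃ₗ[R]
      (LinearMap.ker S.g.hom ⧸ LinearMap.range S.moduleCatToCycles) :=
    ((P.isoExt (R := R) (p + 1) (ModuleCat.of R B)).trans
      ((K.homologyIsoSc' p (p + 1) (p + 2) (by simp) (by simp)).trans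
        S.moduleCatHomologyIso)).toLinearEquiv
  have hg : ∀ f : P.complex.X (p + 1) ⟶ ModuleCat.of R B, S.g.hom f =
      P.complex.d (p + 2) (p + 1) ≫ f := fun f => rfl
  have hf : ∀ f : P.complex.X p ⟶ ModuleCat.of R B, S.f.hom f =
      P.complex.d (p + 1) p ≫ f := fun f => rfl
  let F : LinearMap.ker S.g.hom →ₗ[R]
      Abelian.Ext (ModuleCat.of R A) (ModuleCat.of R B) (p + 1) :=
    { toFun := fun f => P.extMk (n := p + 1) (f.1 : P.complex.X (p + 1) ⟶ ModuleCat.of R B)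
        (p + 2) rfl f.2
      map_add' := fun f g => (P.add_extMk _ _ _ _ _ _).symm
      map_smul' := fun r f => by
        refine Eq.trans ?_ (Abelian.Ext.smul_eq_comp_mk₀ _ r).symm
        refine Eq.trans ?_ (P.extMk_comp_mk₀ _ _ _ f.2 _).symm
        congr 1 }
  have hF : Function.Surjective F := by
    intro α
    obtain ⟨f, hf, rfl⟩ := P.extMk_surjective α (p + 2) rfl
    exact ⟨⟨f, hf⟩, rfl⟩
  have hker : LinearMap.range S.moduleCatToCycles = LinearMap.ker F := by
    ext f
    rw [LinearMap.mem_ker, LinearMap.mem_range]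
    refine Iff.trans ?_ (P.extMk_eq_zero_iff (n := p + 1)
      (f.1 : P.complex.X (p + 1) ⟶ ModuleCat.of R B) (p + 2) rfl f.2 p rfl).symm
    constructor
    · rintro ⟨g, rfl⟩
      exact ⟨g, rfl⟩
    · rintro ⟨g, hg⟩
      exact ⟨g, Subtype.ext hg⟩
  have i2 : (LinearMap.ker S.g.hom ⧸ LinearMap.range S.moduleCatToCycles) ≃ₗ[R]
      Abelian.Ext (ModuleCat.of R A) (ModuleCat.of R B) (p + 1) :=
    (Submodule.quotEquivOfEq _ _ hker).trans (F.quotKerEquivOfSurjective hF)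
  exact ⟨i1.trans i2⟩

/-- A Gorenstein ring is a Cohen-Macaulay ring of type one. -/
theorem exists_socle_generator (𝔪 : Ideal R) (h𝔪 : 𝔪 ≠ ⊤) (rs : List R) (hmem : ∀ r ∈ rs, r ∈ 𝔪)
    (hreg : RingTheory.Sequence.IsWeaklyRegular R rs) (hpos : 0 < rs.length)
    (hGor : Nonempty (extModule R (R ⧸ 𝔪) R rs.length ≃ₗ[R] R ⧸ 𝔪)) :
    ∃ σ : R, σ ∉ Ideal.ofList rs ∧ (∀ r ∈ 𝔪, r * σ ∈ Ideal.ofList rs) ∧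
      ∀ y, (∀ r ∈ 𝔪, r * y ∈ Ideal.ofList rs) → ∃ c, y - c * σ ∈ Ideal.ofList rs := by
  obtain ⟨p, hp⟩ : ∃ p, rs.length = p + 1 := ⟨rs.length - 1, by omega⟩
  obtain ⟨-, ⟨e2⟩⟩ := ext_residue_of_isWeaklyRegular 𝔪 rs hmem R hreg
  obtain ⟨e0⟩ := hGor
  rw [hp] at e0 e2
  obtain ⟨e1⟩ := nonempty_extModule_equiv (R := R) (R ⧸ 𝔪) R p
  have htop : (Ideal.ofList rs • ⊤ : Submodule R R) = Ideal.ofList rs := by simp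
  let e3 : (R ⧸ 𝔪) ≃ₗ[R] ((R ⧸ 𝔪) →ₗ[R] R ⧸ (Ideal.ofList rs • ⊤ : Submodule R R)) :=
    e0.symm.trans (e1.trans e2)
  let f := e3 (Submodule.Quotient.mk 1)
  obtain ⟨σ, hσ⟩ := Submodule.Quotient.mk_surjective _ (f (Submodule.Quotient.mk 1))
  have hmk : ∀ x : R, (Submodule.Quotient.mk x : R ⧸ (Ideal.ofList rs • ⊤ : Submodule R R)) = 0 ↔
      x ∈ Ideal.ofList rs := fun x => by
    rw [Submodule.Quotient.mk_eq_zero, htop]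
  have hone : ∀ r : R, (Submodule.Quotient.mk r : R ⧸ 𝔪) = r • Submodule.Quotient.mk 1 :=
    fun r => by rw [← Submodule.Quotient.mk_smul, smul_eq_mul, mul_one]
  have hkill : ∀ r ∈ 𝔪, r • (Submodule.Quotient.mk 1 : R ⧸ 𝔪) = 0 := fun r hr => by
    rw [← hone, Submodule.Quotient.mk_eq_zero]
    exact hr
  refine ⟨σ, fun h => ?_, fun r hr => ?_, fun y hy => ?_⟩
  · have h1 : f = 0 := by
      refine LinearMap.ext fun x => ?_
      obtain ⟨x, rfl⟩ := Submodule.Quotient.mk_surjective _ x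
      rw [hone, _root_.map_smul, ← hσ, (hmk σ).2 h, smul_zero, LinearMap.zero_apply]
    have h2 : (Submodule.Quotient.mk 1 : R ⧸ 𝔪) = 0 := e3.map_eq_zero_iff.1 h1
    rw [Submodule.Quotient.mk_eq_zero] at h2
    exact h𝔪 ((Ideal.eq_top_iff_one _).2 h2)
  · rw [← hmk, ← smul_eq_mul, Submodule.Quotient.mk_smul, hσ, ← map_smul, hkill r hr, map_zero]
  · let g : (R ⧸ 𝔪) →ₗ[R] R ⧸ (Ideal.ofList rs • ⊤ : Submodule R R) :=
      Submodule.liftQ (𝔪 : Submodule R R)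
        (LinearMap.toSpanSingleton R (R ⧸ (Ideal.ofList rs • ⊤ : Submodule R R))
        (Submodule.Quotient.mk y)) (by
        intro r hr
        rw [LinearMap.mem_ker, LinearMap.toSpanSingleton_apply, ← Submodule.Quotient.mk_smul,
          hmk]
        exact hy r hr)
    have hg : g (Submodule.Quotient.mk 1) = Submodule.Quotient.mk y := by
      change Submodule.liftQ 𝔪 _ _ (Submodule.Quotient.mk 1) = _
      rw [Submodule.liftQ_apply, LinearMap.toSpanSingleton_apply, one_smul]
    obtain ⟨c, hc⟩ := Submodule.Quotient.mk_surjective _ (e3.symm g)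
    have hcg : g = c • f := by
      rw [← e3.apply_symm_apply g, ← hc, hone, map_smul]
    refine ⟨c, ?_⟩
    rw [← hmk, Submodule.Quotient.mk_sub, ← smul_eq_mul, Submodule.Quotient.mk_smul, hσ, ← hg,
      hcg, LinearMap.smul_apply, sub_self]

end CanonicalType

/-! ### Linkage over a Gorenstein ring -/

section DoubleColon

variable {R : Type} [CommRing R]

/-- In a local ring with zero-dimensional quotient, the maximal ideal is nilpotent. -/
lemma exists_maximalIdeal_pow_le {A : Type} [CommRing A] [IsLocalRing A] [IsNoetherianRing A]
    (rs : List A) (hmem : ∀ r ∈ rs, r ∈ IsLocalRing.maximalIdeal A)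
    (hreg : RingTheory.Sequence.IsWeaklyRegular A rs) (hdim : ringKrullDim A ≤ rs.length) :
    ∃ N, IsLocalRing.maximalIdeal A ^ N ≤ Ideal.ofList rs := by
  have hle : Ideal.ofList rs ≤ IsLocalRing.maximalIdeal A := Ideal.span_le.2 hmem
  have hr : RingTheory.Sequence.IsRegular A rs := ⟨hreg, fun h => by
    rw [smul_eq_mul, Ideal.mul_top] at h
    exact IsLocalRing.maximalIdeal.isMaximal A |>.ne_top (top_le_iff.1 (h.le.trans hle))⟩
  have h1 := ringKrullDim_add_length_eq_ringKrullDim_of_isRegular rs hr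
  have h2 : ringKrullDim (A ⧸ Ideal.ofList rs) ≤ 0 := by
    rw [← h1] at hdim
    generalize ringKrullDim (A ⧸ Ideal.ofList rs) = x at hdim
    induction x using WithBot.recBotCoe with
    | bot => exact bot_le
    | coe x =>
      induction x using ENat.recTopCoe with
      | top => exact absurd (show (⊤ : ℕ∞) + rs.length ≤ rs.length from mod_cast hdim) (by simp)
      | coe x =>
        have h : x + rs.length ≤ rs.length := by exact_mod_cast hdim
        have h' : x = 0 := by omega
        subst h'
        exact le_rfl
  have h3 : Ring.KrullDimLE 0 (A ⧸ Ideal.ofList rs) := by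
    rw [Ring.krullDimLE_iff]
    exact h2
  have h4 : IsLocalRing.maximalIdeal A ≤ (Ideal.ofList rs).radical := by
    rw [Ideal.radical_eq_sInf]
    refine le_sInf fun p ⟨hp, hpp⟩ => ?_
    have h5 : (p.map (Ideal.Quotient.mk (Ideal.ofList rs))).IsPrime :=
      Ideal.map_isPrime_of_surjective Ideal.Quotient.mk_surjective (by simpa using hp)
    have h6 : (p.map (Ideal.Quotient.mk (Ideal.ofList rs))).IsMaximal :=
      Ideal.isMaximal_of_isPrime _
    have h7 := Ideal.comap_isMaximal_of_surjective (Ideal.Quotient.mk (Ideal.ofList rs))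
      Ideal.Quotient.mk_surjective (K := p.map (Ideal.Quotient.mk (Ideal.ofList rs)))
    rw [Ideal.comap_map_of_surjective _ Ideal.Quotient.mk_surjective] at h7
    have h8 := IsLocalRing.eq_maximalIdeal h7
    rw [← h8]
    refine sup_le le_rfl ?_
    rw [← RingHom.ker_eq_comap_bot, Ideal.mk_ker]
    exact hp
  obtain ⟨N, hN⟩ := Ideal.exists_radical_pow_le_of_fg (Ideal.ofList rs) (IsNoetherian.noetherian _)
  exact ⟨N, (Ideal.pow_right_mono h4 N).trans hN⟩

lemma map_initIdeal {A B : Type} [CommRing A] [CommRing B] (f : A →+* B) (a : ℕ → A) (s : ℕ) :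
    (initIdeal a s).map f = initIdeal (fun i => f (a i)) s := by
  induction s with
  | zero => exact Ideal.map_bot
  | succ s ih => rw [initIdeal, initIdeal, Ideal.map_sup, ih, Ideal.map_span, Set.image_singleton]

lemma initIdeal_eq_ofList_map {A : Type} [CommRing A] (a : ℕ → A) (d : ℕ) :
    initIdeal a d = Ideal.ofList ((List.range d).map a) := by
  have h := initIdeal_eq_ofList ((List.range d).map a) (s := d) (by simp)
  rw [List.take_of_length_le (by simp)] at h
  rw [← h]
  refine initIdeal_congr fun i hi => ?_
  rw [List.getD_eq_getElem _ _ (by simpa using hi)]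
  simp

lemma WReg.isWeaklyRegular {A : Type} [CommRing A] {a : ℕ → A} {d : ℕ} {M : Type}
    [AddCommGroup M] [Module A M] (h : WReg a M d) :
    RingTheory.Sequence.IsWeaklyRegular M ((List.range d).map a) := by
  rw [← wreg_iff_isWeaklyRegular, List.length_map, List.length_range]
  refine h.congr fun i hi => ?_
  rw [List.getD_eq_getElem _ _ (by simpa using hi)]
  simp

lemma exists_pow_mul_mem_initIdeal [IsNoetherianRing R] (𝔪 : Ideal R) [𝔪.IsPrime] {d : ℕ}
    (hdim : ringKrullDim R = (d : WithBot (WithTop ℕ))) (a : ℕ → R) (ha : ∀ i < d, a i ∈ 𝔪)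
    (hreg : WReg a R d) : ∃ N, ∀ r ∈ 𝔪 ^ N, ∃ s ∉ 𝔪, s * r ∈ initIdeal a d := by
  set A := Localization.AtPrime 𝔪
  have hnA : IsNoetherianRing A := IsLocalization.isNoetherianRing 𝔪.primeCompl A inferInstance
  have hreg' : WReg (fun i => algebraMap R A (a i)) A d := hreg.localize 𝔪.primeCompl
  obtain ⟨N, hN⟩ := exists_maximalIdeal_pow_le
    ((List.range d).map fun i => algebraMap R A (a i))
    (by
      intro r hr
      obtain ⟨i, hi, rfl⟩ := List.mem_map.1 hr
      have := ha i (List.mem_range.1 hi)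
      rwa [← IsLocalization.AtPrime.to_map_mem_maximal_iff A 𝔪] at this)
    hreg'.isWeaklyRegular
    (by
      have h := IsLocalization.AtPrime.ringKrullDim_eq_height 𝔪 A
      have h2 : ringKrullDim A ≤ ringKrullDim R := by
        rw [h]
        exact Ideal.height_le_ringKrullDim_of_ne_top (Ideal.IsPrime.ne_top inferInstance)
      rw [hdim] at h2
      rw [List.length_map, List.length_range]
      exact h2)
  refine ⟨N, fun r hr => ?_⟩
  have h1 : algebraMap R A r ∈ (initIdeal a d).map (algebraMap R A) := by
    rw [map_initIdeal, initIdeal_eq_ofList_map]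
    refine hN ?_
    rw [← Localization.AtPrime.map_eq_maximalIdeal, ← Ideal.map_pow]
    exact Ideal.mem_map_of_mem _ hr
  rw [IsLocalization.algebraMap_mem_map_algebraMap_iff 𝔪.primeCompl] at h1
  obtain ⟨s, hs, h⟩ := h1
  exact ⟨s, hs, h⟩

/-- The elements of a ring killed modulo `Q` by an element outside of `𝔪`. -/
def saturation (𝔪 Q : Ideal R) [𝔪.IsPrime] : Ideal R where
  carrier := {r | ∃ s ∉ 𝔪, s * r ∈ Q}
  zero_mem' := ⟨1, fun h => Ideal.IsPrime.ne_top inferInstance ((Ideal.eq_top_iff_one 𝔪).2 h),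
    by simp⟩
  add_mem' := by
    rintro a b ⟨s, hs, ha⟩ ⟨t, ht, hb⟩
    refine ⟨s * t, fun h => (Ideal.IsPrime.mem_or_mem inferInstance h).elim hs ht, ?_⟩
    have : s * t * (a + b) = t * (s * a) + s * (t * b) := by ring
    rw [this]
    exact Q.add_mem (Q.mul_mem_left _ ha) (Q.mul_mem_left _ hb)
  smul_mem' := by
    rintro c a ⟨s, hs, ha⟩
    refine ⟨s, hs, ?_⟩
    have : s * (c • a) = c * (s * a) := by rw [smul_eq_mul]; ring
    rw [this]
    exact Q.mul_mem_left _ ha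

lemma exists_mul_saturation_le [IsNoetherianRing R] (𝔪 Q : Ideal R) [h𝔪 : 𝔪.IsPrime] :
    ∃ s ∉ 𝔪, ∀ r ∈ saturation 𝔪 Q, s * r ∈ Q := by
  obtain ⟨S, hS⟩ := IsNoetherian.noetherian (saturation 𝔪 Q)
  have h : ∀ r ∈ S, ∃ s ∉ 𝔪, s * r ∈ Q := fun r hr => by
    have : r ∈ saturation 𝔪 Q := hS ▸ Submodule.subset_span hr
    exact this
  choose! s hs hsr using h
  classical
  refine ⟨∏ r ∈ S, s r, fun h => ?_, fun r hr => ?_⟩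
  · obtain ⟨r, hr, h⟩ := (Ideal.IsPrime.prod_mem_iff (p := 𝔪)).1 h
    exact hs r hr h
  · rw [← hS] at hr
    induction hr using Submodule.span_induction with
    | mem x hx =>
      rw [← Finset.prod_erase_mul S s hx, mul_assoc]
      exact Q.mul_mem_left _ (hsr x hx)
    | zero => simp
    | add x y _ _ hx hy => rw [mul_add]; exact Q.add_mem hx hy
    | smul c x _ hx => rw [smul_eq_mul, mul_left_comm]; exact Q.mul_mem_left _ hx

/-- The condition `Q : (Q : J) ⊆ J`. -/
def IsDoubleColon (Q J : Ideal R) : Prop :=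
  ∀ w, (∀ z, (∀ j ∈ J, z * j ∈ Q) → w * z ∈ Q) → w ∈ J

lemma IsDoubleColon.sup_span {𝔪 Q J : Ideal R} [h𝔪 : 𝔪.IsMaximal] {σ : R}
    (hσ𝔪 : ∀ r ∈ 𝔪, r * σ ∈ Q)
    (hsoc : ∀ y, (∀ r ∈ 𝔪, r * y ∈ Q) → ∃ c, y - c * σ ∈ Q)
    (hJ : IsDoubleColon Q J) {y : R} (hy : y ∉ J) (hy𝔪 : ∀ r ∈ 𝔪, r * y ∈ J) :
    IsDoubleColon Q (J ⊔ Ideal.span {y}) := by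
  have hsocz : ∀ z, (∀ j ∈ J, z * j ∈ Q) → ∃ c, z * y - c * σ ∈ Q := fun z hz =>
    hsoc _ fun r hr => by
      rw [mul_left_comm]
      exact hz _ (hy𝔪 r hr)
  obtain ⟨u, huJ, huy⟩ : ∃ u, (∀ j ∈ J, u * j ∈ Q) ∧ u * y - σ ∈ Q := by
    by_contra! hcon
    refine hy (hJ y fun z hz => ?_)
    obtain ⟨c, hc⟩ := hsocz z hz
    by_cases hc𝔪 : c ∈ 𝔪
    · have := Q.add_mem hc (hσ𝔪 c hc𝔪)
      rwa [sub_add_cancel, mul_comm] at this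
    · obtain ⟨t, m, hm, htm⟩ := h𝔪.exists_inv hc𝔪
      refine absurd ?_ (hcon (t * z) fun j hj => by
        rw [mul_assoc]
        exact Q.mul_mem_left _ (hz j hj))
      have h1 : t * z * y - σ = t * (z * y - c * σ) - m * σ := by
        linear_combination σ * htm
      rw [h1]
      exact Q.sub_mem (Q.mul_mem_left _ hc) (hσ𝔪 m hm)
  intro w hw
  have hw' : ∀ z, (∀ j ∈ J, z * j ∈ Q) → z * y ∈ Q → w * z ∈ Q := fun z hz hzy => by
    refine hw z fun j hj => ?_
    obtain ⟨j', hj', e, he, rfl⟩ := Submodule.mem_sup.1 hj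
    obtain ⟨b, rfl⟩ := Ideal.mem_span_singleton'.1 he
    rw [mul_add, mul_left_comm]
    exact Q.add_mem (hz j' hj') (Q.mul_mem_left _ hzy)
  obtain ⟨c, hc⟩ := hsoc (w * u) fun r hr => by
    rw [mul_left_comm]
    refine hw' _ (fun j hj => ?_) ?_
    · rw [mul_assoc]
      exact Q.mul_mem_left _ (huJ j hj)
    · rw [mul_assoc, mul_left_comm]
      exact huJ _ (hy𝔪 r hr)
  have h2 : w - c * y ∈ J := by
    refine hJ _ fun z hz => ?_
    obtain ⟨e, he⟩ := hsocz z hz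
    have h3 : w * (z - e * u) ∈ Q := by
      refine hw' _ (fun j hj => ?_) ?_
      · rw [sub_mul, mul_assoc]
        exact Q.sub_mem (hz j hj) (Q.mul_mem_left _ (huJ j hj))
      · have : (z - e * u) * y = (z * y - e * σ) - e * (u * y - σ) := by ring
        rw [this]
        exact Q.sub_mem he (Q.mul_mem_left _ huy)
    have h4 : (w - c * y) * z = w * (z - e * u) + e * (w * u - c * σ) - c * (z * y - e * σ) := by
      ring
    rw [h4]
    exact Q.sub_mem (Q.add_mem h3 (Q.mul_mem_left _ hc)) (Q.mul_mem_left _ he)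
  rw [← sub_add_cancel w (c * y)]
  exact Submodule.add_mem_sup h2 (Ideal.mem_span_singleton'.2 ⟨c, rfl⟩)

/-- Ideals containing a Gorenstein ideal `Q` and a power of `𝔪` are equal to their double colon
with respect to `Q`. -/
theorem isDoubleColon_of_pow_le [IsNoetherianRing R] (𝔪 Q J : Ideal R) [h𝔪 : 𝔪.IsMaximal] (σ : R)
    (hσ𝔪 : ∀ r ∈ 𝔪, r * σ ∈ Q)
    (hsoc : ∀ y, (∀ r ∈ 𝔪, r * y ∈ Q) → ∃ c, y - c * σ ∈ Q)
    {M N : ℕ} (hM : ∀ r ∈ 𝔪 ^ M, ∃ s ∉ 𝔪, s * r ∈ Q) (hQJ : Q ≤ J) (hN : 𝔪 ^ N ≤ J) :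
    IsDoubleColon Q J := by
  have hsat : IsDoubleColon Q (saturation 𝔪 Q) := by
    intro w hw
    obtain ⟨s, hs, h⟩ := exists_mul_saturation_le 𝔪 Q
    exact ⟨s, hs, mul_comm w s ▸ hw s h⟩
  have hle : saturation 𝔪 Q ≤ J := by
    rintro r ⟨s, hs, hsr⟩
    have h1 : IsCoprime (Ideal.span {s}) (𝔪 ^ N) := by
      refine IsCoprime.pow_right ?_
      rw [Ideal.isCoprime_iff_sup_eq, sup_comm]
      by_contra h
      refine hs ?_
      rw [h𝔪.eq_of_le h le_sup_left]
      exact Ideal.mem_sup_right (Ideal.mem_span_singleton_self s)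
    obtain ⟨a, ha, b, hb, hab⟩ := Ideal.isCoprime_iff_exists.1 h1
    obtain ⟨t, rfl⟩ := Ideal.mem_span_singleton'.1 ha
    have h2 : r = t * (s * r) + b * r := by linear_combination (-r) * hab
    rw [h2]
    exact J.add_mem (J.mul_mem_left _ (hQJ hsr)) (J.mul_mem_right _ (hN hb))
  obtain ⟨J', ⟨hJ1, hJ2, hJ3⟩, hmax⟩ := set_has_maximal_iff_noetherian.2 ‹IsNoetherianRing R›
    {J' : Ideal R | saturation 𝔪 Q ≤ J' ∧ J' ≤ J ∧ IsDoubleColon Q J'}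
    ⟨_, le_rfl, hle, hsat⟩
  rcases hJ2.eq_or_lt with rfl | hlt
  · exact hJ3
  exfalso
  obtain ⟨y, hyJ, hyJ'⟩ := SetLike.exists_of_lt hlt
  have hex : ∃ k, ∀ r ∈ 𝔪 ^ k, r * y ∈ J' :=
    ⟨M, fun r hr => Ideal.mul_mem_right _ J' (hJ1 (hM r hr))⟩
  classical
  have hk0 : Nat.find hex ≠ 0 := fun h => by
    have := Nat.find_spec hex
    rw [h] at this
    exact hyJ' (by simpa using this 1 (by simp))
  obtain ⟨k, hk⟩ := Nat.exists_eq_succ_of_ne_zero hk0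
  have h1 := Nat.find_min hex (m := k) (by omega)
  push Not at h1
  obtain ⟨r, hr, hry⟩ := h1
  have h2 := Nat.find_spec hex
  rw [hk] at h2
  refine hmax (J' ⊔ Ideal.span {r * y}) ⟨hJ1.trans le_sup_left, sup_le hJ2 ?_,
    hJ3.sup_span hσ𝔪 hsoc hry fun m hm => ?_⟩ ?_
  · rw [Ideal.span_singleton_le_iff_mem]
    exact J.mul_mem_left _ hyJ
  · rw [← mul_assoc]
    exact h2 _ (by rw [Nat.succ_eq_add_one, pow_succ']; exact Ideal.mul_mem_mul hm hr)
  · exact lt_of_le_of_ne le_sup_left fun h => hry (h ▸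
      Ideal.mem_sup_right (Ideal.mem_span_singleton_self _))

end DoubleColon

/-! ### Torsion and the top of the complex -/

section Top

set_option linter.unusedSectionVars false

open MvPolynomial

variable {ι : Type} [Fintype ι] [LinearOrder ι] {R : Type} [CommRing R] {φ : Matrix ι ι R}

/-- The scalar determining an element of the last module of the complex. -/
def topC {q : ℕ} (y : EE ι R q (q + 1)) : R := coeff 0 ((y : Finset ι → MvPolynomial ι R) ∅)

lemma eq_C_topC {q : ℕ} (y : EE ι R q (q + 1)) :
    (y : Finset ι → MvPolynomial ι R) ∅ = C (topC y) := by
  have h := y.2.1 ∅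
  rw [show q - (q + 1) = 0 by omega] at h
  rw [topC, ← homogeneousComponent_zero]
  exact (homogeneousComponent_eq_self h).symm

lemma topC_smul {q : ℕ} (r : R) (y : EE ι R q (q + 1)) : topC (r • y) = r * topC y := by
  simp [topC]

lemma eq_zero_of_ne_empty {q : ℕ} (y : EE ι R q (q + 1)) {B : Finset ι} (hB : B ≠ ∅) :
    (y : Finset ι → MvPolynomial ι R) B = 0 :=
  y.2.2 B (by rintro (⟨h, _⟩ | ⟨_, h⟩); exacts [by omega, hB h])

lemma mem_initSub_top {q : ℕ} {a : ℕ → R} {s : ℕ} {y : EE ι R q (q + 1)} :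
    y ∈ initSub a (EE ι R q (q + 1)) s ↔ topC y ∈ initIdeal a s := by
  rw [mem_initSub_EE]
  refine ⟨fun h => h ∅ 0, fun h B m => ?_⟩
  by_cases hB : B = ∅
  · subst hB
    rw [eq_C_topC, coeff_C]
    split_ifs
    exacts [h, zero_mem _]
  · rw [eq_zero_of_ne_empty y hB, coeff_zero]
    exact zero_mem _

/-- The element of the last module of the complex given by a scalar. -/
def topE (ι : Type) [Fintype ι] [LinearOrder ι] {R : Type} [CommRing R] (q : ℕ) (c : R) :
    EE ι R q (q + 1) :=
  ⟨fun B => if B = ∅ then C c else 0, mem_EE.2 ⟨fun B => by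
    rw [show q - (q + 1) = 0 by omega]
    split_ifs
    exacts [isHomogeneous_C ι c, isHomogeneous_zero _ _ _], fun B hB => if_neg fun h =>
      hB (Or.inr ⟨rfl, h⟩)⟩⟩

lemma topC_topE (q : ℕ) (c : R) : topC (topE ι q c) = c := by
  simp [topC, topE]

lemma dE_top_mem_initSub (h0 : ∀ i, φ i i = 0) (h1 : ∀ i j, φ j i = - φ i j)
    (hn : Odd (Fintype.card ι)) {q : ℕ} (hq : Odd q) {a : ℕ → R} {s : ℕ}
    {y : EE ι R q (q + 1)} :
    dE φ q q y ∈ initSub a (EE ι R q q) s ↔ ∀ j ∈ vacIdeal φ q, topC y * j ∈ initIdeal a s := by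
  have hco : ∀ B m, coeff m ((dE φ q q y : Finset ι → MvPolynomial ι R) B) =
      if B.card ≤ q ∧ Even (B.card + q) ∧ m = 0 then topC y * vac φ B else 0 := by
    intro B m
    by_cases hB : B.card ≤ q ∧ Even (B.card + q)
    · rw [dE_coe, dW_self φ _ hB.1 hB.2, eq_C_topC, Om, ← C_mul, coeff_C]
      simp [hB.1, hB.2, eq_comm]
    · rw [if_neg (fun h => hB ⟨h.1, h.2.1⟩), (dE φ q q y).2.2 B, coeff_zero]
      rintro (⟨_, h2⟩ | ⟨h2, _⟩); exacts [hB h2, by omega]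
  rw [mem_initSub_EE]
  constructor
  · intro h j hj
    have : vacIdeal φ q ≤ (initIdeal a s).colon {topC y} := by
      refine Ideal.span_le.2 ?_
      rintro _ ⟨B, hB, rfl⟩
      rw [SetLike.mem_coe, Submodule.mem_colon_singleton, smul_eq_mul, mul_comm]
      by_cases hB' : Even (B.card + q)
      · have := h B 0
        rwa [hco, if_pos ⟨hB, hB', rfl⟩] at this
      · rw [vac_parity h0 h1, mul_zero]
        · exact zero_mem _
        · have h2 := Finset.card_add_card_compl B
          rw [← Nat.not_even_iff_odd]
          intro h
          rw [← h2, Nat.odd_add] at hn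
          exact hB' ((hn.2 h).add_odd hq)
    have := this hj
    rwa [Submodule.mem_colon_singleton, smul_eq_mul, mul_comm] at this
  · intro h B m
    rw [hco]
    split_ifs with hB
    · exact h _ (vac_mem_vacIdeal φ hB.1)
    · exact zero_mem _

/-- Lifting a torsion element to the top of the complex. -/
lemma exists_chain_top (h0 : ∀ i, φ i i = 0) (h1 : ∀ i j, φ j i = - φ i j)
    (hn : Odd (Fintype.card ι)) {q : ℕ} (hq : Odd q) (hex : ∀ i, ExE φ q i)
    {a : ℕ → R} (ha : WReg a R (q + 1)) (m : EE ι R q 0)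
    (hm : ∀ i < q + 1, a i • m ∈ LinearMap.range (dE φ q 0)) :
    ∃ w : ∀ t, EE ι R q t, w 0 = m ∧
      Chain (E := fun t => EE ι R q t) (dE φ q) a (q + 1) w ∧
      ∀ j ∈ vacIdeal φ q, topC (w (q + 1)) * j ∈ initIdeal a (q + 1) := by
  obtain ⟨w, h, hw⟩ := exists_chain (E := fun t => EE ι R q t) (d := dE φ q) (a := a) (q + 1)
    (fun i hi => exactMod_of_exactAt (dE_dE h0 h1 q) (ha.EE q) i (by omega) i le_rfl
      (fun j _ _ => hex j)) m hm
  refine ⟨w, h, hw, (dE_top_mem_initSub h0 h1 hn hq).1 ?_⟩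
  have h2 := initSub_mono a (Nat.le_succ q) (hw q (Nat.lt_succ_self q))
  have h3 : a q • w q ∈ initSub a (EE ι R q q) (q + 1) := smul_mem_initSub a (Nat.lt_succ_self q) _
  have := sub_mem h3 h2
  rwa [sub_sub_cancel] at this

lemma Chain.mem_range_of_top (h0 : ∀ i, φ i i = 0) (h1 : ∀ i j, φ j i = - φ i j) {q : ℕ}
    {a : ℕ → R} (ha : WReg a R (q + 1)) {w : ∀ t, EE ι R q t}
    (hw : Chain (E := fun t => EE ι R q t) (dE φ q) a (q + 1) w)
    (hr : topC (w (q + 1)) ∈ initIdeal a (q + 1)) : w 0 ∈ LinearMap.range (dE φ q 0) :=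
  Chain.mem_range_of_last (dE_dE h0 h1 q) hw (ha.EE q)
    (Submodule.mem_sup_right (mem_initSub_top.2 hr))

/-- Elements of the Pfaffian ideal annihilate the torsion. -/
theorem smul_mem_range_of_mem_vacIdeal (h0 : ∀ i, φ i i = 0) (h1 : ∀ i j, φ j i = - φ i j)
    (hn : Odd (Fintype.card ι)) {q : ℕ} (hq : Odd q) (hex : ∀ i, ExE φ q i)
    {a : ℕ → R} (ha : WReg a R (q + 1)) (m : EE ι R q 0)
    (hm : ∀ i < q + 1, a i • m ∈ LinearMap.range (dE φ q 0)) {r : R} (hr : r ∈ vacIdeal φ q) :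
    r • m ∈ LinearMap.range (dE φ q 0) := by
  obtain ⟨w, rfl, hw, h⟩ := exists_chain_top h0 h1 hn hq hex ha m hm
  refine (hw.smul r).mem_range_of_top h0 h1 ha ?_
  rw [topC_smul, mul_comm]
  exact h r hr

/-- The annihilator of the torsion lies in the Pfaffian ideal. -/
theorem mem_vacIdeal_of_smul_mem_range (h0 : ∀ i, φ i i = 0) (h1 : ∀ i j, φ j i = - φ i j)
    (hn : Odd (Fintype.card ι)) {q : ℕ} (hq : Odd q) (hex : ∀ i, ExE φ q i)
    {a : ℕ → R} (ha : WReg a R (q + 1))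
    (hJ : IsDoubleColon (initIdeal a (q + 1)) (vacIdeal φ q)) (r : R)
    (hr : ∀ m : EE ι R q 0, (∀ s ∈ vacIdeal φ q, s • m ∈ LinearMap.range (dE φ q 0)) →
      r • m ∈ LinearMap.range (dE φ q 0)) : r ∈ vacIdeal φ q := by
  refine hJ r fun z hz => ?_
  obtain ⟨w, hy, hw⟩ := exists_chain_of_last (E := fun t => EE ι R q t) (d := dE φ q) (a := a)
    (dE_dE h0 h1 q) (ha.EE q) (topE ι q z)
    ((dE_top_mem_initSub h0 h1 hn hq).2 fun j hj => by
      rw [topC_topE]; exact hz j hj)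
  have h2 : r • w 0 ∈ LinearMap.range (dE φ q 0) := hr _ fun s hs => by
    refine (hw.smul s).mem_range_of_top h0 h1 ha ?_
    rw [hy, topC_smul, topC_topE, mul_comm]
    exact hz s hs
  have h3 := (hw.smul r).last_mem (fun i hi => exactMod_of_exactAt (dE_dE h0 h1 q) (ha.EE q) i
    (by omega) i le_rfl (fun j _ _ => hex j)) h2
  obtain ⟨_, ⟨u, rfl⟩, v, hv, huv⟩ := Submodule.mem_sup.1 h3
  rw [EE_eq_zero le_rfl u, map_zero, zero_add] at huv
  rw [huv, mem_initSub_top, hy, topC_smul, topC_topE] at hv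
  exact hv

end Top

/-! ### The annihilator of the torsion -/

section Annihilator

set_option linter.unusedSectionVars false

variable {R : Type} [CommRing R] {𝒜 : ℤ → AddSubgroup R} [GradedRing 𝒜]

/-- A sequence of parameters of length `d` in every power of the maximal homogeneous ideal. -/
lemma exists_wreg_of_depthGE [IsNoetherianRing R] (𝔪 : Ideal R) (hm : 𝔪 ≠ ⊤) {d : ℕ}
    (hCM : depthGE 𝔪 R d) (t : ℕ) : ∃ a : ℕ → R, (∀ i < d, a i ∈ 𝔪 ^ t) ∧ WReg a R d := by
  rcases hCM with h | ⟨rs, rfl, hmem, hreg⟩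
  · exact absurd (Subsingleton.elim _ _) hm
  · exact exists_wreg_pow 𝔪 hm rs hmem hreg t

variable [IsNoetherianRing R] [IsLocalRing (𝒜 0)] {q n : ℕ} {φ : Matrix (Fin n) (Fin n) R}

/-- The complexes resolving the symmetric powers are exact. -/
lemma exactAt_dE_of_height (hneg : ∀ i : ℤ, i < 0 → 𝒜 i = ⊥) (hdn : q + 1 ≤ n) (hnodd : Odd n)
    (hq : Odd q) (hdim : ringKrullDim R = ((q + 1 : ℕ) : WithBot (WithTop ℕ)))
    (hCM : depthGE (maxHomIdeal 𝒜) R (q + 1)) (h0 : ∀ i, φ i i = 0)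
    (h1 : ∀ i j, φ j i = - φ i j) (hlin : ∀ i j, φ i j ∈ 𝒜 1)
    (hF : ∀ i : ℕ, (n : ℤ) - (q + 1 : ℕ) ≤ i → (i : ℤ) ≤ (n : ℤ) - 1 →
      ((n - i : ℕ) : ℕ∞) ≤ idealHeight (minorsIdeal n i φ)) (i : ℕ) : ExE φ q i := by
  have hmax := maxHomIdeal_isMaximal (𝒜 := 𝒜) hneg
  have hprime := hmax.isPrime
  obtain ⟨x, hx, hreg⟩ := exists_wreg_of_depthGE _ hmax.ne_top hCM 1
  rw [pow_one] at hx
  have hodd : Odd (Fintype.card (Fin n)) := by rwa [Fintype.card_fin]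
  refine exactAt_dE_of_localization h0 h1 hlin hneg hodd hq i ?_
  exact exactAt_dE _ (map_diag _ h0) (map_skew _ h1) hodd hq
    (vacDepth_of_height _ (by omega) hdn hnodd hq.add_one hdim x hx hreg φ h0 h1 hF) i

lemma linE_mem_range_of_height (hneg : ∀ i : ℤ, i < 0 → 𝒜 i = ⊥) (hd : 3 ≤ q + 1)
    (hdn : q + 1 ≤ n) (hnodd : Odd n)
    (hq : Odd q) (hdim : ringKrullDim R = ((q + 1 : ℕ) : WithBot (WithTop ℕ)))
    (hCM : depthGE (maxHomIdeal 𝒜) R (q + 1)) (h0 : ∀ i, φ i i = 0)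
    (h1 : ∀ i j, φ j i = - φ i j) (hlin : ∀ i j, φ i j ∈ 𝒜 1)
    (hht : 3 ≤ idealHeight (vacIdeal φ 1))
    (hF : ∀ i : ℕ, (n : ℤ) - (q + 1 : ℕ) ≤ i → (i : ℤ) ≤ (n : ℤ) - 1 →
      ((n - i : ℕ) : ℕ∞) ≤ idealHeight (minorsIdeal n i φ)) (v : Fin n → R)
    (hv : ∑ j, v j * vac φ {j} = 0) : linE v ∈ LinearMap.range (dE φ 1 0) := by
  have hmax := maxHomIdeal_isMaximal (𝒜 := 𝒜) hneg
  have hprime := hmax.isPrime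
  obtain ⟨x, hx, hreg⟩ := exists_wreg_of_depthGE _ hmax.ne_top hCM 1
  rw [pow_one] at hx
  have hodd : Odd (Fintype.card (Fin n)) := by rwa [Fintype.card_fin]
  obtain ⟨a, ha, hareg⟩ := exists_wreg_vacIdeal_localization (maxHomIdeal 𝒜) hdim x hx hreg φ h0 h1
    (k := 3) (q := 1) hd (by exact_mod_cast hht)
  exact linE_mem_range_of_localization h0 h1 hlin hneg hodd
    ((vacDepth_of_height _ (by omega) hdn hnodd hq.add_one hdim x hx hreg φ h0 h1 hF).mono hq.pos)
    a ha hareg v hv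

/-- The annihilator of the torsion of the symmetric power. -/
theorem annihilator_torsion (hneg : ∀ i : ℤ, i < 0 → 𝒜 i = ⊥) (hd : 3 ≤ q + 1)
    (hdn : q + 1 ≤ n) (hnodd : Odd n)
    (hq : Odd q) (hdim : ringKrullDim R = ((q + 1 : ℕ) : WithBot (WithTop ℕ)))
    (hCM : depthGE (maxHomIdeal 𝒜) R (q + 1))
    (hGor : Nonempty (extModule R (R ⧸ maxHomIdeal 𝒜) R (q + 1) ≃ₗ[R] R ⧸ maxHomIdeal 𝒜))
    (h0 : ∀ i, φ i i = 0)
    (h1 : ∀ i j, φ j i = - φ i j) (hlin : ∀ i j, φ i j ∈ 𝒜 1)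
    (hht : 3 ≤ idealHeight (vacIdeal φ 1))
    (hF : ∀ i : ℕ, (n : ℤ) - (q + 1 : ℕ) ≤ i → (i : ℤ) ≤ (n : ℤ) - 1 →
      ((n - i : ℕ) : ℕ∞) ≤ idealHeight (minorsIdeal n i φ)) {I : Ideal R}
    (hI : I = vacIdeal φ 1) :
    Module.annihilator R ↥(torsionSubmodule (maxHomIdeal 𝒜) (SymPow (R := R) ↥I q)) =
      vacIdeal φ q := by
  have hmax := maxHomIdeal_isMaximal (𝒜 := 𝒜) hneg
  have hprime := hmax.isPrime
  have hodd : Odd (Fintype.card (Fin n)) := by rwa [Fintype.card_fin]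
  have hex := exactAt_dE_of_height hneg hdn hnodd hq hdim hCM h0 h1 hlin hF
  have hpres := linE_mem_range_of_height hneg hd hdn hnodd hq hdim hCM h0 h1 hlin hht hF
  ext r
  rw [mem_annihilator_torsion_iff h0 h1 hodd hq hpres hI]
  constructor
  · intro h
    obtain ⟨N, hN⟩ := exists_maxHomIdeal_pow_le hneg hdim _ (vacIdeal_isHomogeneous h0 h1 hlin q)
      (le_idealHeight_vacIdeal (by omega) hdn hnodd hq.add_one φ h0 h1 hF)
    obtain ⟨a, ha, hreg⟩ := exists_wreg_of_depthGE _ hmax.ne_top hCM (N + 1)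
    have ham : ∀ i < q + 1, a i ∈ maxHomIdeal 𝒜 := fun i hi =>
      Ideal.pow_le_self (Nat.succ_ne_zero N) (ha i hi)
    have hlen : ((List.range (q + 1)).map a).length = q + 1 := by simp
    obtain ⟨σ, -, hσ, hsoc⟩ := exists_socle_generator (maxHomIdeal 𝒜) hmax.ne_top
      ((List.range (q + 1)).map a) (by
        intro r hr
        obtain ⟨i, hi, rfl⟩ := List.mem_map.1 hr
        exact ham i (List.mem_range.1 hi)) hreg.isWeaklyRegular (by omega) (by rwa [hlen])
    rw [← initIdeal_eq_ofList_map] at hσ hsoc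
    obtain ⟨M, hM⟩ := exists_pow_mul_mem_initIdeal (maxHomIdeal 𝒜) hdim a ham hreg
    have hQJ : initIdeal a (q + 1) ≤ vacIdeal φ q :=
      initIdeal_le a fun i hi => hN (Ideal.pow_le_pow_right (Nat.le_succ N) (ha i hi))
    exact mem_vacIdeal_of_smul_mem_range h0 h1 hodd hq hex hreg
      (isDoubleColon_of_pow_le (maxHomIdeal 𝒜) _ _ σ hσ hsoc hM hQJ hN) r
      fun m hm => h m ⟨N, fun s hs => hm s (hN hs)⟩
  · rintro hr m ⟨t, ht⟩
    obtain ⟨a, ha, hreg⟩ := exists_wreg_of_depthGE _ hmax.ne_top hCM t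
    exact smul_mem_range_of_mem_vacIdeal h0 h1 hodd hq hex hreg m (fun i hi => ht _ (ha i hi)) hr

end Annihilator

/-! ### Powers of an ideal of linear forms annihilate the torsion -/

section LinearForms

set_option linter.unusedSectionVars false

open MvPolynomial

variable {R : Type} [CommRing R] {𝒜 : ℤ → AddSubgroup R} [GradedRing 𝒜]
  {M : Type} [AddCommGroup M] [Module R M]

lemma HomProj.pr_mem_initSub (G : HomProj 𝒜 M) {a : ℕ → R} {s : ℕ} (ha : ∀ i < s, a i ∈ 𝒜 1)
    {y : M} (hy : y ∈ initSub a M s) (c : ℤ) : G.pr c y ∈ initSub a M s := by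
  induction s generalizing y c with
  | zero =>
    rw [initSub_zero, Submodule.mem_bot] at hy ⊢
    rw [hy, map_zero]
  | succ s ih =>
    obtain ⟨v, hv⟩ := mem_initSub_succ.1 hy
    refine mem_initSub_succ.2 ⟨G.pr (c - 1) v, ?_⟩
    have := ih (fun i hi => ha i (by omega)) hv c
    rwa [map_sub, G.pr_smul (ha s (by omega))] at this

lemma HomProj.pr_eq_zero_of_mem_pow (G : HomProj 𝒜 M) (hG : ∀ c < 0, ∀ m, G.pr c m = 0)
    {S : Set R} (hS : ∀ x ∈ S, x ∈ 𝒜 1) (k : ℕ) {m : M}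
    (hm : m ∈ (Ideal.span S ^ k • ⊤ : Submodule R M)) {c : ℤ} (hc : c < k) : G.pr c m = 0 := by
  induction k generalizing m c with
  | zero => exact hG c (by simpa using hc) m
  | succ k ih =>
    rw [pow_succ', Submodule.mul_smul] at hm
    refine Submodule.smul_induction_on hm (fun r hr n hn => ?_) fun x y hx hy => by
      rw [map_add, hx, hy, add_zero]
    induction hr using Submodule.span_induction generalizing n with
    | mem x hx => rw [G.pr_smul (hS x hx), ih hn (by push_cast at hc; omega), smul_zero]
    | zero => rw [zero_smul, map_zero]
    | add x y _ _ hx hy => rw [add_smul, map_add, hx n hn, hy n hn, add_zero]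
    | smul f x _ hx =>
      rw [smul_eq_mul, mul_comm, mul_smul]
      exact hx _ (Submodule.smul_mem _ f hn)

variable {ι : Type} [Fintype ι] [LinearOrder ι] {φ : Matrix ι ι R}

lemma EE_pr_eq_zero (hneg : ∀ i : ℤ, i < 0 → 𝒜 i = ⊥) (q t : ℕ) {c : ℤ} (hc : c < 0)
    (m : EE ι R q t) : (HomProj.EE 𝒜 q t).pr c m = 0 := by
  ext1; funext B
  rw [HomProj.EE_apply]
  ext u
  rw [coeff_prP, proj_neg hneg]
  · rfl
  · unfold wt
    split_ifs <;> omega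

lemma pr_mem_range_of_smul_mem_range (h0 : ∀ i, φ i i = 0)
    (h1 : ∀ i j, φ j i = - φ i j)
    (hlin : ∀ i j, φ i j ∈ 𝒜 1) (hn : Odd (Fintype.card ι)) {q : ℕ} (hq : Odd q)
    (hex : ∀ i, ExE φ q i) {a : ℕ → R} (ha : ∀ i < q + 1, a i ∈ 𝒜 1) (hreg : WReg a R (q + 1))
    (hgen : ∀ k : ℤ, 0 < k → ∀ r ∈ 𝒜 k, r ∈ initIdeal a (q + 1)) (m : EE ι R q 0)
    (hm : ∀ i < q + 1, a i • m ∈ LinearMap.range (dE φ q 0)) {c : ℤ}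
    (hc : (Fintype.card ι : ℤ) < q + 2 * c + 2) :
    (HomProj.EE 𝒜 q 0).pr c m ∈ LinearMap.range (dE φ q 0) := by
  obtain ⟨w, rfl, hw, -⟩ := exists_chain_top h0 h1 hn hq hex hreg m hm
  have key : Chain (E := fun t => EE ι R q t) (dE φ q) a (q + 1)
      (fun t => (HomProj.EE 𝒜 q t).pr (c + t) (w t)) := by
    intro i hi
    have := (HomProj.EE 𝒜 q i).pr_mem_initSub (fun j hj => ha j (by omega)) (hw i hi)
      (c + (i + 1 : ℕ))
    rw [map_sub, HomProj.pr_smul _ (ha i hi), ← dE_pr h0 h1 hlin hn hq] at this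
    convert this using 5
    push_cast; ring
  have h2 := key.mem_range_of_top h0 h1 hreg ?_
  · simpa using h2
  · refine hgen (c + (q + 1 : ℕ) - wt ι q (q + 1) ∅) ?_ _ ?_
    · rw [wt, if_neg (by omega)]
      omega
    · rw [topC, HomProj.EE_apply, coeff_prP]
      exact proj_mem 𝒜 _ _

/-- Powers of an ideal of linear forms annihilate the torsion. -/
theorem smul_mem_range_of_mem_pow (hneg : ∀ i : ℤ, i < 0 → 𝒜 i = ⊥) (h0 : ∀ i, φ i i = 0)
    (h1 : ∀ i j, φ j i = - φ i j)
    (hlin : ∀ i j, φ i j ∈ 𝒜 1) (hn : Odd (Fintype.card ι)) {q : ℕ} (hq : Odd q)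
    (hex : ∀ i, ExE φ q i) {a : ℕ → R} (ha : ∀ i < q + 1, a i ∈ 𝒜 1) (hreg : WReg a R (q + 1))
    (hgen : ∀ k : ℤ, 0 < k → ∀ r ∈ 𝒜 k, r ∈ initIdeal a (q + 1)) (m : EE ι R q 0) {t : ℕ}
    (hm : ∀ s ∈ initIdeal a (q + 1) ^ t, s • m ∈ LinearMap.range (dE φ q 0)) {r : R} {k : ℕ}
    (hk : Fintype.card ι ≤ q + 2 * k) (hr : r ∈ initIdeal a (q + 1) ^ k) :
    r • m ∈ LinearMap.range (dE φ q 0) := by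
  set F : Submodule R (EE ι R q 0) := initIdeal a (q + 1) ^ k • ⊤ with hF
  have hFz : ∀ n ∈ F, ∀ c : ℤ, c < k → (HomProj.EE 𝒜 q 0).pr c n = 0 := by
    intro n hn c hc
    refine (HomProj.EE 𝒜 q 0).pr_eq_zero_of_mem_pow
      (fun c hc m => EE_pr_eq_zero hneg q 0 hc m)
      (S := {r | r ∈ (List.range (q + 1)).map a}) (fun x hx => ?_) k ?_ hc
    · obtain ⟨i, hi, rfl⟩ := List.mem_map.1 hx
      exact ha i (List.mem_range.1 hi)
    · rw [hF, initIdeal_eq_ofList_map] at hn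
      exact hn
  refine mem_of_pow_smul_mem (M := F) ((LinearMap.range (dE φ q 0)).comap F.subtype) a (q + 1)
    ?_ ⟨r • m, Submodule.smul_mem_smul hr trivial⟩ ?_
  · rintro ⟨n, hnF⟩ hn'
    refine (HomProj.EE 𝒜 q 0).mem_of_pr_mem (LinearMap.range (dE φ q 0)).toAddSubgroup n
      fun c => ?_
    rcases lt_or_ge c k with hc | hc
    · rw [hFz n hnF c hc]
      exact zero_mem _
    · exact pr_mem_range_of_smul_mem_range h0 h1 hlin hn hq hex ha hreg hgen n
        (fun i hi => hn' i hi) (by omega)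
  · intro i hi
    refine ⟨t, ?_⟩
    change a i ^ t • r • m ∈ LinearMap.range (dE φ q 0)
    rw [smul_comm]
    exact Submodule.smul_mem _ r (hm _ (Ideal.pow_mem_pow (mem_initIdeal a hi) t))

end LinearForms

/-! ### Standard graded polynomial rings -/

section PolynomialRing

open MvPolynomial

/-- A finite family, extended by zero to a sequence. -/
def extendZero {A : Type} [Zero A] {d : ℕ} (x : Fin d → A) (i : ℕ) : A :=
  if h : i < d then x ⟨i, h⟩ else 0

lemma initIdeal_extendZero {A : Type} [CommRing A] {d : ℕ} (x : Fin d → A) {s : ℕ} (hs : s ≤ d) :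
    initIdeal (extendZero x) s = Ideal.span (x '' {i | (i : ℕ) < s}) := by
  apply le_antisymm
  · refine initIdeal_le _ fun i hi => Ideal.subset_span ⟨⟨i, by omega⟩, hi, ?_⟩
    rw [extendZero, dif_pos]
  · refine Ideal.span_le.2 ?_
    rintro _ ⟨i, hi, rfl⟩
    have := mem_initIdeal (extendZero x) (show (i : ℕ) < s from hi)
    rwa [extendZero, dif_pos i.2] at this

/-- The variables of a polynomial ring form a regular sequence. -/
lemma wreg_X (A : Type) [CommRing A] (d : ℕ) :
    WReg (extendZero (X : Fin d → MvPolynomial (Fin d) A)) (MvPolynomial (Fin d) A) d := by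
  intro s hs y hy
  rw [mem_initSub_self, initIdeal_extendZero _ hs.le, mem_ideal_span_X_image] at hy ⊢
  rw [extendZero, dif_pos hs, smul_eq_mul] at hy
  intro m hm
  obtain ⟨i, hi, h⟩ := hy (Finsupp.single ⟨s, hs⟩ 1 + m) (by
    rw [mem_support_iff, coeff_X_mul]
    exact mem_support_iff.1 hm)
  refine ⟨i, hi, fun h' => h ?_⟩
  have : (⟨s, hs⟩ : Fin d) ≠ i := fun h => by
    subst h
    exact lt_irrefl s hi
  rw [Finsupp.add_apply, h', Finsupp.single_eq_of_ne' this]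

lemma WReg.map_equiv {A B : Type} [CommRing A] [CommRing B] (e : A ≃+* B) {a : ℕ → A} {d : ℕ}
    (h : WReg a A d) : WReg (fun i => e (a i)) B d := by
  intro s hs y hy
  obtain ⟨y, rfl⟩ := e.surjective y
  have hmap := map_initIdeal (e : A →+* B) a s
  simp only [RingEquiv.coe_toRingHom] at hmap
  have key : ∀ z, e z ∈ initIdeal (fun i => e (a i)) s ↔ z ∈ initIdeal a s := by
    intro z
    rw [← hmap]
    refine ⟨fun h => ?_, fun h => Ideal.mem_map_of_mem (e : A →+* B) h⟩
    obtain ⟨z', hz', h'⟩ := (Ideal.mem_map_of_equiv e _).1 h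
    rwa [← e.injective h']
  rw [mem_initSub_self, smul_eq_mul, ← map_mul, key] at hy
  rw [mem_initSub_self, key]
  exact mem_initSub_self.1 (h s hs y (mem_initSub_self.2 hy))

variable {R : Type} [CommRing R] {𝒜 : ℤ → AddSubgroup R} [GradedRing 𝒜] {d : ℕ} {x : Fin d → R}

lemma wreg_extendZero
    (hbij : Function.Bijective (eval₂Hom (SetLike.GradeZero.subring 𝒜).subtype x)) :
    WReg (extendZero x) R d := by
  have h := (wreg_X (SetLike.GradeZero.subring 𝒜) d).map_equiv (RingEquiv.ofBijective _ hbij)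
  convert h using 2 with i
  unfold extendZero
  split_ifs with hi
  · exact (eval₂Hom_X' _ _ _).symm
  · exact (map_zero _).symm

lemma maxHomIdeal_eq_initIdeal (hneg : ∀ i : ℤ, i < 0 → 𝒜 i = ⊥) [IsLocalRing (𝒜 0)]
    (hx : ∀ i, x i ∈ 𝒜 1)
    (hbij : Function.Bijective (eval₂Hom (SetLike.GradeZero.subring 𝒜).subtype x))
    (hfield : IsField (𝒜 0)) : maxHomIdeal 𝒜 = initIdeal (extendZero x) d := by
  have hle : initIdeal (extendZero x) d ≤ maxHomIdeal 𝒜 := initIdeal_le _ fun i hi => by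
    rw [extendZero, dif_pos hi]
    exact mem_maxHomIdeal_of_ne one_ne_zero (hx _)
  refine le_antisymm (fun r hr => ?_) hle
  have key : ∀ p : MvPolynomial (Fin d) (SetLike.GradeZero.subring 𝒜), ∃ c ∈ 𝒜 0,
      eval₂Hom (SetLike.GradeZero.subring 𝒜).subtype x p - c ∈ initIdeal (extendZero x) d := by
    intro p
    induction p using MvPolynomial.induction_on with
    | C a => exact ⟨a, a.2, by simp⟩
    | add p q hp hq =>
      obtain ⟨c, hc, hp⟩ := hp
      obtain ⟨e, he, hq⟩ := hq
      refine ⟨c + e, add_mem hc he, ?_⟩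
      rw [map_add, add_sub_add_comm]
      exact add_mem hp hq
    | mul_X p i _ =>
      refine ⟨0, zero_mem _, ?_⟩
      rw [sub_zero, map_mul, eval₂Hom_X']
      have := mem_initIdeal (extendZero x) i.2
      rw [extendZero, dif_pos i.2] at this
      exact Ideal.mul_mem_left _ _ this
  obtain ⟨p, rfl⟩ := hbij.2 r
  obtain ⟨c, hc, hp⟩ := key p
  have hcm : c ∈ maxHomIdeal 𝒜 := by
    have := sub_mem hr (hle hp)
    rwa [sub_sub_cancel] at this
  rcases eq_or_ne c 0 with rfl | hc0
  · rwa [sub_zero] at hp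
  · obtain ⟨b, hb⟩ := hfield.mul_inv_cancel (a := ⟨c, hc⟩) (fun h => hc0 (congrArg Subtype.val h))
    refine absurd ?_ (maxHomIdeal_isMaximal (𝒜 := 𝒜) hneg).ne_top
    rw [Ideal.eq_top_iff_one]
    have h1 : c * b = 1 := congrArg Subtype.val hb
    rw [← h1]
    exact Ideal.mul_mem_right _ _ hcm

/-- The Pfaffian ideal lies in a power of the maximal homogeneous ideal. -/
lemma vacIdeal_le_pow {ι : Type} [Fintype ι] [LinearOrder ι] {φ : Matrix ι ι R}
    (h0 : ∀ i, φ i i = 0) (h1 : ∀ i j, φ j i = - φ i j) (J : Ideal R) (hJ : ∀ i j, φ i j ∈ J)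
    {q k : ℕ} (hk : q + 2 * k ≤ Fintype.card ι) : vacIdeal φ q ≤ J ^ k := by
  refine Ideal.span_le.2 ?_
  rintro _ ⟨B, hB, rfl⟩
  have h : vac φ B ∈ J ^ (Bᶜ.card / 2) :=
    (vac_isVac h0 h1).induction (fun k a => a ∈ J ^ (k / 2))
      (fun k => zero_mem _) (fun k a b => add_mem) (fun k a => neg_mem) (fun k i j a ha => by
        rw [show (k + 2) / 2 = k / 2 + 1 by omega, pow_succ']
        exact Ideal.mul_mem_mul (hJ i j) ha) (by simp) B
  refine Ideal.pow_le_pow_right ?_ h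
  have := Finset.card_add_card_compl B
  omega

end PolynomialRing

variable {R : Type} [CommRing R]

theorem statement16
    (𝒜 : ℤ → AddSubgroup R) [GradedRing 𝒜]
    (hNoeth : IsNoetherianRing R)
    (hnonneg : ∀ i : ℤ, i < 0 → 𝒜 i = ⊥)
    -- `R₀` is a local Cohen–Macaulay ring
    (hloc : IsLocalRing ↥(𝒜 0))
    (hR0CM : ∃ d₀ : ℕ, ringKrullDim ↥(𝒜 0) = (d₀ : WithBot (WithTop ℕ)) ∧
      (Subsingleton ↥(𝒜 0) ∨ ∃ rs : List ↥(𝒜 0), rs.length = d₀ ∧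
        (∀ r ∈ rs, ¬ IsUnit r) ∧ RingTheory.Sequence.IsRegular ↥(𝒜 0) rs))
    -- `3 ≤ d ≤ n`, `n` odd, `d` even, `dim R = d`
    (d n : ℕ) (hd3 : 3 ≤ d) (hdn : d ≤ n) (hnodd : Odd n) (hdeven : Even d)
    (hdim : ringKrullDim R = (d : WithBot (WithTop ℕ)))
    -- `R` is Gorenstein: Cohen–Macaulay of type one
    (hCM : depthGE (maxHomIdeal 𝒜) R d)
    (hGor : Nonempty ((extModule R (R ⧸ maxHomIdeal 𝒜) R d) ≃ₗ[R] (R ⧸ maxHomIdeal 𝒜)))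
    -- `φ` is an `n × n` alternating matrix of linear forms
    (φ : Matrix (Fin n) (Fin n) R) (halt : IsAlternating φ)
    (hlin : ∀ i j, φ i j ∈ 𝒜 1)
    -- `I = Pf_{n-1}(φ)` has height three
    (hht : idealHeight (pfaffianIdeal n (n - 1) φ) = 3)
    -- and `n − i ≤ ht I_i(φ)` for `n − d ≤ i ≤ n − 1`
    (hF : ∀ i : ℕ, (n : ℤ) - d ≤ i → (i : ℤ) ≤ (n : ℤ) - 1 →
      ((n - i : ℕ) : ℕ∞) ≤ idealHeight (minorsIdeal n i φ)) :
    -- (a) `ann_R H⁰_𝔪(Sym_{d-1}(I)) = Pf_{n-d+1}(φ)`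
    (Module.annihilator R
        ↥(torsionSubmodule (maxHomIdeal 𝒜)
          (SymPow (R := R) ↥(pfaffianIdeal n (n - 1) φ) (d - 1))) =
      pfaffianIdeal n (n - d + 1) φ)
    -- (b) if `R` is a standard graded polynomial ring over a field, then
    --     `Pf_{n-d+1}(φ) = 𝔪^{(n-d+1)/2}`
    ∧ (∀ x : Fin d → R, (∀ i, x i ∈ 𝒜 1) →
        Function.Bijective
          (MvPolynomial.eval₂Hom (SetLike.GradeZero.subring 𝒜).subtype x) →
        IsField ↥(𝒜 0) →
        pfaffianIdeal n (n - d + 1) φ = (maxHomIdeal 𝒜) ^ ((n - d + 1) / 2)) := by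
  obtain ⟨h0, h1⟩ := halt
  obtain ⟨q, rfl⟩ : ∃ q, d = q + 1 := ⟨d - 1, by omega⟩
  have hq : Odd q := by
    rw [← Nat.not_even_iff_odd]
    exact fun h => Nat.not_even_iff_odd.2 h.add_one hdeven
  have hpar : Even (n + q) := hnodd.add_odd hq
  have hI : pfaffianIdeal n (n - 1) φ = vacIdeal φ 1 :=
    pfaffianIdeal_eq_vacIdeal h0 h1 (by omega) hnodd.add_one
  have hJ : pfaffianIdeal n (n - (q + 1) + 1) φ = vacIdeal φ q := by
    rw [show n - (q + 1) + 1 = n - q by omega]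
    exact pfaffianIdeal_eq_vacIdeal h0 h1 (by omega) hpar
  have hht' : 3 ≤ idealHeight (vacIdeal φ 1) := by rw [← hI, hht]
  have hodd : Odd (Fintype.card (Fin n)) := by rwa [Fintype.card_fin]
  have hann := annihilator_torsion hnonneg hd3 hdn hnodd hq hdim hCM hGor h0 h1 hlin hht' hF hI
  rw [hJ]
  refine ⟨hann, fun x hx hbij hfield => ?_⟩
  obtain ⟨k, hk⟩ : ∃ k, n = q + 2 * k := by
    obtain ⟨u, hu⟩ := hpar
    exact ⟨u - q, by omega⟩
  rw [show (n - (q + 1) + 1) / 2 = k by omega]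
  refine le_antisymm (vacIdeal_le_pow h0 h1 _
    (fun i j => mem_maxHomIdeal_of_ne one_ne_zero (hlin i j)) (by rw [Fintype.card_fin, hk])) ?_
  intro r hr
  rw [← hann, mem_annihilator_torsion_iff h0 h1 hodd hq
    (linE_mem_range_of_height hnonneg hd3 hdn hnodd hq hdim hCM h0 h1 hlin hht' hF) hI]
  rintro m ⟨t, ht⟩
  have hmax := maxHomIdeal_eq_initIdeal hnonneg hx hbij hfield
  rw [hmax] at ht hr
  refine smul_mem_range_of_mem_pow hnonneg h0 h1 hlin hodd hq
    (exactAt_dE_of_height hnonneg hdn hnodd hq hdim hCM h0 h1 hlin hF)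
    (fun i hi => ?_) (wreg_extendZero hbij) (fun c hc s hs => ?_) m ht
    (by rw [Fintype.card_fin, hk]) hr
  · rw [extendZero, dif_pos hi]
    exact hx _
  · rw [← hmax]
    exact mem_maxHomIdeal_of_ne hc.ne' hs

end Paper
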